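/- In the renormalization setting: for every y > 0, the shifted profile at the later crossing time lies strictly below the profile at the earlier crossing time, namely u(x, t_y) > u(x+1, t_{y+1}) for all x < y, while u(x, t_y) = u(x+1, t_{y+1}) = 0 for all x ≥ y. -/

import Mathlib

open MeasureTheory Set Filter

noncomputable section

/-- Condition (F1): `f` and `κ` are `C²`, 1-periodic in `x`, `f(x,0)=0`, and there is `θ > 0`
with `f(x,u) > 0` for `u > θ` and `κ(x) > θ`. -/
def CondF1 (f : ℝ → ℝ → ℝ) (κ : ℝ → ℝ) (θ : ℝ) : Prop :=
  ContDiff ℝ 2 (Function.uncurry f) ∧ ContDiff ℝ 2 κ ∧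
  (∀ x u, f (x + 1) u = f x u) ∧ (∀ x, κ (x + 1) = κ x) ∧
  (∀ x, f x 0 = 0) ∧ 0 < θ ∧ (∀ x u, θ < u → 0 < f x u) ∧ (∀ x, θ < κ x)

/-- `κ₀ := min κ` (over a period). -/
def kappaMin (κ : ℝ → ℝ) : ℝ := sInf (κ '' Icc 0 1)

/-- `κ⁰ := max κ` (over a period). -/
def kappaMax (κ : ℝ → ℝ) : ℝ := sSup (κ '' Icc 0 1)

/-- Condition (F2): existence of a compactly supported traveling subsolution profile `φ₀`
with speed `c₀`. -/
def CondF2 (m : ℝ) (f : ℝ → ℝ → ℝ) (κ : ℝ → ℝ) (c₀ l₀ : ℝ) (φ₀ : ℝ → ℝ) : Prop :=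
  0 < c₀ ∧ 0 < l₀ ∧ ContDiffOn ℝ 2 φ₀ (Icc (-l₀) l₀) ∧
  φ₀ (-l₀) = 0 ∧ φ₀ l₀ = 0 ∧ (∀ z ∈ Ioo (-l₀) l₀, 0 < φ₀ z) ∧
  c₀ < -(derivWithin φ₀ (Icc (-l₀) l₀) l₀) ∧
  ∀ (x : ℝ), ∀ z ∈ Icc (-l₀) l₀,
    0 ≤ derivWithin (derivWithin (fun w => φ₀ w ^ m) (Icc (-l₀) l₀)) (Icc (-l₀) l₀) z
        + c₀ * derivWithin φ₀ (Icc (-l₀) l₀) z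
        + f x (φ₀ z) * (κ x - φ₀ z)

/-- A (bounded, continuous) very weak solution of `u_t = (u^m)_{xx} + f(x,u)(κ(x)-u)`
on `ℝ × (0,τ)` with initial data `u₀`. -/
def VeryWeakSol (m : ℝ) (f : ℝ → ℝ → ℝ) (κ : ℝ → ℝ) (τ : ℝ)
    (u₀ : ℝ → ℝ) (u : ℝ → ℝ → ℝ) : Prop :=
  ContinuousOn (fun q : ℝ × ℝ => u q.1 q.2) (univ ×ˢ Ioc (0:ℝ) τ) ∧
  (∃ M : ℝ, ∀ x : ℝ, ∀ t ∈ Ioc (0:ℝ) τ, |u x t| ≤ M) ∧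
  ∀ φ : ℝ → ℝ → ℝ, ContDiff ℝ (⊤ : ℕ∞) (Function.uncurry φ) →
    HasCompactSupport (Function.uncurry φ) →
    ∫ x : ℝ, u x τ * φ x τ =
      (∫ x : ℝ, u₀ x * φ x 0)
      + (∫ t in Ioo (0:ℝ) τ, ∫ x : ℝ, f x (u x t) * (κ x - u x t) * φ x t)
      + (∫ t in Ioo (0:ℝ) τ, ∫ x : ℝ,
          (u x t * deriv (fun s => φ x s) t + u x t ^ m * deriv (deriv (fun y => φ y t)) x))

/-- A global very weak solution: a very weak solution on `ℝ × (0,τ)` for every `τ > 0`. -/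
def GlobalVeryWeakSol (m : ℝ) (f : ℝ → ℝ → ℝ) (κ : ℝ → ℝ)
    (u₀ : ℝ → ℝ) (u : ℝ → ℝ → ℝ) : Prop :=
  ∀ τ > (0:ℝ), VeryWeakSol m f κ τ u₀ u

/-- Left spatial derivative of the pressure `v = (m/(m-1)) u^{m-1}` at the point `z`
(at time `t`). -/
def pressureDx (m : ℝ) (u : ℝ → ℝ → ℝ) (z t : ℝ) : ℝ :=
  derivWithin (fun y => (m / (m - 1)) * u y t ^ (m - 1)) (Iic z) z

/-- The renormalization setting: (F1), (F2), a positive 1-periodic stationary solution `p`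
with `p ≥ κ₀` lying strictly above all translates of `φ₀`, a global very weak solution `u`
with Heaviside-type initial data `p·H(-x)` possessing a `C¹`, strictly increasing free
boundary `b → ∞` along which Darcy's law holds with nonnegative speed, and the crossing
times `ty y` defined by `b (ty y) = y` for `y > 0`. -/
def RenormSetting (m : ℝ) (f : ℝ → ℝ → ℝ) (κ : ℝ → ℝ) (θ c₀ l₀ : ℝ) (φ₀ p : ℝ → ℝ)
    (u : ℝ → ℝ → ℝ) (b : ℝ → ℝ) (ty : ℝ → ℝ) : Prop :=
  CondF1 f κ θ ∧ CondF2 m f κ c₀ l₀ φ₀ ∧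
  ContDiff ℝ 2 p ∧ (∀ x, 0 < p x) ∧ (∀ x, p (x + 1) = p x) ∧
  (∀ x, deriv (deriv (fun y => p y ^ m)) x + f x (p x) * (κ x - p x) = 0) ∧
  (∀ x, kappaMin κ ≤ p x) ∧
  (∀ x₀ : ℝ, ∀ x ∈ Icc (x₀ - l₀) (x₀ + l₀), φ₀ (x - x₀) < p x) ∧
  GlobalVeryWeakSol m f κ (fun x => if x ≤ 0 then p x else 0) u ∧
  (∀ t > (0:ℝ), DifferentiableAt ℝ b t) ∧
  ContinuousOn (deriv b) (Ioi 0) ∧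
  (∀ t > (0:ℝ), ∀ x : ℝ, (x < b t → 0 < u x t) ∧ (b t ≤ x → u x t = 0)) ∧
  StrictMonoOn b (Ioi 0) ∧
  Tendsto b atTop atTop ∧
  (∀ x t : ℝ, 0 < t → 0 < u x t →
      DifferentiableAt ℝ (fun s => u x s) t ∧
      DifferentiableAt ℝ (fun y => u y t) x ∧
      DifferentiableAt ℝ (deriv (fun y => u y t)) x) ∧
  (∀ t > (0:ℝ), deriv b t = -(pressureDx m u (b t) t) ∧ 0 ≤ deriv b t) ∧
  (∀ y > (0:ℝ), 0 < ty y ∧ b (ty y) = y)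

/-- Centred second difference quotient on a lattice of mesh `Δ`. -/
def secondDiff (Δ : ℝ) (φ : ℤ → ℝ) (j : ℤ) : ℝ :=
  (φ (j + 1) - 2 * φ j + φ (j - 1)) / Δ ^ 2

/-- One explicit Euler step of length `h` for `φ_τ = α φ_xx + c φ`. -/
def eulerStep (h Δ : ℝ) (α c φ : ℤ → ℝ) (j : ℤ) : ℝ :=
  φ j + h * (α j * secondDiff Δ φ j + c j * φ j)

/-- Stability conditions for the explicit Euler step. -/
structure StableMesh (h Δ K L : ℝ) : Prop where
  h_pos : 0 < h
  mesh_pos : 0 < Δ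
  mesh_le : Δ ≤ 1 / 2
  one_le : 1 ≤ K
  L_nonneg : 0 ≤ L
  cfl : 24 * (h * K) ≤ Δ ^ 2
  hL : 4 * (h * L) ≤ 1

/-- Bounds on the coefficients of the explicit Euler step. -/
structure BoundedCoeff (K L : ℝ) (α c : ℤ → ℝ) : Prop where
  nonneg : ∀ j, 0 ≤ α j
  le : ∀ j, α j ≤ K
  abs_le : ∀ j, |c j| ≤ L

theorem eulerStep_weights {h Δ K L : ℝ} (H : StableMesh h Δ K L) {α c : ℤ → ℝ}
    (hc : BoundedCoeff K L α c) (j : ℤ) :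
    ∃ l m : ℝ, 0 ≤ l ∧ l ≤ 1 / 24 ∧ 2 / 3 ≤ m ∧ m + 2 * l ≤ 1 + h * L ∧
      ∀ φ, eulerStep h Δ α c φ j = m * φ j + l * (φ (j + 1) + φ (j - 1)) := by
  have h0 := H.h_pos
  have hΔ : 0 < Δ ^ 2 := pow_pos H.mesh_pos 2
  have hcj := abs_le.1 (hc.abs_le j)
  have e1 : h * c j ≤ h * L := mul_le_mul_of_nonneg_left hcj.2 h0.le
  have e2 : h * (-L) ≤ h * c j := mul_le_mul_of_nonneg_left hcj.1 h0.le
  have e3 : h * α j / Δ ^ 2 ≤ 1 / 24 := by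
    rw [div_le_iff₀ hΔ]
    have := mul_le_mul_of_nonneg_left (hc.le j) h0.le
    linarith [H.cfl]
  have e4 : 0 ≤ h * α j / Δ ^ 2 := by
    have := hc.nonneg j
    positivity
  refine ⟨h * α j / Δ ^ 2, 1 - 2 * (h * α j / Δ ^ 2) + h * c j, e4, e3, ?_, ?_, ?_⟩
  · linarith [H.hL]
  · linarith
  · intro φ
    unfold eulerStep secondDiff
    field_simp
    ring

theorem eulerStep_nonneg {h Δ K L : ℝ} (H : StableMesh h Δ K L) {α c : ℤ → ℝ}
    (hc : BoundedCoeff K L α c) {φ : ℤ → ℝ} (hφ : ∀ j, 0 ≤ φ j) (j : ℤ) :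
    0 ≤ eulerStep h Δ α c φ j := by
  obtain ⟨l, m, hl, _, hm, _, he⟩ := eulerStep_weights H hc j
  rw [he]
  have := hφ j; have := hφ (j + 1); have := hφ (j - 1)
  positivity

theorem eulerStep_mono {h Δ K L : ℝ} (H : StableMesh h Δ K L) {α c : ℤ → ℝ}
    (hc : BoundedCoeff K L α c) {φ χ : ℤ → ℝ} (hφ : ∀ j, φ j ≤ χ j) (j : ℤ) :
    eulerStep h Δ α c φ j ≤ eulerStep h Δ α c χ j := by
  obtain ⟨l, m, hl, _, hm, _, he⟩ := eulerStep_weights H hc j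
  rw [he, he]
  have := hφ j; have := hφ (j + 1); have := hφ (j - 1)
  gcongr

/-- The `2 × 2` minor of a pair of sequences. -/
def minor (φ χ : ℤ → ℝ) (i j : ℤ) : ℝ := φ i * χ j - φ j * χ i

theorem minor_self (φ χ : ℤ → ℝ) (i : ℤ) : minor φ χ i i = 0 := by
  unfold minor; ring

theorem minor_eulerStep_nonneg {h Δ K L : ℝ} (H : StableMesh h Δ K L) {α c : ℤ → ℝ}
    (hc : BoundedCoeff K L α c) {φ χ : ℤ → ℝ} (hD : ∀ i j, i < j → 0 ≤ minor φ χ i j)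
    {i j : ℤ} (hij : i < j) :
    0 ≤ minor (eulerStep h Δ α c φ) (eulerStep h Δ α c χ) i j := by
  obtain ⟨l, m, hl, hl', hm, _, he⟩ := eulerStep_weights H hc i
  obtain ⟨l', m', hl2, hl2', hm2, _, he'⟩ := eulerStep_weights H hc j
  have hD' : ∀ i j, i ≤ j → 0 ≤ minor φ χ i j := by
    intro i j hij
    rcases hij.eq_or_lt with rfl | h
    · rw [minor_self]
    · exact hD i j h
  have key : minor (eulerStep h Δ α c φ) (eulerStep h Δ α c χ) i j
      = m * m' * minor φ χ i j + m * l' * (minor φ χ i (j + 1) + minor φ χ i (j - 1))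
        + l * m' * (minor φ χ (i + 1) j + minor φ χ (i - 1) j)
        + l * l' * (minor φ χ (i + 1) (j + 1) + minor φ χ (i + 1) (j - 1)
          + minor φ χ (i - 1) (j + 1) + minor φ χ (i - 1) (j - 1)) := by
    unfold minor
    rw [he, he, he', he']
    ring
  have a1 := hD' i j (by lia)
  have a2 := hD' i (j + 1) (by lia)
  have a3 := hD' i (j - 1) (by lia)
  have a4 := hD' (i + 1) j (by lia)
  have a5 := hD' (i - 1) j (by lia)
  have a6 := hD' (i + 1) (j + 1) (by lia)
  have a7 := hD' (i - 1) (j + 1) (by lia)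
  have a8 := hD' (i - 1) (j - 1) (by lia)
  have hmm : (0:ℝ) ≤ m * m' - l * l' := by nlinarith
  have hm0 : 0 ≤ m := by linarith
  have hm0' : 0 ≤ m' := by linarith
  by_cases hj : j = i + 1
  · subst hj
    have e1 : minor φ χ (i + 1) (i + 1 - 1) = - minor φ χ i (i + 1) := by
      unfold minor; rw [add_sub_cancel_right]; ring
    have : minor (eulerStep h Δ α c φ) (eulerStep h Δ α c χ) i (i + 1)
      = (m * m' - l * l') * minor φ χ i (i + 1)
        + m * l' * (minor φ χ i (i + 1 + 1) + minor φ χ i (i + 1 - 1))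
        + l * m' * (minor φ χ (i + 1) (i + 1) + minor φ χ (i - 1) (i + 1))
        + l * l' * (minor φ χ (i + 1) (i + 1 + 1)
          + minor φ χ (i - 1) (i + 1 + 1) + minor φ χ (i - 1) (i + 1 - 1)) := by
      rw [key, e1]; ring
    rw [this]
    positivity
  · have a9 := hD' (i + 1) (j - 1) (by lia)
    rw [key]
    positivity

/-- A product of separated subsolutions remains below the minor, up to an additive error. -/
theorem minor_eulerStep_lower {h Δ K L : ℝ} (H : StableMesh h Δ K L) {α c : ℤ → ℝ}
    (hc : BoundedCoeff K L α c) {φ χ F G F' G' : ℤ → ℝ} {E e B : ℝ}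
    (hE : 0 ≤ E) (he0 : 0 ≤ e)
    (hD : ∀ i j, i < j → 0 ≤ minor φ χ i j)
    (hF : ∀ j, 0 ≤ F j) (hG : ∀ j, 0 ≤ G j)
    (hF' : ∀ j, 0 ≤ F' j) (hG' : ∀ j, 0 ≤ G' j) (hFB : ∀ j, F' j ≤ B) (hGB : ∀ j, G' j ≤ B)
    (hsep : ∀ i j, j ≤ i + 1 → F i * G j = 0) (hsep' : ∀ i j, j ≤ i + 1 → F' i * G' j = 0)
    (hFs : ∀ j, F' j - h * e ≤ eulerStep h Δ α c F j)
    (hGs : ∀ j, G' j - h * e ≤ eulerStep h Δ α c G j)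
    (hDl : ∀ i j, i < j → F i * G j - E ≤ minor φ χ i j) {i j : ℤ} (hij : i < j) :
    F' i * G' j - ((1 + h * L) ^ 2 * E + h * (2 * B * e)) ≤
      minor (eulerStep h Δ α c φ) (eulerStep h Δ α c χ) i j := by
  have h0 := H.h_pos
  have hB : 0 ≤ B := (hF' 0).trans (hFB 0)
  by_cases hj : j ≤ i + 1
  · rw [hsep' i j hj]
    have := minor_eulerStep_nonneg H hc hD hij
    have : 0 ≤ (1 + h * L) ^ 2 * E + h * (2 * B * e) := by positivity
    linarith
  obtain ⟨l, m, hl, hl', hm, hml, he⟩ := eulerStep_weights H hc i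
  obtain ⟨l', m', hl2, hl2', hm2, hml2, he'⟩ := eulerStep_weights H hc j
  have hm0 : 0 ≤ m := by linarith
  have hm0' : 0 ≤ m' := by linarith
  have hDl' : ∀ i j, i ≤ j → F i * G j - E ≤ minor φ χ i j := by
    intro i j hij
    rcases hij.eq_or_lt with rfl | h
    · rw [minor_self, hsep i i (by lia)]; linarith
    · exact hDl i j h
  have key : minor (eulerStep h Δ α c φ) (eulerStep h Δ α c χ) i j
      = m * m' * minor φ χ i j + m * l' * (minor φ χ i (j + 1) + minor φ χ i (j - 1))
        + l * m' * (minor φ χ (i + 1) j + minor φ χ (i - 1) j)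
        + l * l' * (minor φ χ (i + 1) (j + 1) + minor φ χ (i + 1) (j - 1)
          + minor φ χ (i - 1) (j + 1) + minor φ χ (i - 1) (j - 1)) := by
    unfold minor
    rw [he, he, he', he']
    ring
  have low : eulerStep h Δ α c F i * eulerStep h Δ α c G j - (m + 2 * l) * (m' + 2 * l') * E ≤
      minor (eulerStep h Δ α c φ) (eulerStep h Δ α c χ) i j := by
    rw [key, he, he']
    calc _ = m * m' * (F i * G j - E) + m * l' * ((F i * G (j + 1) - E) + (F i * G (j - 1) - E))
        + l * m' * ((F (i + 1) * G j - E) + (F (i - 1) * G j - E))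
        + l * l' * ((F (i + 1) * G (j + 1) - E) + (F (i + 1) * G (j - 1) - E)
          + (F (i - 1) * G (j + 1) - E) + (F (i - 1) * G (j - 1) - E)) := by ring
      _ ≤ _ := by
        gcongr <;> exact hDl' _ _ (by lia)
  have q1 : (m + 2 * l) * (m' + 2 * l') * E ≤ (1 + h * L) ^ 2 * E := by
    rw [sq]
    gcongr
    have := H.L_nonneg
    positivity
  have q2 : F' i * G' j - h * (2 * B * e) ≤ eulerStep h Δ α c F i * eulerStep h Δ α c G j := by
    have s1 := hFs i
    have s2 := hGs j
    have p1 := eulerStep_nonneg H hc hF i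
    have p2 := eulerStep_nonneg H hc hG j
    have he1 : 0 ≤ h * e := by positivity
    have t1 := hF' i; have t2 := hG' j; have t3 := hFB i; have t4 := hGB j
    set X := eulerStep h Δ α c F i
    set Y := eulerStep h Δ α c G j
    have u1 : (F' i - h * e) * G' j ≤ X * G' j := mul_le_mul_of_nonneg_right s1 t2
    have u2 : X * (G' j - h * e) ≤ X * Y := mul_le_mul_of_nonneg_left s2 p1
    have u3 : h * e * G' j ≤ h * e * B := mul_le_mul_of_nonneg_left t4 he1
    rcases le_total X B with hX | hX
    · have u4 : h * e * X ≤ h * e * B := mul_le_mul_of_nonneg_left hX he1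
      nlinarith
    · have u5 : F' i * G' j ≤ B * G' j := mul_le_mul_of_nonneg_right t3 t2
      have u6 : B * Y ≤ X * Y := mul_le_mul_of_nonneg_right hX p2
      have u7 : B * (G' j - h * e) ≤ B * Y := mul_le_mul_of_nonneg_left s2 hB
      nlinarith
  linarith

/-- The discrete weight `exp (-μ |j| Δ)` is almost a supersolution. -/
theorem secondDiff_exp_le {Δ μ : ℝ} (hΔ : 0 < Δ) (hμ : 0 ≤ μ) (hμΔ : μ * Δ ≤ 1) (j : ℤ) :
    secondDiff Δ (fun j : ℤ => Real.exp (-(μ * (|(j:ℝ)| * Δ)))) j ≤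
      2 * μ ^ 2 * Real.exp (-(μ * (|(j:ℝ)| * Δ))) := by
  have hx : 0 ≤ μ * Δ := by positivity
  have b1 : Real.exp (μ * Δ) ≤ 1 + μ * Δ + (μ * Δ) ^ 2 := by
    have := Real.abs_exp_sub_one_sub_id_le (x := μ * Δ) (by rwa [abs_of_nonneg hx])
    linarith [(abs_le.1 this).2]
  have b2 : Real.exp (-(μ * Δ)) ≤ 1 - μ * Δ + (μ * Δ) ^ 2 := by
    have := Real.abs_exp_sub_one_sub_id_le (x := -(μ * Δ)) (by rwa [abs_neg, abs_of_nonneg hx])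
    have := (abs_le.1 this).2
    nlinarith
  unfold secondDiff
  rw [div_le_iff₀ (by positivity)]
  rcases lt_trichotomy j 0 with hj | rfl | hj
  · have h1 : |((j + 1 : ℤ) : ℝ)| = |(j:ℝ)| - 1 := by
      have : ((j+1 : ℤ):ℝ) ≤ 0 := by exact_mod_cast hj
      rw [abs_of_nonpos this, abs_of_neg (by exact_mod_cast hj)]; push_cast; ring
    have h2 : |((j - 1 : ℤ) : ℝ)| = |(j:ℝ)| + 1 := by
      have : ((j-1 : ℤ):ℝ) ≤ 0 := by exact_mod_cast (by lia)
      rw [abs_of_nonpos this, abs_of_neg (by exact_mod_cast hj)]; push_cast; ring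
    beta_reduce
    rw [h1, h2]
    have e1 : Real.exp (-(μ * ((|(j:ℝ)| - 1) * Δ))) =
        Real.exp (-(μ * (|(j:ℝ)| * Δ))) * Real.exp (μ * Δ) := by
      rw [← Real.exp_add]; ring_nf
    have e2 : Real.exp (-(μ * ((|(j:ℝ)| + 1) * Δ))) =
        Real.exp (-(μ * (|(j:ℝ)| * Δ))) * Real.exp (-(μ * Δ)) := by
      rw [← Real.exp_add]; ring_nf
    rw [e1, e2]
    have := Real.exp_pos (-(μ * (|(j:ℝ)| * Δ)))
    nlinarith
  · simp only [zero_add, zero_sub, Int.cast_one, Int.cast_neg, Int.cast_zero, abs_zero, abs_neg,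
      abs_one, one_mul, zero_mul, mul_zero, neg_zero, Real.exp_zero, mul_one]
    nlinarith
  · have h1 : |((j + 1 : ℤ) : ℝ)| = |(j:ℝ)| + 1 := by
      have : (0:ℝ) ≤ ((j+1 : ℤ):ℝ) := by exact_mod_cast (by lia)
      rw [abs_of_nonneg this, abs_of_pos (by exact_mod_cast hj)]; push_cast; ring
    have h2 : |((j - 1 : ℤ) : ℝ)| = |(j:ℝ)| - 1 := by
      have : (0:ℝ) ≤ ((j-1 : ℤ):ℝ) := by exact_mod_cast (by lia)
      rw [abs_of_nonneg this, abs_of_pos (by exact_mod_cast hj)]; push_cast; ring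
    beta_reduce
    rw [h1, h2]
    have e1 : Real.exp (-(μ * ((|(j:ℝ)| - 1) * Δ))) =
        Real.exp (-(μ * (|(j:ℝ)| * Δ))) * Real.exp (μ * Δ) := by
      rw [← Real.exp_add]; ring_nf
    have e2 : Real.exp (-(μ * ((|(j:ℝ)| + 1) * Δ))) =
        Real.exp (-(μ * (|(j:ℝ)| * Δ))) * Real.exp (-(μ * Δ)) := by
      rw [← Real.exp_add]; ring_nf
    rw [e1, e2]
    have := Real.exp_pos (-(μ * (|(j:ℝ)| * Δ)))
    nlinarith

theorem eulerStep_le_exp {h Δ K L : ℝ} (H : StableMesh h Δ K L) {α c : ℤ → ℝ}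
    (hc : BoundedCoeff K L α c) {φ : ℤ → ℝ} {B : ℝ} (hB : 0 ≤ B)
    (hφ : ∀ j : ℤ, φ j ≤ B * Real.exp (-(2 * (|(j:ℝ)| * Δ)))) (j : ℤ) :
    eulerStep h Δ α c φ j ≤
      (1 + h * (8 * K + L)) * B * Real.exp (-(2 * (|(j:ℝ)| * Δ))) := by
  refine (eulerStep_mono H hc hφ j).trans ?_
  have h1 := secondDiff_exp_le (μ := 2) H.mesh_pos (by norm_num) (by linarith [H.mesh_le]) j
  set ω : ℤ → ℝ := fun j : ℤ => Real.exp (-(2 * (|(j:ℝ)| * Δ))) with hω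
  have e1 : eulerStep h Δ α c (fun j => B * ω j) j =
      B * (ω j + h * (α j * secondDiff Δ ω j + c j * ω j)) := by
    unfold eulerStep secondDiff; ring
  have hωj : 0 < ω j := Real.exp_pos _
  have h2 : α j * secondDiff Δ ω j ≤ K * (8 * ω j) := by
    calc α j * secondDiff Δ ω j ≤ α j * (8 * ω j) := by
          refine mul_le_mul_of_nonneg_left ?_ (hc.nonneg j)
          refine h1.trans (le_of_eq ?_); norm_num [hω]
      _ ≤ _ := by have := hc.le j; gcongr
  have h3 : c j * ω j ≤ L * ω j := by
    have := (abs_le.1 (hc.abs_le j)).2; gcongr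
  calc _ = _ := e1
    _ ≤ B * (ω j + h * (K * (8 * ω j) + L * ω j)) := by
      have := H.h_pos
      gcongr
    _ = _ := by simp only [hω]; ring

/-- A lattice function with bounded support. -/
def BddSupp (φ : ℤ → ℝ) : Prop := ∃ J : ℤ, ∀ j, J < |j| → φ j = 0

theorem BddSupp.finite {φ : ℤ → ℝ} (h : BddSupp φ) : φ.support.Finite := by
  obtain ⟨J, hJ⟩ := h
  refine (Set.finite_Icc (-J) J).subset fun j hj => ?_
  have : |j| ≤ J := by
    by_contra hc
    exact hj (hJ j (not_le.1 hc))
  exact abs_le.1 this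

/-- Bounded support passes to functions depending on three neighbouring values. -/
theorem BddSupp.of_neighbours {φ f : ℤ → ℝ} (h : BddSupp φ)
    (hf : ∀ j, φ (j + 1) = 0 → φ j = 0 → φ (j - 1) = 0 → f j = 0) : BddSupp f := by
  obtain ⟨J, hJ⟩ := h
  refine ⟨J + 1, fun j hj => hf j (hJ _ ?_) (hJ _ ?_) (hJ _ ?_)⟩
  · rw [lt_abs] at *; lia
  · rw [lt_abs] at *; lia
  · rw [lt_abs] at *; lia

theorem BddSupp.of_zero {φ f : ℤ → ℝ} (h : BddSupp φ)
    (hf : ∀ j, φ j = 0 → f j = 0) : BddSupp f :=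
  h.of_neighbours fun j _ h _ => hf j h

theorem BddSupp.eulerStep {h Δ : ℝ} {α c φ : ℤ → ℝ} (hφ : BddSupp φ) :
    BddSupp (eulerStep h Δ α c φ) :=
  hφ.of_neighbours fun j h1 h2 h3 => by
    unfold _root_.eulerStep secondDiff; rw [h1, h2, h3]; ring

theorem BddSupp.add {f g : ℤ → ℝ} (hf : BddSupp f) (hg : BddSupp g) :
    BddSupp fun j => f j + g j := by
  obtain ⟨J, hJ⟩ := hf
  obtain ⟨J', hJ'⟩ := hg
  exact ⟨max J J', fun j hj => by
    beta_reduce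
    rw [hJ j ((le_max_left _ _).trans_lt hj), hJ' j ((le_max_right _ _).trans_lt hj), add_zero]⟩

theorem BddSupp.neg {f : ℤ → ℝ} (hf : BddSupp f) : BddSupp fun j => -f j :=
  hf.of_zero fun j h => by rw [h, neg_zero]

theorem BddSupp.sub {f g : ℤ → ℝ} (hf : BddSupp f) (hg : BddSupp g) :
    BddSupp fun j => f j - g j := by
  simpa only [sub_eq_add_neg] using hf.add hg.neg

theorem BddSupp.const_mul {f : ℤ → ℝ} (r : ℝ) (hf : BddSupp f) : BddSupp fun j => r * f j :=
  hf.of_zero fun j h => by rw [h, mul_zero]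

theorem BddSupp.mul_left {f : ℤ → ℝ} (g : ℤ → ℝ) (hf : BddSupp f) : BddSupp fun j => g j * f j :=
  hf.of_zero fun j h => by rw [h, mul_zero]

theorem BddSupp.shift {f : ℤ → ℝ} (hf : BddSupp f) : BddSupp fun j => f (j + 1) :=
  hf.of_neighbours fun _ h _ _ => h

theorem BddSupp.shift' {f : ℤ → ℝ} (hf : BddSupp f) : BddSupp fun j => f (j - 1) :=
  hf.of_neighbours fun _ _ _ h => h

theorem BddSupp.summable {f : ℤ → ℝ} (hf : BddSupp f) : Summable f :=
  summable_of_hasFiniteSupport hf.finite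

theorem tsum_le_of_telescoping {f F g : ℤ → ℝ} (hf : BddSupp f) (hF : BddSupp F)
    (hg : BddSupp g) (h : ∀ j, f j ≤ F j + (g (j + 1) - g j)) :
    ∑' j, f j ≤ ∑' j, F j := by
  have s1 := hf.summable
  have s2 := hF.summable
  have s3 := hg.summable
  have s4 := hg.shift.summable
  have e : ∑' j, g (j + 1) = ∑' j, g j := (Equiv.addRight (1:ℤ)).tsum_eq g
  calc ∑' j, f j ≤ ∑' j, (F j + (g (j + 1) - g j)) := s1.tsum_le_tsum h (s2.add (s4.sub s3))
    _ = _ := by rw [s2.tsum_add (s4.sub s3), s4.tsum_sub s3, e]; ring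

theorem tsum_eq_of_telescoping {f F g : ℤ → ℝ} (hf : BddSupp f) (hF : BddSupp F)
    (hg : BddSupp g) (h : ∀ j, f j = F j + (g (j + 1) - g j)) :
    ∑' j, f j = ∑' j, F j :=
  le_antisymm (tsum_le_of_telescoping hf hF hg fun j => (h j).le)
    (tsum_le_of_telescoping hF hf hg.neg fun j => by rw [h j]; linarith)

/-- Forward difference quotient. -/
def diffQuot (Δ : ℝ) (φ : ℤ → ℝ) (j : ℤ) : ℝ := (φ (j + 1) - φ j) / Δ

/-- Exponentially growing lattice weight. -/
def expWeight (Δ : ℝ) (j : ℤ) : ℝ := Real.exp (|(j:ℝ)| * Δ)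

theorem expWeight_pos (Δ : ℝ) (j : ℤ) : 0 < expWeight Δ j := Real.exp_pos _

theorem expWeight_le {Δ : ℝ} (hΔ : 0 < Δ) (hΔ' : Δ ≤ 1 / 2) {i j : ℤ} (hij : |i - j| ≤ 1) :
    expWeight Δ i ≤ (1 + 2 * Δ) * expWeight Δ j := by
  unfold expWeight
  have h1 : |(i:ℝ)| ≤ |(j:ℝ)| + 1 := by
    have : |(i:ℝ) - j| ≤ 1 := by exact_mod_cast hij
    linarith [abs_sub_abs_le_abs_sub (i:ℝ) j]
  have h2 : Real.exp Δ ≤ 1 + 2 * Δ := by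
    have := Real.abs_exp_sub_one_sub_id_le (x := Δ) (by rw [abs_of_pos hΔ]; linarith)
    have := (abs_le.1 this).2
    nlinarith
  calc Real.exp (|(i:ℝ)| * Δ) ≤ Real.exp (Δ + |(j:ℝ)| * Δ) := by
        apply Real.exp_le_exp.2; nlinarith
    _ = Real.exp Δ * Real.exp (|(j:ℝ)| * Δ) := Real.exp_add _ _
    _ ≤ _ := by gcongr

theorem expWeight_le_two {Δ : ℝ} (hΔ : 0 < Δ) (hΔ' : Δ ≤ 1 / 2) {i j : ℤ} (hij : |i - j| ≤ 1) :
    expWeight Δ i ≤ 2 * expWeight Δ j := by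
  have := expWeight_le hΔ hΔ' hij
  have := expWeight_pos Δ j
  nlinarith

theorem abs_expWeight_sub_le {Δ : ℝ} (hΔ : 0 < Δ) (hΔ' : Δ ≤ 1 / 2) (j : ℤ) :
    |expWeight Δ j - expWeight Δ (j - 1)| ≤ 2 * Δ * expWeight Δ j := by
  have h1 := expWeight_le hΔ hΔ' (i := j) (j := j - 1) (by simp)
  have h2 := expWeight_le hΔ hΔ' (i := j - 1) (j := j) (by simp)
  have h3 := expWeight_pos Δ j
  rw [abs_le]
  constructor
  · linarith
  · have h4 : (1 - 2 * Δ) * expWeight Δ j ≤ expWeight Δ (j - 1) := by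
      have h5 : (1 - 2 * Δ) * (1 + 2 * Δ) ≤ 1 := by nlinarith
      have h6 : 0 ≤ 1 - 2 * Δ := by linarith
      calc (1 - 2 * Δ) * expWeight Δ j ≤ (1 - 2 * Δ) * ((1 + 2 * Δ) * expWeight Δ (j - 1)) := by
            gcongr
        _ = ((1 - 2 * Δ) * (1 + 2 * Δ)) * expWeight Δ (j - 1) := by ring
        _ ≤ 1 * expWeight Δ (j - 1) := by
            have := expWeight_pos Δ (j - 1); gcongr
        _ = _ := one_mul _
    linarith

/-- The weighted discrete Dirichlet energy dissipates second differences. -/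
theorem energy_eulerStep {h Δ K L η : ℝ} (H : StableMesh h Δ K L) {α c : ℤ → ℝ}
    (hc : BoundedCoeff K L α c) (hη : 0 < η) (hα : ∀ j, η ≤ α j) {φ : ℤ → ℝ} (hφ : BddSupp φ) :
    (∑' j, expWeight Δ j * diffQuot Δ (eulerStep h Δ α c φ) j ^ 2)
      + h * ∑' j, expWeight Δ j * (α j * secondDiff Δ φ j ^ 2) ≤
    (1 + h * (32 * K + 4 * L)) * (∑' j, expWeight Δ j * diffQuot Δ φ j ^ 2)
      + h * (4 * L ^ 2 / η + 2 * L + L ^ 2) * ∑' j, expWeight Δ j * φ j ^ 2 := by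
  have h0 := H.h_pos
  have hΔ := H.mesh_pos
  have hL := H.L_nonneg
  have hK : 0 < K := by linarith [H.one_le]
  set ρ := expWeight Δ with hρ
  set D := diffQuot Δ φ with hD
  set δ := secondDiff Δ φ with hδ
  set R : ℤ → ℝ := fun j => α j * δ j + c j * φ j with hR
  have bD : BddSupp D := hφ.of_neighbours fun j h1 h2 _ => by
    simp [hD, diffQuot, h1, h2]
  have bδ : BddSupp δ := hφ.of_neighbours fun j h1 h2 h3 => by
    simp [hδ, secondDiff, h1, h2, h3]
  have bR : BddSupp R := hφ.of_neighbours fun j h1 h2 h3 => by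
    simp [hR, hδ, secondDiff, h1, h2, h3]
  have bD' : BddSupp (diffQuot Δ (eulerStep h Δ α c φ)) :=
    (BddSupp.eulerStep (h := h) (Δ := Δ) (α := α) (c := c) hφ).of_neighbours fun j h1 h2 _ => by simp [diffQuot, h1, h2]
  have e1 : ∀ j, diffQuot Δ (eulerStep h Δ α c φ) j = D j + h * ((R (j + 1) - R j) / Δ) := by
    intro j
    simp only [diffQuot, eulerStep, hD, hR, hδ]
    field_simp
    ring
  have e2 : ∀ j, D j - D (j - 1) = Δ * δ j := by
    intro j
    simp only [hD, hδ, diffQuot, secondDiff, sub_add_cancel]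
    field_simp
    ring
  rw [← tsum_mul_left, ← tsum_mul_left, ← tsum_mul_left, ← Summable.tsum_add,
    ← Summable.tsum_add]
  rotate_left
  · exact ((bD.of_zero fun j h => by rw [h]; ring)).summable
  · exact ((hφ.of_zero fun j h => by rw [h]; ring)).summable
  · exact ((bD'.of_zero fun j h => by rw [h]; ring)).summable
  · exact ((bδ.of_zero fun j h => by rw [h]; ring)).summable
  have bDm := bD.shift'
  refine tsum_le_of_telescoping (g := fun j => 2 * h / Δ * (ρ (j - 1) * D (j - 1) * R j) +
      4 * h ^ 2 / Δ ^ 2 * (ρ j * R j ^ 2) - h * (32 * K + 4 * L) * (ρ (j - 1) * D (j - 1) ^ 2))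
      ?_ ?_ ?_ ?_
  · exact (bD'.of_zero fun j h => by rw [h]; ring).add (bδ.of_zero fun j h => by rw [h]; ring)
  · exact (bD.of_zero fun j h => by rw [h]; ring).add (hφ.of_zero fun j h => by rw [h]; ring)
  · exact ((bR.of_zero fun j h => by rw [h]; ring).add (bR.of_zero fun j h => by rw [h]; ring)).sub
      (bDm.of_zero fun j h => by rw [h]; ring)
  intro j
  rw [e1 j]
  have hρ0 : 0 < ρ j := expWeight_pos Δ j
  have hρp : ρ j ≤ 2 * ρ (j + 1) := expWeight_le_two hΔ H.mesh_le (by simp)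
  have hρm : ρ j ≤ 2 * ρ (j - 1) := expWeight_le_two hΔ H.mesh_le (by simp)
  have hρa : |ρ j - ρ (j - 1)| ≤ 2 * Δ * ρ j := abs_expWeight_sub_le hΔ H.mesh_le j
  have eD := e2 j
  have hRj : R j = α j * δ j + c j * φ j := rfl
  have hαj := hα j
  have hαK := hc.le j
  have hcj := hc.abs_le j
  simp only [add_sub_cancel_right]
  generalize R (j + 1) = Rp at *
  generalize R j = r at *
  generalize D (j - 1) = Dm at *
  generalize D j = d at *
  generalize δ j = s at *
  generalize ρ (j + 1) = ρp at *
  generalize ρ (j - 1) = ρm at *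
  generalize ρ j = ρ' at *
  generalize α j = a at *
  generalize c j = cc at *
  generalize φ j = y at *
  have ha0 : 0 ≤ a := hη.le.trans hαj
  have f1 : ρ' * (Rp - r) ^ 2 ≤ 4 * (ρp * Rp ^ 2) + 2 * (ρ' * r ^ 2) := by
    have : (Rp - r) ^ 2 ≤ 2 * Rp ^ 2 + 2 * r ^ 2 := by nlinarith [sq_nonneg (Rp + r)]
    have := mul_le_mul_of_nonneg_left this hρ0.le
    have := mul_le_mul_of_nonneg_right hρp (sq_nonneg Rp)
    linarith
  have f2 : -(2 * (cc * y * s)) ≤ 1 / 4 * (a * s ^ 2) + 4 * L ^ 2 / η * y ^ 2 := by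
    have g1 : -(cc * y * s) ≤ L * |y| * |s| := by
      calc -(cc * y * s) ≤ |cc * y * s| := neg_le_abs _
        _ = |cc| * |y| * |s| := by rw [abs_mul, abs_mul]
        _ ≤ _ := by gcongr
    have g2 : 2 * (L * |y| * |s|) ≤ 1 / 4 * (η * |s| ^ 2) + 4 * L ^ 2 / η * |y| ^ 2 := by
      have : 0 ≤ (η * |s| / 2 - 2 * L * |y|) ^ 2 / η := by positivity
      have e : (η * |s| / 2 - 2 * L * |y|) ^ 2 / η = 1 / 4 * (η * |s| ^ 2) + 4 * L ^ 2 / η * |y| ^ 2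
        - 2 * (L * |y| * |s|) := by field_simp; ring
      linarith
    rw [sq_abs, sq_abs] at g2
    have g3 : η * s ^ 2 ≤ a * s ^ 2 := by gcongr
    linarith
  have f3 : |r| * |Dm| ≤ 1 / 16 * (a * s ^ 2) + 4 * (K * Dm ^ 2) + L / 2 * (y ^ 2 + Dm ^ 2) := by
    have g1 : |r| ≤ a * |s| + L * |y| := by
      rw [hRj]
      calc |a * s + cc * y| ≤ |a * s| + |cc * y| := abs_add_le _ _
        _ = a * |s| + |cc| * |y| := by rw [abs_mul, abs_mul, abs_of_nonneg ha0]
        _ ≤ _ := by gcongr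
    have g2 := mul_le_mul_of_nonneg_right g1 (abs_nonneg Dm)
    have g3 : a * |s| * |Dm| ≤ 1 / 16 * (a * |s| ^ 2) + 4 * (a * |Dm| ^ 2) := by
      have : 0 ≤ a * (|s| / 4 - 2 * |Dm|) ^ 2 := by positivity
      linarith
    have g4 : L * |y| * |Dm| ≤ L / 2 * (|y| ^ 2 + |Dm| ^ 2) := by
      have : 0 ≤ L * (|y| - |Dm|) ^ 2 := by positivity
      linarith
    rw [sq_abs, sq_abs] at g3 g4
    have g5 : a * Dm ^ 2 ≤ K * Dm ^ 2 := by gcongr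
    linarith
  have f4 : r ^ 2 ≤ 2 * K * (a * s ^ 2) + 2 * L ^ 2 * y ^ 2 := by
    have g1 : r ^ 2 ≤ 2 * (a * s) ^ 2 + 2 * (cc * y) ^ 2 := by
      rw [hRj]; nlinarith [sq_nonneg (a * s - cc * y)]
    have g2 : (a * s) ^ 2 ≤ K * (a * s ^ 2) := by
      have : a * (a * s ^ 2) ≤ K * (a * s ^ 2) := by gcongr
      linarith
    have g3 : cc ^ 2 ≤ L ^ 2 := by rw [← sq_abs cc]; gcongr
    have g4 : (cc * y) ^ 2 ≤ L ^ 2 * y ^ 2 := by rw [mul_pow]; gcongr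
    linarith
  have f5 : 6 * h ^ 2 / Δ ^ 2 * r ^ 2 ≤ h * (1 / 2 * (a * s ^ 2) + L ^ 2 * y ^ 2) := by
    have g0 : 0 ≤ a * s ^ 2 := by positivity
    have g1 : 12 * h / Δ ^ 2 * K ≤ 1 / 2 := by
      rw [div_mul_eq_mul_div, div_le_iff₀ (by positivity)]; linarith [H.cfl]
    have g2 : 12 * h / Δ ^ 2 ≤ 1 := by
      have : 12 * h / Δ ^ 2 * 1 ≤ 12 * h / Δ ^ 2 * K := by
        have := H.one_le; gcongr
      linarith
    calc 6 * h ^ 2 / Δ ^ 2 * r ^ 2 ≤ 6 * h ^ 2 / Δ ^ 2 * (2 * K * (a * s ^ 2) + 2 * L ^ 2 * y ^ 2) := by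
          gcongr
      _ = h * ((12 * h / Δ ^ 2 * K) * (a * s ^ 2) + (12 * h / Δ ^ 2) * (L ^ 2 * y ^ 2)) := by ring
      _ ≤ h * (1 / 2 * (a * s ^ 2) + 1 * (L ^ 2 * y ^ 2)) := by gcongr
      _ = _ := by ring
  have f6 : -(2 * (r * s)) = -(2 * (a * s ^ 2)) - 2 * (cc * y * s) := by rw [hRj]; ring
  have f7 : -(2 / Δ * (r * ((ρ' - ρm) * Dm))) ≤ 4 * (ρ' * (|r| * |Dm|)) := by
    calc -(2 / Δ * (r * ((ρ' - ρm) * Dm))) ≤ |2 / Δ * (r * ((ρ' - ρm) * Dm))| := neg_le_abs _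
      _ = 2 / Δ * (|r| * (|ρ' - ρm| * |Dm|)) := by
        rw [abs_mul, abs_mul, abs_mul, abs_of_pos (by positivity : 0 < 2 / Δ)]
      _ ≤ 2 / Δ * (|r| * ((2 * Δ * ρ') * |Dm|)) := by gcongr
      _ = _ := by field_simp; ring
  have f8 : (16 * K + 2 * L) * (ρ' * Dm ^ 2) ≤ (32 * K + 4 * L) * (ρm * Dm ^ 2) := by
    have := mul_le_mul_of_nonneg_right hρm (sq_nonneg Dm)
    have h3 : 0 ≤ 16 * K + 2 * L := by positivity
    have := mul_le_mul_of_nonneg_left this h3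
    linarith
  have ed : d = Dm + Δ * s := by linarith
  have ident : (ρ' * (d + h * ((Rp - r) / Δ)) ^ 2 + h * (ρ' * (a * s ^ 2))) -
      ((1 + h * (32 * K + 4 * L)) * (ρ' * d ^ 2) + h * (4 * L ^ 2 / η + 2 * L + L ^ 2) * (ρ' * y ^ 2)
      + (2 * h / Δ * (ρ' * d * Rp) + 4 * h ^ 2 / Δ ^ 2 * (ρp * Rp ^ 2)
          - h * (32 * K + 4 * L) * (ρ' * d ^ 2)
        - (2 * h / Δ * (ρm * Dm * r) + 4 * h ^ 2 / Δ ^ 2 * (ρ' * r ^ 2)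
          - h * (32 * K + 4 * L) * (ρm * Dm ^ 2)))) =
      h * (ρ' * (-(2 * (r * s)))) + h * (-(2 / Δ * (r * ((ρ' - ρm) * Dm))))
      + h ^ 2 / Δ ^ 2 * (ρ' * (Rp - r) ^ 2 - 4 * (ρp * Rp ^ 2) + 4 * (ρ' * r ^ 2))
      + h * (ρ' * (a * s ^ 2)) - h * (4 * L ^ 2 / η + 2 * L + L ^ 2) * (ρ' * y ^ 2)
      - h * ((32 * K + 4 * L) * (ρm * Dm ^ 2)) := by
    rw [ed]; field_simp; ring
  have k1 : h ^ 2 / Δ ^ 2 * (ρ' * (Rp - r) ^ 2 - 4 * (ρp * Rp ^ 2) + 4 * (ρ' * r ^ 2)) ≤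
      ρ' * (h * (1 / 2 * (a * s ^ 2) + L ^ 2 * y ^ 2)) := by
    calc _ ≤ h ^ 2 / Δ ^ 2 * (6 * (ρ' * r ^ 2)) := by gcongr; linarith
      _ = ρ' * (6 * h ^ 2 / Δ ^ 2 * r ^ 2) := by ring
      _ ≤ _ := by gcongr
  have k2 : h * (-(2 / Δ * (r * ((ρ' - ρm) * Dm)))) ≤ h * (4 * (ρ' *
      (1 / 16 * (a * s ^ 2) + 4 * (K * Dm ^ 2) + L / 2 * (y ^ 2 + Dm ^ 2)))) := by
    refine mul_le_mul_of_nonneg_left (f7.trans ?_) h0.le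
    gcongr
  have k3 : h * (ρ' * (-(2 * (r * s)))) ≤ h * (ρ' * (-(2 * (a * s ^ 2)) +
      (1 / 4 * (a * s ^ 2) + 4 * L ^ 2 / η * y ^ 2))) := by
    rw [f6]; gcongr; linarith
  have k4 := mul_le_mul_of_nonneg_left f8 h0.le
  have : h * (ρ' * (-(2 * (r * s)))) + h * (-(2 / Δ * (r * ((ρ' - ρm) * Dm))))
      + h ^ 2 / Δ ^ 2 * (ρ' * (Rp - r) ^ 2 - 4 * (ρp * Rp ^ 2) + 4 * (ρ' * r ^ 2))
      + h * (ρ' * (a * s ^ 2)) - h * (4 * L ^ 2 / η + 2 * L + L ^ 2) * (ρ' * y ^ 2)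
      - h * ((32 * K + 4 * L) * (ρm * Dm ^ 2)) ≤ 0 := by linarith
  linarith

/-- Exponentially decaying lattice weight. -/
def expDecay (Δ : ℝ) (j : ℤ) : ℝ := Real.exp (-(|(j:ℝ)| * Δ))

theorem expDecay_pos (Δ : ℝ) (j : ℤ) : 0 < expDecay Δ j := Real.exp_pos _

theorem expWeight_mul_expDecay (Δ : ℝ) (j : ℤ) : expWeight Δ j * expDecay Δ j = 1 := by
  unfold expWeight expDecay
  rw [← Real.exp_add, add_neg_cancel, Real.exp_zero]

theorem summable_expDecay {Δ : ℝ} (hΔ : 0 < Δ) (hΔ' : Δ ≤ 1 / 2) :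
    Summable (expDecay Δ) ∧ Δ * ∑' j, expDecay Δ j ≤ 4 := by
  set q := Real.exp (-Δ) with hq
  have q0 : 0 < q := Real.exp_pos _
  have q1 : q ≤ 1 - Δ / 2 := by
    have := Real.abs_exp_sub_one_sub_id_le (x := -Δ) (by rw [abs_neg, abs_of_pos hΔ]; linarith)
    have := (abs_le.1 this).2
    nlinarith
  have hg := hasSum_geometric_of_lt_one q0.le (by linarith : q < 1)
  have e1 : (fun n : ℕ => expDecay Δ (n : ℤ)) = fun n => q ^ n := by
    funext n
    rw [hq, ← Real.exp_nat_mul]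
    simp [expDecay]
  have e2 : (fun n : ℕ => expDecay Δ (-((n : ℤ) + 1))) = fun n => q * q ^ n := by
    funext n
    rw [hq, ← Real.exp_nat_mul, ← Real.exp_add, expDecay]
    congr 1
    have : (0:ℝ) ≤ (n:ℝ) + 1 := by positivity
    push_cast
    rw [abs_neg, abs_of_nonneg this]
    ring
  have h1 : HasSum (fun n : ℕ => expDecay Δ (n : ℤ)) (1 - q)⁻¹ := by rw [e1]; exact hg
  have h2 : HasSum (fun n : ℕ => expDecay Δ (-((n : ℤ) + 1))) (q * (1 - q)⁻¹) := by
    rw [e2]; exact hg.mul_left q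
  have h3 := HasSum.of_nat_of_neg_add_one h1 h2
  refine ⟨h3.summable, ?_⟩
  rw [h3.tsum_eq]
  have : (1 - q)⁻¹ + q * (1 - q)⁻¹ = (1 + q) / (1 - q) := by ring
  rw [this, ← mul_div_assoc, div_le_iff₀ (by linarith)]
  nlinarith


/-- Summation of a lattice function bounded by decaying weights. -/
theorem mesh_tsum_le {Δ R C C' : ℝ} (hΔ : 0 < Δ) (hΔ' : Δ ≤ 1 / 2) (hC : 0 ≤ C) (hC' : 0 ≤ C')
    {f g : ℤ → ℝ} (hf : BddSupp f) (hg : BddSupp g)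
    (h : ∀ j : ℤ, |(j:ℝ)| * Δ ≤ R → f j ≤ g j + C * expDecay Δ j)
    (h' : ∀ j : ℤ, f j ≤ g j + C' * expDecay Δ j) :
    Δ * ∑' j, f j ≤ Δ * (∑' j, g j) + (4 * C + 8 * (C' * Real.exp (-(R / 2)))) := by
  obtain ⟨s1, b1⟩ := summable_expDecay hΔ hΔ'
  obtain ⟨s2, b2⟩ := summable_expDecay (half_pos hΔ) (by linarith)
  have key : ∀ j, f j ≤ g j + (C * expDecay Δ j + (C' * Real.exp (-(R / 2))) * expDecay (Δ / 2) j) := by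
    intro j
    have p1 := expDecay_pos Δ j
    have p2 := expDecay_pos (Δ / 2) j
    rcases le_or_gt (|(j:ℝ)| * Δ) R with hR | hR
    · have := h j hR
      have : 0 ≤ C' * Real.exp (-(R / 2)) * expDecay (Δ / 2) j := by positivity
      linarith
    · have t := h' j
      have : expDecay Δ j ≤ Real.exp (-(R / 2)) * expDecay (Δ / 2) j := by
        unfold expDecay
        rw [← Real.exp_add]
        apply Real.exp_le_exp.2
        linarith
      have := mul_le_mul_of_nonneg_left this hC'
      have : 0 ≤ C * expDecay Δ j := by positivity
      linarith
  have e := hf.summable.tsum_le_tsum key (hg.summable.add ((s1.mul_left C).add (s2.mul_left _)))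
  rw [hg.summable.tsum_add ((s1.mul_left C).add (s2.mul_left _)),
    (s1.mul_left C).tsum_add (s2.mul_left _), tsum_mul_left, tsum_mul_left] at e
  have e' := mul_le_mul_of_nonneg_left e hΔ.le
  have t1 := mul_le_mul_of_nonneg_left b1 hC
  have t2 := mul_le_mul_of_nonneg_left b2 (by positivity : 0 ≤ C' * Real.exp (-(R / 2)))
  linarith

theorem mesh_tsum_le_of_le_expDecay {Δ C : ℝ} (hΔ : 0 < Δ) (hΔ' : Δ ≤ 1 / 2) (hC : 0 ≤ C)
    {f : ℤ → ℝ} (hf : BddSupp f) (h : ∀ j : ℤ, f j ≤ C * expDecay Δ j) :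
    Δ * ∑' j, f j ≤ 4 * C := by
  obtain ⟨s1, b1⟩ := summable_expDecay hΔ hΔ'
  have := hf.summable.tsum_le_tsum h (s1.mul_left _)
  rw [tsum_mul_left] at this
  have := mul_le_mul_of_nonneg_left this hΔ.le
  have t2 := mul_le_mul_of_nonneg_left b1 hC
  linarith

/-- The explicit scheme for the backward dual problem, run forward in the reversed time. -/
def dualScheme (h Δ : ℝ) (α c : ℕ → ℤ → ℝ) (φ : ℤ → ℝ) : ℕ → ℤ → ℝ
  | 0 => φ
  | k + 1 => eulerStep h Δ (α k) (c k) (dualScheme h Δ α c φ k)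

theorem dualScheme_bddSupp {h Δ : ℝ} {α c : ℕ → ℤ → ℝ} {φ : ℤ → ℝ} (hφ : BddSupp φ) (k : ℕ) :
    BddSupp (dualScheme h Δ α c φ k) := by
  induction k with
  | zero => exact hφ
  | succ k ih => exact ih.eulerStep

theorem dualScheme_nonneg {h Δ K L : ℝ} (H : StableMesh h Δ K L) {α c : ℕ → ℤ → ℝ}
    (hc : ∀ k, BoundedCoeff K L (α k) (c k)) {φ : ℤ → ℝ} (hφ : ∀ j, 0 ≤ φ j) (k : ℕ) (j : ℤ) :
    0 ≤ dualScheme h Δ α c φ k j := by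
  induction k generalizing j with
  | zero => exact hφ j
  | succ k ih => exact eulerStep_nonneg H (hc k) ih j

theorem one_add_mul_pow_le {h T A : ℝ} (hh : 0 ≤ h) (hA : 0 ≤ A) {k : ℕ} (hk : k * h ≤ T) :
    (1 + h * A) ^ k ≤ Real.exp (T * A) := by
  calc (1 + h * A) ^ k ≤ (Real.exp (h * A)) ^ k := by
        have : 0 ≤ h * A := by positivity
        gcongr
        linarith [Real.add_one_le_exp (h * A)]
    _ = Real.exp (k * (h * A)) := (Real.exp_nat_mul _ _).symm
    _ ≤ _ := Real.exp_le_exp.2 (by nlinarith)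

theorem dualScheme_le_exp {h Δ K L T : ℝ} (H : StableMesh h Δ K L) {α c : ℕ → ℤ → ℝ}
    (hc : ∀ k, BoundedCoeff K L (α k) (c k)) {φ : ℤ → ℝ} {B : ℝ} (hB : 0 ≤ B)
    (hφ : ∀ j : ℤ, φ j ≤ B * Real.exp (-(2 * (|(j:ℝ)| * Δ)))) {k : ℕ} (hk : k * h ≤ T) (j : ℤ) :
    dualScheme h Δ α c φ k j ≤
      Real.exp (T * (8 * K + L)) * B * Real.exp (-(2 * (|(j:ℝ)| * Δ))) := by
  have hA : 0 ≤ 8 * K + L := by linarith [H.one_le, H.L_nonneg]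
  have key : ∀ j : ℤ, dualScheme h Δ α c φ k j ≤
      (1 + h * (8 * K + L)) ^ k * B * Real.exp (-(2 * (|(j:ℝ)| * Δ))) := by
    clear hk
    induction k with
    | zero => simpa [dualScheme] using hφ
    | succ k ih =>
      intro j
      have := H.h_pos
      refine (eulerStep_le_exp H (hc k) (by positivity) ih j).trans (le_of_eq ?_)
      ring
  refine (key j).trans ?_
  gcongr
  exact one_add_mul_pow_le H.h_pos.le hA hk

/-- Total dissipation of the dual scheme. -/
theorem dualScheme_dissipation {h Δ K L T η B CE : ℝ} (H : StableMesh h Δ K L) {α c : ℕ → ℤ → ℝ}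
    (hc : ∀ k, BoundedCoeff K L (α k) (c k)) (hη : 0 < η) (hα : ∀ k j, η ≤ α k j)
    {φ : ℤ → ℝ} (hφ : BddSupp φ) (h0 : ∀ j, 0 ≤ φ j) (hB : 0 ≤ B)
    (hφB : ∀ j : ℤ, φ j ≤ B * Real.exp (-(2 * (|(j:ℝ)| * Δ))))
    (hCE : Δ * (∑' j, expWeight Δ j * diffQuot Δ φ j ^ 2) ≤ CE) {N : ℕ} (hN : N * h ≤ T) :
    h * ∑ k ∈ Finset.range N, Δ * (∑' j, expWeight Δ j *
        (α k j * secondDiff Δ (dualScheme h Δ α c φ k) j ^ 2)) ≤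
      Real.exp (T * (32 * K + 4 * L)) * (CE + T * ((4 * L ^ 2 / η + 2 * L + L ^ 2) *
        (4 * (Real.exp (T * (8 * K + L)) * B) ^ 2))) := by
  have hh := H.h_pos
  have hΔ := H.mesh_pos
  have hL := H.L_nonneg
  have hK : 0 < K := by linarith [H.one_le]
  set Φ := dualScheme h Δ α c φ with hΦ
  set B' := Real.exp (T * (8 * K + L)) * B with hB'
  set C₂ := 4 * L ^ 2 / η + 2 * L + L ^ 2 with hC₂
  have hC₂0 : 0 ≤ C₂ := by positivity
  set E : ℕ → ℝ := fun k => Δ * ∑' j, expWeight Δ j * diffQuot Δ (Φ k) j ^ 2 with hE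
  set A : ℕ → ℝ := fun k => Δ * ∑' j, expWeight Δ j * (α k j * secondDiff Δ (Φ k) j ^ 2) with hA
  have hB'0 : 0 ≤ B' := by positivity
  have hP : ∀ k : ℕ, k * h ≤ T → Δ * (∑' j, expWeight Δ j * Φ k j ^ 2) ≤ 4 * B' ^ 2 := by
    intro k hk
    have bΦ : BddSupp (Φ k) := dualScheme_bddSupp hφ k
    have key : ∀ j : ℤ, expWeight Δ j * Φ k j ^ 2 ≤ B' ^ 2 * expDecay Δ j := by
      intro j
      have b1 : Φ k j ≤ B' * Real.exp (-(2 * (|(j:ℝ)| * Δ))) := dualScheme_le_exp H hc hB hφB hk j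
      have b0 : 0 ≤ Φ k j := dualScheme_nonneg H hc h0 k j
      have b2 : Φ k j ≤ B' * expDecay Δ j := by
        refine b1.trans ?_
        have : 0 ≤ |(j:ℝ)| * Δ := by positivity
        exact mul_le_mul_of_nonneg_left (Real.exp_le_exp.2 (by linarith)) hB'0
      have p := expDecay_pos Δ j
      have q := expWeight_pos Δ j
      calc expWeight Δ j * Φ k j ^ 2 ≤ expWeight Δ j * (B' * expDecay Δ j) ^ 2 := by gcongr
        _ = B' ^ 2 * expDecay Δ j * (expWeight Δ j * expDecay Δ j) := by ring
        _ = _ := by rw [expWeight_mul_expDecay]; ring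
    exact mesh_tsum_le_of_le_expDecay hΔ H.mesh_le (by positivity)
      (bΦ.of_zero fun j h => by rw [h]; ring) key
  have hE0 : E 0 ≤ CE := hCE
  have hE_nonneg : ∀ k, 0 ≤ E k := fun k => mul_nonneg hΔ.le
    (tsum_nonneg fun j => mul_nonneg (expWeight_pos _ _).le (sq_nonneg _))
  have hA_nonneg : ∀ k, 0 ≤ A k := fun k => mul_nonneg hΔ.le
    (tsum_nonneg fun j => mul_nonneg (expWeight_pos _ _).le
      (mul_nonneg ((hc k).nonneg j) (sq_nonneg _)))
  have step : ∀ k : ℕ, k * h ≤ T → E (k + 1) + h * A k ≤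
      (1 + h * (32 * K + 4 * L)) * E k + h * (C₂ * (4 * B' ^ 2)) := by
    intro k hk
    have e := energy_eulerStep H (hc k) hη (hα k) (dualScheme_bddSupp (h := h) (Δ := Δ) (α := α) (c := c) hφ k)
    have e' := mul_le_mul_of_nonneg_left e hΔ.le
    have p := mul_le_mul_of_nonneg_left (hP k hk) (by positivity : 0 ≤ h * C₂)
    have : E (k + 1) = Δ * ∑' j, expWeight Δ j *
        diffQuot Δ (eulerStep h Δ (α k) (c k) (dualScheme h Δ α c φ k)) j ^ 2 := rfl
    rw [this]
    simp only [hE, hA, hΦ, hC₂] at *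
    linarith
  have ind : ∀ k : ℕ, k ≤ N → E k + h * ∑ i ∈ Finset.range k, A i ≤
      (1 + h * (32 * K + 4 * L)) ^ k * (CE + k * h * (C₂ * (4 * B' ^ 2))) := by
    intro k
    induction k with
    | zero => intro _; simpa using hE0
    | succ k ih =>
      intro hk
      have ih := ih (by lia)
      have hkT : k * h ≤ T := by
        refine le_trans ?_ hN
        have : (k:ℝ) ≤ N := by exact_mod_cast (by lia)
        gcongr
      have st := step k hkT
      rw [Finset.sum_range_succ, mul_add]
      have hS : 0 ≤ ∑ i ∈ Finset.range k, A i := Finset.sum_nonneg fun i _ => hA_nonneg i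
      set X := 1 + h * (32 * K + 4 * L) with hX
      have hX1 : 1 ≤ X := by
        have : 0 ≤ h * (32 * K + 4 * L) := by positivity
        linarith
      have t1 := mul_le_mul_of_nonneg_left ih (by linarith : 0 ≤ X)
      have t2 : h * ∑ i ∈ Finset.range k, A i ≤ X * (h * ∑ i ∈ Finset.range k, A i) :=
        le_mul_of_one_le_left (by positivity) hX1
      have t3 : h * (C₂ * (4 * B' ^ 2)) ≤ X ^ (k + 1) * (h * (C₂ * (4 * B' ^ 2))) :=
        le_mul_of_one_le_left (by positivity) (one_le_pow₀ hX1)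
      push_cast
      have t4 : X ^ (k + 1) * (CE + (k + 1) * h * (C₂ * (4 * B' ^ 2))) =
        X * (X ^ k * (CE + k * h * (C₂ * (4 * B' ^ 2)))) + X ^ (k + 1) * (h * (C₂ * (4 * B' ^ 2))) := by
        ring
      rw [t4]
      linarith
  have fin := ind N le_rfl
  have hCE0 : 0 ≤ CE := (hE_nonneg 0).trans hE0
  have hT0 : 0 ≤ T := le_trans (by positivity) hN
  calc h * ∑ k ∈ Finset.range N, A k
      ≤ (1 + h * (32 * K + 4 * L)) ^ N * (CE + N * h * (C₂ * (4 * B' ^ 2))) := by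
        linarith [hE_nonneg N]
    _ ≤ _ := by
      gcongr
      exact one_add_mul_pow_le hh.le (by positivity) hN

theorem pairing_eulerStep_error {h Δ K L η lam R ξ M B : ℝ} (H : StableMesh h Δ K L)
    {α c : ℤ → ℝ} (hη : 0 < η) (hlam : 0 < lam) (hα : ∀ j, η ≤ α j)
    {φ : ℤ → ℝ} (hφ : BddSupp φ) (h0 : ∀ j, 0 ≤ φ j) (hB : 0 ≤ B)
    (hφB : ∀ j : ℤ, φ j ≤ B * expDecay Δ j) (hξ : 0 ≤ ξ) (hM : 0 ≤ M)
    {W W' Y G : ℤ → ℝ} (hW : ∀ j, W j = W' j + h * (secondDiff Δ Y j + G j))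
    (hY : ∀ j : ℤ, |(j:ℝ)| * Δ ≤ R → |Y j - α j * W' j| ≤ ξ)
    (hG : ∀ j : ℤ, |(j:ℝ)| * Δ ≤ R → |G j - c j * W' j| ≤ ξ)
    (hY' : ∀ j : ℤ, |Y j - α j * W' j| ≤ M) (hG' : ∀ j : ℤ, |G j - c j * W' j| ≤ M) :
    |Δ * (∑' j, W j * φ j) - Δ * ∑' j, W' j * eulerStep h Δ α c φ j| ≤
      h * (lam * (Δ * ∑' j, expWeight Δ j * (α j * secondDiff Δ φ j ^ 2)) +
        (4 * (ξ ^ 2 / (4 * lam * η) + B * ξ) +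
          8 * ((M ^ 2 / (4 * lam * η) + B * M) * Real.exp (-(R / 2))))) := by
  have hh := H.h_pos
  have hΔ := H.mesh_pos
  set r : ℤ → ℝ := fun j => (Y j - α j * W' j) * secondDiff Δ φ j + (G j - c j * W' j) * φ j with hr
  have bδ : BddSupp (secondDiff Δ φ) := hφ.of_neighbours fun j h1 h2 h3 => by
    simp [secondDiff, h1, h2, h3]
  have br : BddSupp r := (bδ.mul_left _).add (hφ.mul_left _)
  have b1 : BddSupp (fun j => W j * φ j) := hφ.mul_left _
  have b2 : BddSupp (fun j => W' j * eulerStep h Δ α c φ j) := hφ.eulerStep.mul_left _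
  have bm : BddSupp (fun j => φ (j - 1)) := hφ.shift'
  have e : (∑' j, W j * φ j) = ∑' j, (W' j * eulerStep h Δ α c φ j + h * r j) := by
    refine tsum_eq_of_telescoping
      (g := fun j => h / Δ ^ 2 * (Y j * φ (j - 1) - Y (j - 1) * φ j)) b1 (b2.add (br.const_mul h))
      (((bm.mul_left _).sub (hφ.mul_left _)).const_mul _) fun j => ?_
    rw [hW j]
    simp only [hr, eulerStep, secondDiff, add_sub_cancel_right]
    field_simp
    ring
  rw [e, b2.summable.tsum_add (br.const_mul h).summable, tsum_mul_left]
  have e2 : Δ * ((∑' j, W' j * eulerStep h Δ α c φ j) + h * ∑' j, r j) -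
      Δ * (∑' j, W' j * eulerStep h Δ α c φ j) = h * (Δ * ∑' j, r j) := by ring
  rw [e2, abs_mul, abs_of_pos hh]
  refine mul_le_mul_of_nonneg_left ?_ hh.le
  have bg : BddSupp (fun j => expWeight Δ j * (α j * secondDiff Δ φ j ^ 2)) :=
    bδ.of_zero fun j h => by rw [h]; ring
  have point : ∀ j ζ, 0 ≤ ζ → |Y j - α j * W' j| ≤ ζ → |G j - c j * W' j| ≤ ζ →
      |r j| ≤ lam * (expWeight Δ j * (α j * secondDiff Δ φ j ^ 2)) +
        (ζ ^ 2 / (4 * lam * η) + B * ζ) * expDecay Δ j := by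
    intro j ζ hζ h1 h2
    have p := expWeight_pos Δ j
    have q := expDecay_pos Δ j
    have pq := expWeight_mul_expDecay Δ j
    have g1 : |r j| ≤ ζ * |secondDiff Δ φ j| + ζ * φ j := by
      calc |r j| ≤ |(Y j - α j * W' j) * secondDiff Δ φ j| + |(G j - c j * W' j) * φ j| := abs_add_le _ _
        _ = |Y j - α j * W' j| * |secondDiff Δ φ j| + |G j - c j * W' j| * φ j := by
          rw [abs_mul, abs_mul, abs_of_nonneg (h0 j)]
        _ ≤ _ := by have := h0 j; gcongr
    have g2 : ζ * φ j ≤ B * ζ * expDecay Δ j := by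
      have := mul_le_mul_of_nonneg_left (hφB j) hζ; linarith
    have g3 : ζ * |secondDiff Δ φ j| ≤ lam * (expWeight Δ j * (η * |secondDiff Δ φ j| ^ 2)) +
        ζ ^ 2 / (4 * lam * η) * expDecay Δ j := by
      have : expDecay Δ j = 1 / expWeight Δ j := by field_simp; linarith
      rw [this]
      set s := |secondDiff Δ φ j|
      set ρ := expWeight Δ j
      have e : lam * (ρ * (η * s ^ 2)) + ζ ^ 2 / (4 * lam * η) * (1 / ρ) - ζ * s =
          (2 * lam * η * ρ * s - ζ) ^ 2 / (4 * lam * η * ρ) := by field_simp; ring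
      have : 0 ≤ (2 * lam * η * ρ * s - ζ) ^ 2 / (4 * lam * η * ρ) := by positivity
      linarith
    have g4 : lam * (expWeight Δ j * (η * |secondDiff Δ φ j| ^ 2)) ≤
        lam * (expWeight Δ j * (α j * secondDiff Δ φ j ^ 2)) := by
      rw [sq_abs]; have := hα j; gcongr
    linarith
  have m1 := mesh_tsum_le (R := R) (C := ξ ^ 2 / (4 * lam * η) + B * ξ)
    (C' := M ^ 2 / (4 * lam * η) + B * M) hΔ H.mesh_le (by positivity) (by positivity)
    br (bg.const_mul lam) (fun j hj => (le_abs_self _).trans (point j ξ hξ (hY j hj) (hG j hj)))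
    (fun j => (le_abs_self _).trans (point j M hM (hY' j) (hG' j)))
  have m2 := mesh_tsum_le (R := R) (C := ξ ^ 2 / (4 * lam * η) + B * ξ)
    (C' := M ^ 2 / (4 * lam * η) + B * M) hΔ H.mesh_le (by positivity) (by positivity)
    br.neg (bg.const_mul lam) (fun j hj => (neg_le_abs _).trans (point j ξ hξ (hY j hj) (hG j hj)))
    (fun j => (neg_le_abs _).trans (point j M hM (hY' j) (hG' j)))
  rw [tsum_mul_left] at m1 m2
  rw [tsum_neg] at m2
  rw [abs_le]
  constructor <;> linarith

/-- Duality error of the explicit scheme over many steps. -/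
theorem dualScheme_error {h Δ K L T η B CE lam R ξ M δ : ℝ} (H : StableMesh h Δ K L)
    {α c : ℕ → ℤ → ℝ} (hc : ∀ k, BoundedCoeff K L (α k) (c k)) (hη : 0 < η) (hlam : 0 < lam)
    (hα : ∀ k j, η ≤ α k j)
    {φ : ℤ → ℝ} (hφ : BddSupp φ) (h0 : ∀ j, 0 ≤ φ j) (hB : 0 ≤ B)
    (hφB : ∀ j : ℤ, φ j ≤ B * Real.exp (-(2 * (|(j:ℝ)| * Δ))))
    (hCE : Δ * (∑' j, expWeight Δ j * diffQuot Δ φ j ^ 2) ≤ CE) {N : ℕ} (hN : N * h = T)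
    (hξ : 0 ≤ ξ) (hM : 0 ≤ M) (hδ : 0 ≤ δ)
    {W Y G : ℕ → ℤ → ℝ}
    (hW : ∀ k < N, ∀ j, W k j = W (k + 1) j + h * (secondDiff Δ (Y k) j + G k j))
    (hY : ∀ k < N, (k + 1) * h ≤ T - δ → ∀ j : ℤ, |(j:ℝ)| * Δ ≤ R → |Y k j - α k j * W (k + 1) j| ≤ ξ)
    (hG : ∀ k < N, (k + 1) * h ≤ T - δ → ∀ j : ℤ, |(j:ℝ)| * Δ ≤ R → |G k j - c k j * W (k + 1) j| ≤ ξ)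
    (hY' : ∀ k < N, ∀ j : ℤ, |Y k j - α k j * W (k + 1) j| ≤ M)
    (hG' : ∀ k < N, ∀ j : ℤ, |G k j - c k j * W (k + 1) j| ≤ M) :
    |Δ * (∑' j, W 0 j * φ j) - Δ * ∑' j, W N j * dualScheme h Δ α c φ N j| ≤
      lam * (Real.exp (T * (32 * K + 4 * L)) * (CE + T * ((4 * L ^ 2 / η + 2 * L + L ^ 2) *
        (4 * (Real.exp (T * (8 * K + L)) * B) ^ 2)))) +
      4 * T * (ξ ^ 2 / (4 * lam * η) + Real.exp (T * (8 * K + L)) * B * ξ) +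
      (M ^ 2 / (4 * lam * η) + Real.exp (T * (8 * K + L)) * B * M) *
        (4 * (δ + h) + 8 * T * Real.exp (-(R / 2))) := by
  have hh := H.h_pos
  have hΔ := H.mesh_pos
  have dis := dualScheme_dissipation H hc hη hα hφ h0 hB hφB hCE hN.le
  set D := Real.exp (T * (32 * K + 4 * L)) * (CE + T * ((4 * L ^ 2 / η + 2 * L + L ^ 2) *
        (4 * (Real.exp (T * (8 * K + L)) * B) ^ 2)))
  set B' := Real.exp (T * (8 * K + L)) * B with hB'
  have hB'0 : 0 ≤ B' := by positivity
  set Φ := dualScheme h Δ α c φ with hΦ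
  set A : ℕ → ℝ := fun k => Δ * ∑' j, expWeight Δ j * (α k j * secondDiff Δ (Φ k) j ^ 2) with hA
  set c₁ := ξ ^ 2 / (4 * lam * η) + B' * ξ with hc₁
  set c₂ := M ^ 2 / (4 * lam * η) + B' * M with hc₂
  have hc₁0 : 0 ≤ c₁ := by positivity
  have hc₂0 : 0 ≤ c₂ := by positivity
  have hT0 : 0 ≤ T := by rw [← hN]; positivity
  set I : ℕ → ℝ := fun k => if (k + 1) * h ≤ T - δ then 0 else 1 with hI
  have step : ∀ k < N, |Δ * (∑' j, W k j * Φ k j) - Δ * ∑' j, W (k + 1) j * Φ (k + 1) j| ≤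
      h * (lam * A k + (4 * (c₁ + I k * c₂) + 8 * (c₂ * Real.exp (-(R / 2))))) := by
    intro k hk
    have hkT : k * h ≤ T := by
      rw [← hN]
      have : (k:ℝ) ≤ N := by exact_mod_cast hk.le
      gcongr
    have hΦB : ∀ j, Φ k j ≤ B' * expDecay Δ j := by
      intro j
      refine (dualScheme_le_exp H hc hB hφB hkT j).trans ?_
      have : 0 ≤ |(j:ℝ)| * Δ := by positivity
      exact mul_le_mul_of_nonneg_left (Real.exp_le_exp.2 (by linarith)) hB'0
    by_cases hg : (k + 1) * h ≤ T - δ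
    · have := pairing_eulerStep_error H hη hlam (hα k) (dualScheme_bddSupp hφ k)
        (dualScheme_nonneg H hc h0 k) hB'0 hΦB hξ hM (hW k hk) (hY k hk hg) (hG k hk hg)
        (hY' k hk) (hG' k hk)
      refine this.trans (le_of_eq ?_)
      simp only [hI, if_pos hg, zero_mul, add_zero, hA, hc₁, hc₂, hΦ]
    · have := pairing_eulerStep_error (R := R) H hη hlam (hα k) (dualScheme_bddSupp hφ k)
        (dualScheme_nonneg H hc h0 k) hB'0 hΦB hM hM (hW k hk) (fun j _ => hY' k hk j)
        (fun j _ => hG' k hk j) (hY' k hk) (hG' k hk)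
      refine this.trans ?_
      have hI1 : I k = 1 := by simp only [hI, if_neg hg]
      rw [hI1]
      refine mul_le_mul_of_nonneg_left ?_ hh.le
      have : lam * (Δ * ∑' j, expWeight Δ j * (α k j * secondDiff Δ (Φ k) j ^ 2)) = lam * A k := rfl
      linarith
  have tele : ∀ n ≤ N, |Δ * (∑' j, W 0 j * φ j) - Δ * ∑' j, W n j * Φ n j| ≤
      ∑ k ∈ Finset.range n, h * (lam * A k + (4 * (c₁ + I k * c₂) + 8 * (c₂ * Real.exp (-(R / 2))))) := by
    intro n
    induction n with
    | zero => intro _; simp [hΦ, dualScheme]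
    | succ n ih =>
      intro hn
      rw [Finset.sum_range_succ]
      have := ih (by lia)
      have := step n (by lia)
      exact (abs_sub_le _ (Δ * ∑' j, W n j * Φ n j) _).trans (by linarith)
  have count : ∀ n ≤ N, h * ∑ k ∈ Finset.range n, I k ≤ max 0 (n * h - (T - δ) + h) := by
    intro n
    induction n with
    | zero => intro _; simp
    | succ n ih =>
      intro hn
      rw [Finset.sum_range_succ, mul_add]
      have ih := ih (by lia)
      by_cases hg : (n + 1) * h ≤ T - δ
      · have : I n = 0 := by simp only [hI, if_pos hg]
        rw [this, mul_zero, add_zero]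
        refine ih.trans (max_le_max le_rfl ?_)
        push_cast; linarith
      · have hI1 : I n = 1 := by simp only [hI, if_neg hg]
        rw [hI1, mul_one]
        push Not at hg
        push_cast
        refine le_max_of_le_right ?_
        rcases max_cases 0 (n * h - (T - δ) + h) with h1 | h1 <;> linarith
  have cN := count N le_rfl
  rw [hN, max_eq_right (by linarith)] at cN
  refine (tele N le_rfl).trans ?_
  have e : ∀ A I : ℕ → ℝ,
      ∑ k ∈ Finset.range N, h * (lam * A k + (4 * (c₁ + I k * c₂) + 8 * (c₂ * Real.exp (-(R / 2))))) =
      lam * (h * ∑ k ∈ Finset.range N, A k) + 4 * (N * h) * c₁ +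
        4 * c₂ * (h * ∑ k ∈ Finset.range N, I k) + 8 * (N * h) * (c₂ * Real.exp (-(R / 2))) := by
    intro A I
    rw [← Finset.mul_sum, Finset.sum_add_distrib, Finset.sum_add_distrib, ← Finset.mul_sum,
      ← Finset.mul_sum, Finset.sum_add_distrib, ← Finset.sum_mul]
    simp only [Finset.sum_const, Finset.card_range, nsmul_eq_mul]
    ring
  rw [e, hN]
  have t1 := mul_le_mul_of_nonneg_left dis hlam.le
  have t2 := mul_le_mul_of_nonneg_left cN (by positivity : 0 ≤ 4 * c₂)
  linarith

/-- The hat kernel of width `Δ` and unit mass. -/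
def hat (Δ z : ℝ) : ℝ := max 0 (Δ - |z|) / Δ ^ 2

/-- Average of `v` around `x` against the hat kernel. -/
def hatAvg (Δ : ℝ) (v : ℝ → ℝ) (x : ℝ) : ℝ := ∫ z in (-Δ)..Δ, hat Δ z * v (x + z)

theorem continuous_hat (Δ : ℝ) : Continuous (hat Δ) := by
  unfold hat; fun_prop

theorem hat_nonneg (Δ z : ℝ) : 0 ≤ hat Δ z := by
  unfold hat; positivity

theorem integral_hat {Δ : ℝ} (hΔ : 0 < Δ) : ∫ z in (-Δ)..Δ, hat Δ z = 1 := by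
  have i : ∀ a b, IntervalIntegrable (hat Δ) volume a b := fun a b =>
    (continuous_hat Δ).intervalIntegrable a b
  rw [← intervalIntegral.integral_add_adjacent_intervals (i (-Δ) 0) (i 0 Δ)]
  have e1 : ∫ z in (-Δ)..0, hat Δ z = ∫ z in (-Δ)..0, (Δ + z) / Δ ^ 2 := by
    refine intervalIntegral.integral_congr fun z hz => ?_
    rw [uIcc_of_le (by linarith)] at hz
    simp only [hat]
    rw [abs_of_nonpos hz.2, max_eq_right (by linarith [hz.1])]
    ring
  have e2 : ∫ z in (0:ℝ)..Δ, hat Δ z = ∫ z in (0:ℝ)..Δ, (Δ - z) / Δ ^ 2 := by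
    refine intervalIntegral.integral_congr fun z hz => ?_
    rw [uIcc_of_le (by linarith)] at hz
    simp only [hat]
    rw [abs_of_nonneg hz.1, max_eq_right (by linarith [hz.2])]
  rw [e1, e2]
  simp only [intervalIntegral.integral_div]
  rw [intervalIntegral.integral_add (by simp) (by simp), intervalIntegral.integral_sub (by simp) (by simp)]
  simp only [intervalIntegral.integral_const, integral_id]
  simp
  field_simp
  ring

theorem abs_hatAvg_sub_le {Δ : ℝ} (hΔ : 0 < Δ) {v : ℝ → ℝ} {x C μ : ℝ}
    (hv : IntervalIntegrable v volume (x - Δ) (x + Δ))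
    (h : ∀ z, |z| ≤ Δ → |v (x + z) - C| ≤ μ) : |hatAvg Δ v x - C| ≤ μ := by
  have i1 : IntervalIntegrable (fun z => v (x + z)) volume (-Δ) Δ := by
    have := hv.comp_add_left x
    simpa using this
  have i2 : IntervalIntegrable (fun z => hat Δ z * v (x + z)) volume (-Δ) Δ :=
    i1.continuousOn_mul (continuous_hat Δ).continuousOn
  have i3 : IntervalIntegrable (hat Δ) volume (-Δ) Δ := (continuous_hat Δ).intervalIntegrable _ _
  have e : hatAvg Δ v x - C = ∫ z in (-Δ)..Δ, hat Δ z * (v (x + z) - C) := by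
    have : ∀ z, hat Δ z * (v (x + z) - C) = hat Δ z * v (x + z) - C * hat Δ z := fun z => by ring
    simp only [this]
    rw [intervalIntegral.integral_sub i2 (i3.const_mul C), intervalIntegral.integral_const_mul,
      integral_hat hΔ, mul_one, hatAvg]
  rw [e]
  have b : ∀ z ∈ Ioc (-Δ) Δ, ‖hat Δ z * (v (x + z) - C)‖ ≤ hat Δ z * μ := by
    intro z hz
    rw [Real.norm_eq_abs, abs_mul, abs_of_nonneg (hat_nonneg Δ z)]
    exact mul_le_mul_of_nonneg_left (h z (abs_le.2 ⟨hz.1.le, hz.2⟩)) (hat_nonneg Δ z)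
  calc _ ≤ ∫ z in (-Δ)..Δ, hat Δ z * μ :=
        intervalIntegral.norm_integral_le_of_norm_le (by linarith)
          (Filter.Eventually.of_forall fun z hz => b z hz) (i3.mul_const μ)
    _ = μ := by rw [intervalIntegral.integral_mul_const, integral_hat hΔ, one_mul]

theorem abs_average_sub_le {h t₁ t₂ C μ : ℝ} (hh : 0 < h) (ht : t₂ - t₁ = h) {f : ℝ → ℝ}
    (hf : IntervalIntegrable f volume t₁ t₂)
    (hb : ∀ t ∈ Ioc t₁ t₂, |f t - C| ≤ μ) : |(∫ t in t₁..t₂, f t) / h - C| ≤ μ := by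
  have e : (∫ t in t₁..t₂, f t) / h - C = (∫ t in t₁..t₂, (f t - C)) / h := by
    rw [intervalIntegral.integral_sub hf (by simp), intervalIntegral.integral_const, ht, smul_eq_mul]
    field_simp
  rw [e, abs_div, abs_of_pos hh, div_le_iff₀ hh]
  have := intervalIntegral.norm_integral_le_of_norm_le_const (a := t₁) (b := t₂) (f := fun t => f t - C)
    (C := μ) (by rw [uIoc_of_le (by linarith)]; exact hb)
  rwa [ht, abs_of_pos hh] at this

/-- A bounded pair `w, v = a w` satisfying `w_t = v_xx + γ`, `γ = c w`, in integrated
(hat-averaged) form. -/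
structure LinSol (T M K L : ℝ) (w v γ a c : ℝ → ℝ → ℝ) : Prop where
  T_pos : 0 < T
  one_le : 1 ≤ K
  L_nonneg : 0 ≤ L
  cont_w : ContinuousOn (fun q : ℝ × ℝ => w q.1 q.2) (univ ×ˢ Ioc 0 T)
  cont_v : ContinuousOn (fun q : ℝ × ℝ => v q.1 q.2) (univ ×ˢ Ioc 0 T)
  cont_γ : ContinuousOn (fun q : ℝ × ℝ => γ q.1 q.2) (univ ×ˢ Ioc 0 T)
  bdd_w : ∀ x, ∀ t ∈ Icc 0 T, |w x t| ≤ M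
  bdd_v : ∀ x, ∀ t ∈ Ioc 0 T, |v x t| ≤ M
  bdd_γ : ∀ x, ∀ t ∈ Ioc 0 T, |γ x t| ≤ M
  int_zero : ∀ x y, IntervalIntegrable (fun x => w x 0) volume x y
  v_eq : ∀ x, ∀ t ∈ Ioc 0 T, v x t = a x t * w x t
  a_nonneg : ∀ x t, 0 ≤ a x t
  a_le : ∀ x t, a x t ≤ K
  γ_eq : ∀ x, ∀ t ∈ Ioc 0 T, γ x t = c x t * w x t
  c_le : ∀ x t, |c x t| ≤ L
  degenerate : ∀ ε > 0, ∃ η > 0, ∀ x, ∀ t ∈ Ioc 0 T, a x t < η → |w x t| ≤ ε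
  hat_eq : ∀ x Δ t₁ t₂, 0 < Δ → 0 ≤ t₁ → t₁ ≤ t₂ → t₂ ≤ T →
    hatAvg Δ (fun y => w y t₂) x - hatAvg Δ (fun y => w y t₁) x =
      ((∫ t in t₁..t₂, v (x + Δ) t) - 2 * (∫ t in t₁..t₂, v x t) + ∫ t in t₁..t₂, v (x - Δ) t)
        / Δ ^ 2 + ∫ t in t₁..t₂, hatAvg Δ (fun y => γ y t) x

theorem continuous_slice {T t : ℝ} {w : ℝ → ℝ → ℝ}
    (h : ContinuousOn (fun q : ℝ × ℝ => w q.1 q.2) (univ ×ˢ Ioc 0 T)) (ht : t ∈ Ioc 0 T) :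
    Continuous fun x => w x t := by
  have : ContinuousOn (fun x : ℝ => w x t) univ :=
    h.comp (f := fun x : ℝ => (x, t)) (by fun_prop) fun x _ => ⟨mem_univ _, ht⟩
  exact continuousOn_univ.1 this

theorem intervalIntegrable_time {T M t₁ t₂ : ℝ} {f : ℝ → ℝ} (h : ContinuousOn f (Ioc 0 T))
    (hM : ∀ t ∈ Ioc 0 T, |f t| ≤ M) (h1 : 0 ≤ t₁) (h12 : t₁ ≤ t₂) (h2 : t₂ ≤ T) :
    IntervalIntegrable f volume t₁ t₂ := by
  rw [intervalIntegrable_iff_integrableOn_Ioc_of_le h12]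
  have hs : Ioc t₁ t₂ ⊆ Ioc 0 T := Ioc_subset_Ioc h1 h2
  refine Integrable.of_bound ((h.mono hs).aestronglyMeasurable measurableSet_Ioc) M ?_
  exact (ae_restrict_iff' measurableSet_Ioc).2 (Eventually.of_forall fun t ht => hM t (hs ht))

theorem continuousOn_time {T : ℝ} {w : ℝ → ℝ → ℝ}
    (h : ContinuousOn (fun q : ℝ × ℝ => w q.1 q.2) (univ ×ˢ Ioc 0 T)) (x : ℝ) :
    ContinuousOn (fun t => w x t) (Ioc 0 T) :=
  h.comp (f := fun t : ℝ => (x, t)) (by fun_prop) fun t ht => ⟨mem_univ _, ht⟩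

theorem abs_hatAvg_le {Δ M : ℝ} (hΔ : 0 < Δ) {v : ℝ → ℝ} (x : ℝ)
    (hv : IntervalIntegrable v volume (x - Δ) (x + Δ)) (h : ∀ y, |v y| ≤ M) :
    |hatAvg Δ v x| ≤ M := by
  have := abs_hatAvg_sub_le hΔ (C := 0) (μ := M) hv (fun z _ => by simpa using h (x + z))
  simpa using this

theorem continuousOn_hatAvg {T M Δ : ℝ} (hΔ : 0 < Δ) {w : ℝ → ℝ → ℝ}
    (h : ContinuousOn (fun q : ℝ × ℝ => w q.1 q.2) (univ ×ˢ Ioc 0 T))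
    (hM : ∀ x, ∀ t ∈ Ioc 0 T, |w x t| ≤ M) (x : ℝ) :
    ContinuousOn (fun t => hatAvg Δ (fun y => w y t) x) (Ioc 0 T) := by
  intro t ht
  refine intervalIntegral.continuousWithinAt_of_dominated_interval (bound := fun z => hat Δ z * M) ?_ ?_ ?_ ?_
  · filter_upwards [self_mem_nhdsWithin] with s hs
    exact ((continuous_hat Δ).mul ((continuous_slice h hs).comp (continuous_const.add continuous_id))).aestronglyMeasurable
  · filter_upwards [self_mem_nhdsWithin] with s hs
    refine Eventually.of_forall fun z _ => ?_
    rw [Real.norm_eq_abs, abs_mul, abs_of_nonneg (hat_nonneg Δ z)]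
    exact mul_le_mul_of_nonneg_left (hM _ s hs) (hat_nonneg Δ z)
  · exact ((continuous_hat Δ).mul continuous_const).intervalIntegrable _ _
  · refine Eventually.of_forall fun z _ => ?_
    exact continuousWithinAt_const.mul (continuousOn_time h (x + z) t ht)

/-- Regularised diffusion coefficient sampled on the backward space-time grid. -/
def gridDiff (η T h Δ : ℝ) (a : ℝ → ℝ → ℝ) (k : ℕ) (j : ℤ) : ℝ := max η (a (j * Δ) (T - k * h))

/-- Zeroth order coefficient sampled on the backward space-time grid. -/
def gridPot (T h Δ : ℝ) (c : ℝ → ℝ → ℝ) (k : ℕ) (j : ℤ) : ℝ := c (j * Δ) (T - k * h)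

/-- The discrete dual solution with terminal datum `ψ` after `N` steps. -/
def gridDual (η T h Δ : ℝ) (a c : ℝ → ℝ → ℝ) (ψ : ℝ → ℝ) (N : ℕ) : ℤ → ℝ :=
  dualScheme h Δ (gridDiff η T h Δ a) (gridPot T h Δ c) (fun j => ψ (j * Δ)) N

/-- Admissible test profiles for the duality argument. -/
structure TestProfile (R B : ℝ) (ψ : ℝ → ℝ) : Prop where
  nonneg : ∀ x, 0 ≤ ψ x
  le : ∀ x, ψ x ≤ B
  zero : ∀ x, R ≤ |x| → ψ x = 0
  lip : ∀ x y, |ψ x - ψ y| ≤ B * |x - y|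

theorem LinSol.boundedCoeff {T M K L : ℝ} {w v γ a c : ℝ → ℝ → ℝ} (S : LinSol T M K L w v γ a c)
    {η : ℝ} (hη : 0 < η) (hη1 : η ≤ 1) (h Δ : ℝ) (k : ℕ) :
    BoundedCoeff K L (gridDiff η T h Δ a k) (gridPot T h Δ c k) where
  nonneg j := hη.le.trans (le_max_left _ _)
  le j := max_le (hη1.trans S.one_le) (S.a_le _ _)
  abs_le j := S.c_le _ _

theorem TestProfile.bddSupp {R B : ℝ} {ψ : ℝ → ℝ} (hψ : TestProfile R B ψ) {Δ : ℝ} (hΔ : 0 < Δ) :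
    BddSupp fun j : ℤ => ψ (j * Δ) := by
  obtain ⟨J, hJ⟩ := exists_int_gt (R / Δ)
  refine ⟨J, fun j hj => hψ.zero _ ?_⟩
  rw [abs_mul, abs_of_pos hΔ, ← div_le_iff₀ hΔ]
  have : (J : ℝ) < ((|j| : ℤ) : ℝ) := by exact_mod_cast hj
  rw [Int.cast_abs] at this
  linarith

theorem TestProfile.B_nonneg {R B : ℝ} {ψ : ℝ → ℝ} (hψ : TestProfile R B ψ) : 0 ≤ B :=
  (hψ.nonneg 0).trans (hψ.le 0)

theorem TestProfile.le_exp {R B : ℝ} {ψ : ℝ → ℝ} (hψ : TestProfile R B ψ) {Δ : ℝ} (hΔ : 0 < Δ)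
    (j : ℤ) : ψ (j * Δ) ≤ B * Real.exp (2 * R) * Real.exp (-(2 * (|(j:ℝ)| * Δ))) := by
  have hB := hψ.B_nonneg
  rcases le_or_gt R |(j:ℝ) * Δ| with hj | hj
  · rw [hψ.zero _ hj]; positivity
  · rw [abs_mul, abs_of_pos hΔ] at hj
    rw [mul_assoc, ← Real.exp_add]
    calc ψ (j * Δ) ≤ B * 1 := by rw [mul_one]; exact hψ.le _
      _ ≤ _ := by
        gcongr
        apply Real.one_le_exp
        linarith

theorem TestProfile.energy {R B : ℝ} {ψ : ℝ → ℝ} (hψ : TestProfile R B ψ) {Δ : ℝ} (hΔ : 0 < Δ)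
    (hΔ' : Δ ≤ 1 / 2) :
    Δ * (∑' j, expWeight Δ j * diffQuot Δ (fun j : ℤ => ψ (j * Δ)) j ^ 2) ≤
      4 * (B ^ 2 * Real.exp (2 * (R + 1))) := by
  have bs : BddSupp (diffQuot Δ (fun j : ℤ => ψ (j * Δ))) :=
    (hψ.bddSupp hΔ).of_neighbours fun j h1 h2 _ => by
      unfold diffQuot; beta_reduce at *; rw [h1, h2]; simp
  refine mesh_tsum_le_of_le_expDecay hΔ hΔ' (by positivity) (bs.of_zero fun j h => by rw [h]; ring)
    fun j => ?_
  have p := expWeight_pos Δ j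
  have hB := hψ.B_nonneg
  rcases le_or_gt (R + 1) (|(j:ℝ)| * Δ) with hj | hj
  · have e1 : ψ (j * Δ) = 0 := hψ.zero _ (by rw [abs_mul, abs_of_pos hΔ]; linarith)
    have e2 : ψ ((j + 1 : ℤ) * Δ) = 0 := by
      refine hψ.zero _ ?_
      rw [abs_mul, abs_of_pos hΔ]
      have : |(j:ℝ)| - 1 ≤ |((j + 1 : ℤ) : ℝ)| := by
        push_cast
        have := abs_sub_abs_le_abs_sub (j:ℝ) (j + 1)
        have h2 : |(j:ℝ) - (j + 1)| = 1 := by norm_num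
        linarith
      nlinarith
    have : diffQuot Δ (fun j : ℤ => ψ (j * Δ)) j = 0 := by
      unfold diffQuot; beta_reduce; rw [e1, e2]; simp
    rw [this]
    have := expDecay_pos Δ j
    simp only [ne_eq, OfNat.ofNat_ne_zero, not_false_eq_true, zero_pow, mul_zero]
    positivity
  · have e : diffQuot Δ (fun j : ℤ => ψ (j * Δ)) j ^ 2 ≤ B ^ 2 := by
      rw [← sq_abs]
      have : |diffQuot Δ (fun j : ℤ => ψ (j * Δ)) j| ≤ B := by
        unfold diffQuot
        rw [abs_div, abs_of_pos hΔ, div_le_iff₀ hΔ]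
        refine (hψ.lip _ _).trans (le_of_eq ?_)
        push_cast
        rw [show ((j:ℝ) + 1) * Δ - j * Δ = Δ by ring, abs_of_pos hΔ]
      gcongr
    calc _ ≤ expWeight Δ j * B ^ 2 := by gcongr
      _ ≤ _ := by
        rw [mul_comm, mul_assoc]
        gcongr
        unfold expWeight expDecay
        rw [← Real.exp_add]
        apply Real.exp_le_exp.2
        linarith

theorem duality_constants {T B' D₀ Mb ε : ℝ} (hT : 0 < T) (hB' : 0 ≤ B') (hD : 0 ≤ D₀) (hM : 0 ≤ Mb)
    (hε : 0 < ε) :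
    ∃ κ > 0, ∀ η, 0 < η → η ≤ 1 → ∃ lam > 0, ∃ δ > 0, ∃ R > 0, ∀ h, h ≤ δ → ∀ D, D ≤ D₀ / η →
      lam * D + 4 * T * ((2 * η * κ) ^ 2 / (4 * lam * η) + B' * (2 * η * κ)) +
      (Mb ^ 2 / (4 * lam * η) + B' * Mb) * (4 * (δ + h) + 8 * T * Real.exp (-(R / 2))) ≤ ε := by
  set Q := (T + 1) * (D₀ + 1) * (B' + 1) with hQ
  have hQ0 : 0 < Q := by positivity
  have hQ1 : (T + 1) * (D₀ + 1) ≤ Q := le_mul_of_one_le_right (by positivity) (by linarith)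
  have hQ1' : T * (D₀ + 1) ≤ Q := by nlinarith
  have hQ2 : T * B' ≤ Q := by
    rw [hQ]
    calc T * B' = T * 1 * B' := by ring
      _ ≤ (T + 1) * (D₀ + 1) * (B' + 1) := by gcongr <;> linarith
  have hQ3 : 1 ≤ Q := by
    rw [hQ]
    calc (1:ℝ) = 1 * 1 * 1 := by ring
      _ ≤ (T + 1) * (D₀ + 1) * (B' + 1) := by gcongr <;> linarith
  refine ⟨ε / (32 * Q), by positivity, fun η hη hη1 => ?_⟩
  set lam := ε * η / (4 * (D₀ + 1)) with hlam
  have hlam0 : 0 < lam := by positivity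
  set C := Mb ^ 2 / (4 * lam * η) + B' * Mb with hC
  have hC0 : 0 ≤ C := by positivity
  set q := ε / (96 * (C + 1) * (T + 1)) with hq
  have hq0 : 0 < q := by positivity
  refine ⟨lam, hlam0, ε / (96 * (C + 1)), by positivity, max 1 (-(2 * Real.log q)), by positivity, ?_⟩
  intro h hh D hD'
  have t1 : lam * D ≤ ε / 4 := by
    calc lam * D ≤ lam * (D₀ / η) := by gcongr
      _ = ε / 4 * (D₀ / (D₀ + 1)) := by rw [hlam]; field_simp
      _ ≤ ε / 4 * 1 := by gcongr; rw [div_le_one (by positivity)]; linarith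
      _ = _ := by ring
  have t2 : 4 * T * ((2 * η * (ε / (32 * Q))) ^ 2 / (4 * lam * η)) ≤ ε / 4 := by
    have : 4 * T * ((2 * η * (ε / (32 * Q))) ^ 2 / (4 * lam * η)) = ε / 64 * (T * (D₀ + 1) / Q) / Q := by
      rw [hlam]; field_simp; ring
    rw [this]
    calc ε / 64 * (T * (D₀ + 1) / Q) / Q ≤ ε / 64 * 1 / 1 := by
          gcongr; rw [div_le_one hQ0]; exact hQ1'
      _ ≤ _ := by linarith
  have t3 : 4 * T * (B' * (2 * η * (ε / (32 * Q)))) ≤ ε / 4 := by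
    have : 4 * T * (B' * (2 * η * (ε / (32 * Q)))) = ε / 4 * (η * (T * B' / Q)) := by field_simp; ring
    rw [this]
    have h1 : T * B' / Q ≤ 1 := by rw [div_le_one hQ0]; exact hQ2
    calc ε / 4 * (η * (T * B' / Q)) ≤ ε / 4 * (1 * 1) := by gcongr
      _ = _ := by ring
  have t4 : C * (4 * (ε / (96 * (C + 1)) + h)) ≤ ε / 12 := by
    calc C * (4 * (ε / (96 * (C + 1)) + h)) ≤ C * (4 * (ε / (96 * (C + 1)) + ε / (96 * (C + 1)))) := by
          gcongr
      _ = ε / 12 * (C / (C + 1)) := by field_simp; ring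
      _ ≤ ε / 12 * 1 := by gcongr; rw [div_le_one (by positivity)]; linarith
      _ = _ := by ring
  have t5 : C * (8 * T * Real.exp (-(max 1 (-(2 * Real.log q)) / 2))) ≤ ε / 12 := by
    have : Real.exp (-(max 1 (-(2 * Real.log q)) / 2)) ≤ q := by
      rw [← Real.exp_log hq0]
      apply Real.exp_le_exp.2
      have := le_max_right 1 (-(2 * Real.log q))
      rw [Real.exp_log hq0]
      linarith
    calc C * (8 * T * Real.exp (-(max 1 (-(2 * Real.log q)) / 2))) ≤ C * (8 * T * q) := by gcongr
      _ = ε / 12 * (C / (C + 1) * (T / (T + 1))) := by rw [hq]; field_simp; ring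
      _ ≤ ε / 12 * (1 * 1) := by
        gcongr
        · rw [div_le_one (by positivity)]; linarith
        · rw [div_le_one (by positivity)]; linarith
      _ = _ := by ring
  nlinarith

theorem LinSol.duality {T M K L : ℝ} {w v γ a c : ℝ → ℝ → ℝ} (S : LinSol T M K L w v γ a c)
    {R₀ B : ℝ} {ψ : ℝ → ℝ} (hψ : TestProfile R₀ B ψ) {ε : ℝ} (hε : 0 < ε) :
    ∃ η₁ > 0, η₁ ≤ 1 ∧ ∀ η, 0 < η → η ≤ η₁ → ∃ δ > 0, ∀ (Δ h : ℝ) (N : ℕ), Δ < δ →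
      StableMesh h Δ K L → N * h = T →
      |Δ * (∑' j : ℤ, hatAvg Δ (fun y => w y T) (j * Δ) * ψ (j * Δ)) -
        Δ * ∑' j : ℤ, hatAvg Δ (fun y => w y 0) (j * Δ) * gridDual η T h Δ a c ψ N j| ≤ ε := by
  have hT := S.T_pos
  have hL := S.L_nonneg
  have hK := S.one_le
  have hM : 0 ≤ M := (abs_nonneg _).trans (S.bdd_w 0 T ⟨hT.le, le_rfl⟩)
  have hB := hψ.B_nonneg
  set B₁ := B * Real.exp (2 * R₀) with hB₁
  set B' := Real.exp (T * (8 * K + L)) * B₁ with hB'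
  set CE := 4 * (B ^ 2 * Real.exp (2 * (R₀ + 1))) with hCE
  set D₀ := Real.exp (T * (32 * K + 4 * L)) * (CE + T * ((4 * L ^ 2 + 2 * L + L ^ 2) *
        (4 * B' ^ 2))) with hD₀
  set Mb := M * (1 + K + L) with hMb
  obtain ⟨κ, hκ, hconst⟩ := duality_constants (T := T) (B' := B') (D₀ := D₀) (Mb := Mb) hT
    (by positivity) (by positivity) (by positivity) hε
  obtain ⟨η₁, hη₁, hdeg⟩ := S.degenerate κ hκ
  refine ⟨min η₁ 1, by positivity, min_le_right _ _, fun η hη hηle => ?_⟩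
  have hη1 : η ≤ 1 := hηle.trans (min_le_right _ _)
  have hηη : η ≤ η₁ := hηle.trans (min_le_left _ _)
  obtain ⟨lam, hlam, δ, hδ, R, hR, hfin⟩ := hconst η hη hη1
  set μ := η * κ / (1 + K + L) with hμ
  have hμ0 : 0 < μ := by positivity
  have hμeq : (1 + K + L) * μ = η * κ := by rw [hμ]; field_simp
  -- uniform continuity on a compact box
  have hbox : IsCompact (Icc (-R - 1) (R + 1) ×ˢ Icc δ T) := isCompact_Icc.prod isCompact_Icc
  have hsub : Icc (-R - 1) (R + 1) ×ˢ Icc δ T ⊆ univ ×ˢ Ioc 0 T := fun q hq =>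
    ⟨mem_univ _, hδ.trans_le hq.2.1, hq.2.2⟩
  have uc : ∀ {g : ℝ → ℝ → ℝ}, ContinuousOn (fun q : ℝ × ℝ => g q.1 q.2) (univ ×ˢ Ioc 0 T) →
      ∃ ρ > 0, ∀ x ∈ Icc (-R - 1) (R + 1), ∀ x' ∈ Icc (-R - 1) (R + 1), ∀ t ∈ Icc δ T,
        ∀ t' ∈ Icc δ T, |x - x'| < ρ → |t - t'| < ρ → |g x t - g x' t'| ≤ μ := by
    intro g hg
    have := hbox.uniformContinuousOn_of_continuous (hg.mono hsub)
    obtain ⟨ρ, hρ, h⟩ := Metric.uniformContinuousOn_iff.1 this μ hμ0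
    refine ⟨ρ, hρ, fun x hx x' hx' t ht t' ht' h1 h2 => ?_⟩
    have := h (x, t) ⟨hx, ht⟩ (x', t') ⟨hx', ht'⟩ (by
      rw [Prod.dist_eq]; exact max_lt h1 h2)
    exact this.le
  obtain ⟨ρ₁, hρ₁, u₁⟩ := uc S.cont_w
  obtain ⟨ρ₂, hρ₂, u₂⟩ := uc S.cont_v
  obtain ⟨ρ₃, hρ₃, u₃⟩ := uc S.cont_γ
  refine ⟨min (min ρ₁ ρ₂) (min ρ₃ δ), by positivity, fun Δ h N hΔlt H hN => ?_⟩
  have hh := H.h_pos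
  have hΔ := H.mesh_pos
  have hΔ' := H.mesh_le
  obtain ⟨⟨l1, l2⟩, l3, l4⟩ : (Δ < ρ₁ ∧ Δ < ρ₂) ∧ Δ < ρ₃ ∧ Δ < δ := by
    simpa only [lt_min_iff] using hΔlt
  have hhΔ : h ≤ Δ := by
    have := H.cfl
    have : h * 1 ≤ h * K := by gcongr
    nlinarith
  set t : ℕ → ℝ := fun k => T - k * h with ht
  have tk : ∀ k < N, 0 ≤ t (k + 1) ∧ t (k + 1) ≤ t k ∧ t k ∈ Ioc 0 T ∧ t k - t (k + 1) = h := by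
    intro k hk
    have h1 : ((k:ℝ) + 1) * h ≤ N * h := by
      have : (k:ℝ) + 1 ≤ N := by exact_mod_cast hk
      gcongr
    have h2 : 0 ≤ (k:ℝ) * h := by positivity
    simp only [ht]
    push_cast
    refine ⟨by linarith, by linarith, ⟨by linarith, by linarith⟩, by ring⟩
  set W : ℕ → ℤ → ℝ := fun k j => hatAvg Δ (fun y => w y (t k)) (j * Δ) with hW
  set Y : ℕ → ℤ → ℝ := fun k j => (∫ s in t (k + 1)..t k, v (j * Δ) s) / h with hY
  set G : ℕ → ℤ → ℝ := fun k j => (∫ s in t (k + 1)..t k, hatAvg Δ (fun y => γ y s) (j * Δ)) / h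
    with hG
  have int_w : ∀ s ∈ Icc 0 T, ∀ x y, IntervalIntegrable (fun x => w x s) volume x y := by
    intro s hs x y
    rcases hs.1.eq_or_lt with h0 | h0
    · subst h0; exact S.int_zero x y
    · exact (continuous_slice S.cont_w ⟨h0, hs.2⟩).intervalIntegrable _ _
  have int_γ : ∀ s ∈ Ioc 0 T, ∀ x y, IntervalIntegrable (fun x => γ x s) volume x y :=
    fun s hs x y => (continuous_slice S.cont_γ hs).intervalIntegrable _ _
  have bddγ : ∀ x, ∀ s ∈ Ioc 0 T, |hatAvg Δ (fun y => γ y s) x| ≤ M := fun x s hs =>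
    abs_hatAvg_le hΔ x (int_γ s hs _ _) fun y => S.bdd_γ y s hs
  have intY : ∀ x, ∀ k < N, IntervalIntegrable (fun s => v x s) volume (t (k + 1)) (t k) :=
    fun x k hk => intervalIntegrable_time (continuousOn_time S.cont_v x) (S.bdd_v x)
      (tk k hk).1 (tk k hk).2.1 (tk k hk).2.2.1.2
  have intG : ∀ x, ∀ k < N,
      IntervalIntegrable (fun s => hatAvg Δ (fun y => γ y s) x) volume (t (k + 1)) (t k) :=
    fun x k hk => intervalIntegrable_time (continuousOn_hatAvg hΔ S.cont_γ S.bdd_γ x) (bddγ x)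
      (tk k hk).1 (tk k hk).2.1 (tk k hk).2.2.1.2
  have tmem : ∀ k < N, ∀ s ∈ Ioc (t (k + 1)) (t k), s ∈ Ioc 0 T := fun k hk s hs =>
    ⟨(tk k hk).1.trans_lt hs.1, hs.2.trans (tk k hk).2.2.1.2⟩
  have near : ∀ k < N, (k + 1) * h ≤ T - δ → ∀ j : ℤ, |(j:ℝ)| * Δ ≤ R →
      |W (k + 1) j - w (j * Δ) (t k)| ≤ μ ∧ |Y k j - v (j * Δ) (t k)| ≤ μ ∧
      |G k j - γ (j * Δ) (t k)| ≤ μ := by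
    intro k hk hkT j hj
    obtain ⟨q1, q2, q3, q4⟩ := tk k hk
    have hx : |(j:ℝ) * Δ| ≤ R := by rwa [abs_mul, abs_of_pos hΔ]
    have hx' := abs_le.1 hx
    have hδt : δ ≤ t (k + 1) := by simp only [ht]; push_cast; linarith
    have xm : (j:ℝ) * Δ ∈ Icc (-R - 1) (R + 1) := ⟨by linarith, by linarith⟩
    have xz : ∀ z, |z| ≤ Δ → (j:ℝ) * Δ + z ∈ Icc (-R - 1) (R + 1) := fun z hz => by
      have := abs_le.1 hz
      exact ⟨by linarith, by linarith⟩
    have tm : t k ∈ Icc δ T := ⟨by linarith, q3.2⟩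
    have sm : ∀ s ∈ Icc (t (k + 1)) (t k), s ∈ Icc δ T ∧ |s - t k| ≤ Δ := fun s hs =>
      ⟨⟨by linarith [hs.1], by linarith [hs.2, q3.2]⟩, by
        rw [abs_le]; exact ⟨by linarith [hs.1], by linarith [hs.2]⟩⟩
    refine ⟨?_, ?_, ?_⟩
    · refine abs_hatAvg_sub_le hΔ (int_w _ ⟨q1, by linarith [q3.2]⟩ _ _) fun z hz => ?_
      have s1 := sm (t (k + 1)) ⟨le_rfl, q2⟩
      exact u₁ _ (xz z hz) _ xm _ s1.1 _ tm (by simpa using hz.trans_lt l1) (s1.2.trans_lt l1)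
    · refine abs_average_sub_le hh q4 (intY _ k hk) fun s hs => ?_
      have s1 := sm s ⟨hs.1.le, hs.2⟩
      exact u₂ _ xm _ xm _ s1.1 _ tm (by simpa using hρ₂) (s1.2.trans_lt l2)
    · refine abs_average_sub_le hh q4 (intG _ k hk) fun s hs => ?_
      have s1 := sm s ⟨hs.1.le, hs.2⟩
      refine abs_hatAvg_sub_le hΔ (int_γ s (tmem k hk s hs) _ _) fun z hz => ?_
      exact u₃ _ (xz z hz) _ xm _ s1.1 _ tm (by simpa using hz.trans_lt l3) (s1.2.trans_lt l3)
  have bddW : ∀ k < N, ∀ j, |W (k + 1) j| ≤ M := by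
    intro k hk j
    obtain ⟨q1, q2, q3, q4⟩ := tk k hk
    exact abs_hatAvg_le hΔ _ (int_w _ ⟨q1, by linarith [q3.2]⟩ _ _)
      fun y => S.bdd_w y _ ⟨q1, by linarith [q3.2]⟩
  have bddY : ∀ k < N, ∀ j, |Y k j| ≤ M := by
    intro k hk j
    have := abs_average_sub_le hh (tk k hk).2.2.2 (C := 0) (μ := M) (intY (j * Δ) k hk)
      fun s hs => by simpa using S.bdd_v _ s (tmem k hk s hs)
    simpa using this
  have bddG : ∀ k < N, ∀ j, |G k j| ≤ M := by
    intro k hk j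
    have := abs_average_sub_le hh (tk k hk).2.2.2 (C := 0) (μ := M) (intG (j * Δ) k hk)
      fun s hs => by simpa using bddγ _ s (tmem k hk s hs)
    simpa using this
  have hc := S.boundedCoeff hη hη1 h Δ
  have main := dualScheme_error (R := R) (ξ := 2 * η * κ) (M := Mb) (δ := δ) (lam := lam)
    (c := gridPot T h Δ c) (B := B₁) (CE := CE) (W := W) (Y := Y) (G := G) H hc hη hlam
    (fun k j => le_max_left _ _) (hψ.bddSupp hΔ) (fun j => hψ.nonneg _) (by positivity)
    (hψ.le_exp hΔ) (hψ.energy hΔ hΔ') hN (by positivity) (by positivity) hδ.le ?_ ?_ ?_ ?_ ?_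
  · have e0 : t 0 = T := by simp [ht]
    have eN : t N = 0 := by simp [ht, hN]
    simp only [hW, e0, eN] at main
    refine main.trans (hfin h (hhΔ.trans l4.le) _ ?_)
    rw [le_div_iff₀ hη, hD₀, mul_assoc]
    refine mul_le_mul_of_nonneg_left ?_ (Real.exp_pos _).le
    have e : (4 * L ^ 2 / η + 2 * L + L ^ 2) * η ≤ 4 * L ^ 2 + 2 * L + L ^ 2 := by
      have : (4 * L ^ 2 / η + 2 * L + L ^ 2) * η = 4 * L ^ 2 + (2 * L + L ^ 2) * η := by field_simp; ring
      rw [this]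
      have : (2 * L + L ^ 2) * η ≤ (2 * L + L ^ 2) * 1 := by gcongr
      linarith
    have hCE0 : 0 ≤ CE := by positivity
    calc (CE + T * ((4 * L ^ 2 / η + 2 * L + L ^ 2) * (4 * B' ^ 2))) * η
        = CE * η + T * (((4 * L ^ 2 / η + 2 * L + L ^ 2) * η) * (4 * B' ^ 2)) := by ring
      _ ≤ CE * 1 + T * ((4 * L ^ 2 + 2 * L + L ^ 2) * (4 * B' ^ 2)) := by gcongr
      _ = _ := by ring
  · intro k hk j
    have e := S.hat_eq (j * Δ) Δ (t (k + 1)) (t k) hΔ (tk k hk).1 (tk k hk).2.1 (tk k hk).2.2.1.2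
    have e1 : ((j + 1 : ℤ) : ℝ) * Δ = j * Δ + Δ := by push_cast; ring
    have e2 : ((j - 1 : ℤ) : ℝ) * Δ = j * Δ - Δ := by push_cast; ring
    simp only [hW, hY, hG, secondDiff, e1, e2]
    field_simp
    field_simp at e
    linarith
  · intro k hk hkT j hj
    obtain ⟨n1, n2, -⟩ := near k hk hkT j hj
    have q3 := (tk k hk).2.2.1
    have ha := S.a_nonneg (j * Δ) (t k)
    have ev := S.v_eq (j * Δ) (t k) q3
    have eα : gridDiff η T h Δ a k j = max η (a (j * Δ) (t k)) := rfl
    have hαK : |gridDiff η T h Δ a k j| ≤ K := by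
      rw [abs_of_nonneg ((hc k).nonneg j)]; exact (hc k).le j
    have m1 : |gridDiff η T h Δ a k j * (w (j * Δ) (t k) - W (k + 1) j)| ≤ K * μ := by
      rw [abs_mul, abs_sub_comm]; gcongr
    have m2 : |(a (j * Δ) (t k) - gridDiff η T h Δ a k j) * w (j * Δ) (t k)| ≤ η * κ := by
      rw [eα]
      rcases le_or_gt η (a (j * Δ) (t k)) with hle | hlt
      · rw [max_eq_right hle]; simp; positivity
      · rw [max_eq_left hlt.le, abs_mul]
        have := hdeg (j * Δ) (t k) q3 (hlt.trans_le hηη)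
        have h2 : |a (j * Δ) (t k) - η| ≤ η := by rw [abs_le]; constructor <;> linarith
        gcongr
    have e : Y k j - gridDiff η T h Δ a k j * W (k + 1) j = (Y k j - v (j * Δ) (t k)) +
        (gridDiff η T h Δ a k j * (w (j * Δ) (t k) - W (k + 1) j)) +
        ((a (j * Δ) (t k) - gridDiff η T h Δ a k j) * w (j * Δ) (t k)) := by rw [ev]; ring
    rw [e]
    refine (abs_add_three _ _ _).trans ?_
    have : 0 ≤ L * μ := by positivity
    linarith
  · intro k hk hkT j hj
    obtain ⟨n1, -, n3⟩ := near k hk hkT j hj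
    have q3 := (tk k hk).2.2.1
    have ev := S.γ_eq (j * Δ) (t k) q3
    have m1 : |gridPot T h Δ c k j * (w (j * Δ) (t k) - W (k + 1) j)| ≤ L * μ := by
      rw [abs_mul, abs_sub_comm]
      have := (hc k).abs_le j
      gcongr
    have e : G k j - gridPot T h Δ c k j * W (k + 1) j = (G k j - γ (j * Δ) (t k)) +
        (gridPot T h Δ c k j * (w (j * Δ) (t k) - W (k + 1) j)) := by
      rw [ev]; unfold gridPot; ring
    rw [e]
    refine (abs_add_le _ _).trans ?_
    have : 0 ≤ K * μ := by positivity
    have : 0 ≤ η * κ := by positivity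
    linarith
  · intro k hk j
    have hαK : |gridDiff η T h Δ a k j| ≤ K := by
      rw [abs_of_nonneg ((hc k).nonneg j)]; exact (hc k).le j
    refine (abs_sub _ _).trans ?_
    rw [abs_mul]
    have b1 := bddY k hk j
    have b2 : |gridDiff η T h Δ a k j| * |W (k + 1) j| ≤ K * M := by
      have := bddW k hk j
      gcongr
    have : 0 ≤ M * L := by positivity
    linarith
  · intro k hk j
    refine (abs_sub _ _).trans ?_
    rw [abs_mul]
    have b1 := bddG k hk j
    have b2 : |gridPot T h Δ c k j| * |W (k + 1) j| ≤ L * M := by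
      have := bddW k hk j
      have := (hc k).abs_le j
      gcongr
    have : 0 ≤ M * K := by positivity
    linarith

/-- The hat average of a second derivative is a centred second difference quotient. -/
theorem hatAvg_second_deriv {Δ : ℝ} (hΔ : 0 < Δ) {F F' F'' : ℝ → ℝ}
    (h1 : ∀ x, HasDerivAt F (F' x) x) (h2 : ∀ x, HasDerivAt F' (F'' x) x) (hc : Continuous F'')
    (x : ℝ) : hatAvg Δ F'' x = (F (x + Δ) - 2 * F x + F (x - Δ)) / Δ ^ 2 := by
  have hcz : Continuous fun z => F'' (x + z) := hc.comp (continuous_const.add continuous_id)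
  have i : ∀ a b, IntervalIntegrable (fun z => hat Δ z * F'' (x + z)) volume a b := fun a b =>
    ((continuous_hat Δ).mul hcz).intervalIntegrable a b
  unfold hatAvg
  rw [← intervalIntegral.integral_add_adjacent_intervals (i (-Δ) 0) (i 0 Δ)]
  have d1 : ∀ z, HasDerivAt (fun z => F (x + z)) (F' (x + z)) z := fun z =>
    HasDerivAt.comp_const_add x z (h1 (x + z))
  have d2 : ∀ z, HasDerivAt (fun z => F' (x + z)) (F'' (x + z)) z := fun z =>
    HasDerivAt.comp_const_add x z (h2 (x + z))
  have e1 : ∫ z in (-Δ)..0, hat Δ z * F'' (x + z) = (Δ * F' x - F x + F (x - Δ)) / Δ ^ 2 := by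
    have e : ∫ z in (-Δ)..0, hat Δ z * F'' (x + z) = ∫ z in (-Δ)..0, (Δ + z) * F'' (x + z) / Δ ^ 2 := by
      refine intervalIntegral.integral_congr fun z hz => ?_
      rw [uIcc_of_le (by linarith)] at hz
      simp only [hat]
      rw [abs_of_nonpos hz.2, max_eq_right (by linarith [hz.1])]
      ring
    rw [e, intervalIntegral.integral_div]
    congr 1
    have hd : ∀ z ∈ uIcc (-Δ) 0, HasDerivAt (fun z => (Δ + z) * F' (x + z) - F (x + z))
        ((Δ + z) * F'' (x + z)) z := fun z _ => by
      have := (((hasDerivAt_id z).const_add Δ).mul (d2 z)).sub (d1 z)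
      refine HasDerivAt.congr_deriv (f' := _) this ?_
      simp only [id_eq]
      ring
    rw [intervalIntegral.integral_eq_sub_of_hasDerivAt hd
      (((continuous_const.add continuous_id).mul hcz).intervalIntegrable _ _)]
    simp [sub_eq_add_neg]
  have e2 : ∫ z in (0:ℝ)..Δ, hat Δ z * F'' (x + z) = (F (x + Δ) - F x - Δ * F' x) / Δ ^ 2 := by
    have e : ∫ z in (0:ℝ)..Δ, hat Δ z * F'' (x + z) = ∫ z in (0:ℝ)..Δ, (Δ - z) * F'' (x + z) / Δ ^ 2 := by
      refine intervalIntegral.integral_congr fun z hz => ?_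
      rw [uIcc_of_le (by linarith)] at hz
      simp only [hat]
      rw [abs_of_nonneg hz.1, max_eq_right (by linarith [hz.2])]
      ring
    rw [e, intervalIntegral.integral_div]
    congr 1
    have hd : ∀ z ∈ uIcc (0:ℝ) Δ, HasDerivAt (fun z => (Δ - z) * F' (x + z) + F (x + z))
        ((Δ - z) * F'' (x + z)) z := fun z _ => by
      have := (((hasDerivAt_id z).const_sub Δ).mul (d2 z)).add (d1 z)
      refine HasDerivAt.congr_deriv (f' := _) this ?_
      simp only [id_eq]
      ring
    rw [intervalIntegral.integral_eq_sub_of_hasDerivAt hd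
      (((continuous_const.sub continuous_id).mul hcz).intervalIntegrable _ _)]
    simp
    ring
  rw [e1, e2]
  ring

/-- A classical function, compactly supported in space, with the derivatives used in the
consistency estimate. -/
structure SpaceTimeProfile (T R B : ℝ) (F Fτ Fx Fxx : ℝ → ℝ → ℝ) : Prop where
  nonneg : ∀ x τ, 0 ≤ F x τ
  le : ∀ x, ∀ τ ∈ Icc 0 T, F x τ ≤ B
  deriv_time : ∀ x, ∀ τ ∈ Icc 0 T, HasDerivAt (fun s => F x s) (Fτ x τ) τ
  deriv_space : ∀ τ ∈ Icc 0 T, ∀ x, HasDerivAt (fun y => F y τ) (Fx x τ) x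
  deriv_space_two : ∀ τ ∈ Icc 0 T, ∀ x, HasDerivAt (fun y => Fx y τ) (Fxx x τ) x
  cont_time : ContinuousOn (fun q : ℝ × ℝ => Fτ q.1 q.2) (univ ×ˢ Icc 0 T)
  cont_space : ContinuousOn (fun q : ℝ × ℝ => Fxx q.1 q.2) (univ ×ˢ Icc 0 T)
  zero_time : ∀ x, R ≤ |x| → ∀ τ ∈ Icc 0 T, Fτ x τ = 0
  zero_space : ∀ x, R ≤ |x| → ∀ τ ∈ Icc 0 T, Fxx x τ = 0

theorem uniform_modulus {T R : ℝ} {g : ℝ → ℝ → ℝ}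
    (hg : ContinuousOn (fun q : ℝ × ℝ => g q.1 q.2) (univ ×ˢ Icc 0 T))
    (h0 : ∀ x, R ≤ |x| → ∀ τ ∈ Icc 0 T, g x τ = 0) {μ : ℝ} (hμ : 0 < μ) :
    ∃ ρ > 0, ∀ x x' t t', t ∈ Icc 0 T → t' ∈ Icc 0 T → |x - x'| < ρ → |t - t'| < ρ →
      |g x t - g x' t'| ≤ μ := by
  have hbox : IsCompact (Icc (-R - 1) (R + 1) ×ˢ Icc 0 T) := isCompact_Icc.prod isCompact_Icc
  have := hbox.uniformContinuousOn_of_continuous (hg.mono fun q hq => ⟨mem_univ _, hq.2⟩)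
  obtain ⟨ρ, hρ, h⟩ := Metric.uniformContinuousOn_iff.1 this μ hμ
  refine ⟨min ρ 1, by positivity, fun x x' t t' ht ht' hx htt => ?_⟩
  have hx1 := abs_lt.1 (hx.trans_le (min_le_right _ _))
  by_cases hb : x ∈ Icc (-R - 1) (R + 1) ∧ x' ∈ Icc (-R - 1) (R + 1)
  · exact (h (x, t) ⟨hb.1, ht⟩ (x', t') ⟨hb.2, ht'⟩ (by
      rw [Prod.dist_eq]
      exact max_lt (hx.trans_le (min_le_left _ _)) (htt.trans_le (min_le_left _ _)))).le
  · have : R ≤ |x| ∧ R ≤ |x'| := by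
      constructor <;> rw [le_abs] <;> by_contra hcon <;> push Not at hcon <;> apply hb <;>
        constructor <;> constructor <;> linarith
    rw [h0 x this.1 t ht, h0 x' this.2 t' ht']
    simpa using hμ.le

theorem SpaceTimeProfile.consistency {T R B K L : ℝ} {F Fτ Fx Fxx : ℝ → ℝ → ℝ}
    (P : SpaceTimeProfile T R B F Fτ Fx Fxx) (hK : 0 < K) {ε : ℝ} (hε : 0 < ε) :
    ∃ δ > 0, ∀ (Δ h : ℝ) (k : ℕ) (α c : ℤ → ℝ) (j : ℤ), Δ < δ → StableMesh h Δ K L →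
      (k + 1) * h ≤ T → BoundedCoeff K L α c →
      Fτ (j * Δ) (k * h) ≤ α j * Fxx (j * Δ) (k * h) - L * F (j * Δ) (k * h) →
      F (j * Δ) ((k + 1 : ℕ) * h) - h * ε ≤
        eulerStep h Δ α c (fun j => F (j * Δ) (k * h)) j := by
  obtain ⟨ρ₁, hρ₁, u₁⟩ := uniform_modulus P.cont_time P.zero_time (half_pos hε)
  obtain ⟨ρ₂, hρ₂, u₂⟩ := uniform_modulus P.cont_space P.zero_space
    (show 0 < ε / (2 * K) by positivity)
  refine ⟨min ρ₁ ρ₂, by positivity, fun Δ h k α c j hlt H hk hc hineq => ?_⟩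
  have hh := H.h_pos
  have hΔ := H.mesh_pos
  obtain ⟨l1, l2⟩ := lt_min_iff.1 hlt
  have hhΔ : h ≤ Δ := by
    have := H.cfl
    have h1 : h * 1 ≤ h * K := by gcongr; exact H.one_le
    nlinarith [H.mesh_le]
  set x := (j:ℝ) * Δ
  set τ := (k:ℝ) * h with hτ
  have hτ0 : 0 ≤ τ := by positivity
  have ek : ((k + 1 : ℕ) : ℝ) * h = τ + h := by push_cast; rw [hτ]; ring
  have hτT : τ + h ≤ T := by rw [hτ]; linarith
  have τm : τ ∈ Icc 0 T := ⟨hτ0, by linarith⟩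
  rw [ek]
  obtain ⟨s, hs, hsd⟩ := exists_hasDerivAt_eq_slope (fun s => F x s) (fun s => Fτ x s)
    (show τ < τ + h by linarith)
    (fun s hs => (P.deriv_time x s ⟨by linarith [hs.1], by linarith [hs.2]⟩).continuousAt.continuousWithinAt)
    (fun s hs => P.deriv_time x s ⟨by linarith [hs.1], by linarith [hs.2]⟩)
  have e1 : F x (τ + h) = F x τ + h * Fτ x s := by
    rw [hsd, add_sub_cancel_left, mul_div_cancel₀ _ hh.ne']; ring
  have e2 : Fτ x s ≤ Fτ x τ + ε / 2 := by
    have := u₁ x x s τ ⟨by linarith [hs.1], by linarith [hs.2]⟩ τm (by simpa using hρ₁)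
      (by rw [abs_of_pos (by linarith [hs.1])]; linarith [hs.2])
    linarith [(abs_le.1 this).2]
  have e3 : |secondDiff Δ (fun j => F (j * Δ) τ) j - Fxx x τ| ≤ ε / (2 * K) := by
    have hcont : Continuous fun y => Fxx y τ := by
      have : ContinuousOn (fun y : ℝ => Fxx y τ) univ :=
        P.cont_space.comp (f := fun y : ℝ => (y, τ)) (by fun_prop) fun y _ => ⟨mem_univ _, τm⟩
      exact continuousOn_univ.1 this
    have : secondDiff Δ (fun j => F (j * Δ) τ) j = hatAvg Δ (fun y => Fxx y τ) x := by
      rw [hatAvg_second_deriv hΔ (P.deriv_space τ τm) (P.deriv_space_two τ τm) hcont]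
      unfold secondDiff
      push_cast
      rw [add_mul, sub_mul, one_mul]
    rw [this]
    refine abs_hatAvg_sub_le hΔ (hcont.intervalIntegrable _ _) fun z hz => ?_
    exact u₂ _ _ _ _ τm τm (by simpa using hz.trans_lt l2) (by simpa using hρ₂)
  have e4 : α j * Fxx x τ - ε / 2 ≤ α j * secondDiff Δ (fun j => F (j * Δ) τ) j := by
    have h1 := (abs_le.1 e3).1
    have h2 : α j * (ε / (2 * K)) ≤ K * (ε / (2 * K)) := by gcongr; exact hc.le j
    have h3 : K * (ε / (2 * K)) = ε / 2 := by field_simp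
    have h4 := mul_le_mul_of_nonneg_left h1 (hc.nonneg j)
    linarith
  have e5 : -(L * F x τ) ≤ c j * F x τ := by
    have := (abs_le.1 (hc.abs_le j)).1
    have := mul_le_mul_of_nonneg_right this (P.nonneg x τ)
    linarith
  unfold eulerStep
  rw [e1]
  have : h * (Fτ x s - ε) ≤ h * (α j * secondDiff Δ (fun j => F (j * Δ) τ) j + c j * F x τ) := by
    gcongr
    linarith
  show _ ≤ F x τ + _
  linarith

theorem hasDerivAt_posPart_pow (n : ℕ) (q : ℝ) :
    HasDerivAt (fun q : ℝ => max 0 q ^ (n + 2)) ((n + 2) * max 0 q ^ (n + 1)) q := by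
  rcases lt_trichotomy q 0 with hq | rfl | hq
  · have : (fun q : ℝ => max 0 q ^ (n + 2)) =ᶠ[nhds q] fun _ => 0 := by
      filter_upwards [Iio_mem_nhds hq] with y hy
      rw [max_eq_left (le_of_lt hy)]; simp
    rw [max_eq_left hq.le]
    simpa using (hasDerivAt_const q (0:ℝ)).congr_of_eventuallyEq this
  · rw [hasDerivAt_iff_isLittleO_nhds_zero]
    simp only [zero_add, max_self, ne_eq, Nat.add_eq_zero_iff, OfNat.ofNat_ne_zero, and_false, not_false_eq_true, zero_pow, sub_zero, one_ne_zero, mul_zero, smul_eq_mul]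
    have h1 : (fun h : ℝ => max 0 h ^ (n + 2)) =O[nhds 0] fun h : ℝ => h ^ (n + 2) := by
      refine Asymptotics.IsBigO.of_bound 1 (Eventually.of_forall fun h => ?_)
      rw [one_mul, norm_pow, norm_pow]
      gcongr
      rw [Real.norm_eq_abs, Real.norm_eq_abs, abs_of_nonneg (le_max_left _ _)]
      exact max_le (abs_nonneg _) (le_abs_self _)
    exact h1.trans_isLittleO (Asymptotics.isLittleO_pow_id (by lia))
  · have : (fun q : ℝ => max 0 q ^ (n + 2)) =ᶠ[nhds q] fun q => q ^ (n + 2) := by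
      filter_upwards [Ioi_mem_nhds hq] with y hy
      rw [max_eq_right (le_of_lt hy)]
    rw [max_eq_right hq.le]
    have h2 := (hasDerivAt_pow (n + 2) q).congr_of_eventuallyEq this
    simpa using h2

/-- Data of a moving parabolic barrier on the backward time interval `[0, T]`: squared width `σ`,
centre `ζ`, logarithmic amplitude `g`, with their derivatives. -/
structure BarrierPath (T : ℝ) (σ σ' ζ ζ' g g' : ℝ → ℝ) : Prop where
  width_pos : ∀ τ ∈ Icc 0 T, 0 < σ τ
  deriv_width : ∀ τ ∈ Icc 0 T, HasDerivAt σ (σ' τ) τ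
  deriv_centre : ∀ τ ∈ Icc 0 T, HasDerivAt ζ (ζ' τ) τ
  deriv_amp : ∀ τ ∈ Icc 0 T, HasDerivAt g (g' τ) τ
  cont_width : ContinuousOn σ' (Icc 0 T)
  cont_centre : ContinuousOn ζ' (Icc 0 T)
  cont_amp : ContinuousOn g' (Icc 0 T)
  amp_nonpos : ∀ τ ∈ Icc 0 T, g τ ≤ 0

/-- The inverted parabola of a barrier. -/
def barrierArg (Λ : ℝ) (σ ζ : ℝ → ℝ) (x τ : ℝ) : ℝ := 1 - (x - ζ τ) ^ 2 / (Λ * σ τ)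

/-- The moving parabolic barrier. -/
def barrier (Λ : ℝ) (σ ζ g : ℝ → ℝ) (x τ : ℝ) : ℝ :=
  Real.exp (g τ) * max 0 (barrierArg Λ σ ζ x τ) ^ 3

/-- The time derivative of the barrier. -/
def barrierTime (Λ : ℝ) (σ σ' ζ ζ' g g' : ℝ → ℝ) (x τ : ℝ) : ℝ :=
  Real.exp (g τ) * (g' τ * max 0 (barrierArg Λ σ ζ x τ) ^ 3 +
    3 * max 0 (barrierArg Λ σ ζ x τ) ^ 2 *
      (2 * (x - ζ τ) * ζ' τ / (Λ * σ τ) + (x - ζ τ) ^ 2 * σ' τ / (Λ * σ τ ^ 2)))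

/-- The space derivative of the barrier. -/
def barrierSpace (Λ : ℝ) (σ ζ g : ℝ → ℝ) (x τ : ℝ) : ℝ :=
  Real.exp (g τ) * (3 * max 0 (barrierArg Λ σ ζ x τ) ^ 2 * (-(2 * (x - ζ τ) / (Λ * σ τ))))

/-- The second space derivative of the barrier. -/
def barrierSpaceTwo (Λ : ℝ) (σ ζ g : ℝ → ℝ) (x τ : ℝ) : ℝ :=
  Real.exp (g τ) * (24 * max 0 (barrierArg Λ σ ζ x τ) * ((x - ζ τ) ^ 2 / (Λ * σ τ) ^ 2) -
    6 * max 0 (barrierArg Λ σ ζ x τ) ^ 2 / (Λ * σ τ))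

theorem BarrierPath.profile {T Λ R : ℝ} {σ σ' ζ ζ' g g' : ℝ → ℝ} (P : BarrierPath T σ σ' ζ ζ' g g')
    (hΛ : 0 < Λ) (hR : ∀ x, R ≤ |x| → ∀ τ ∈ Icc 0 T, barrierArg Λ σ ζ x τ ≤ 0) :
    SpaceTimeProfile T R 1 (barrier Λ σ ζ g) (barrierTime Λ σ σ' ζ ζ' g g') (barrierSpace Λ σ ζ g)
      (barrierSpaceTwo Λ σ ζ g) where
  nonneg x τ := by unfold barrier; positivity
  le x τ hτ := by
    have hσ := P.width_pos τ hτ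
    have h1 : max 0 (barrierArg Λ σ ζ x τ) ≤ 1 := by
      refine max_le (by norm_num) ?_
      unfold barrierArg
      have : 0 ≤ (x - ζ τ) ^ 2 / (Λ * σ τ) := by positivity
      linarith
    have h2 : Real.exp (g τ) ≤ 1 := Real.exp_le_one_iff.2 (P.amp_nonpos τ hτ)
    have h3 : max 0 (barrierArg Λ σ ζ x τ) ^ 3 ≤ 1 := pow_le_one₀ (le_max_left _ _) h1
    unfold barrier
    exact mul_le_one₀ h2 (by positivity) h3
  deriv_time x τ hτ := by
    have hσ := P.width_pos τ hτ
    have dq : HasDerivAt (fun s => barrierArg Λ σ ζ x s)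
        (2 * (x - ζ τ) * ζ' τ / (Λ * σ τ) + (x - ζ τ) ^ 2 * σ' τ / (Λ * σ τ ^ 2)) τ := by
      have h1 := ((P.deriv_centre τ hτ).const_sub x).pow 2
      have h2 := (P.deriv_width τ hτ).const_mul Λ
      have h3 := (h1.div h2 (by positivity)).const_sub 1
      refine HasDerivAt.congr_deriv (f' := _) h3 ?_
      simp only [Pi.pow_apply]
      field_simp
      ring
    have d3 := (hasDerivAt_posPart_pow 1 (barrierArg Λ σ ζ x τ)).comp τ dq
    have := (P.deriv_amp τ hτ).exp.mul d3
    refine HasDerivAt.congr_deriv (f' := _) this ?_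
    simp only [barrierTime, Function.comp]
    push_cast
    ring
  deriv_space τ hτ x := by
    have hσ := P.width_pos τ hτ
    have dq : HasDerivAt (fun y => barrierArg Λ σ ζ y τ) (-(2 * (x - ζ τ) / (Λ * σ τ))) x := by
      have h3 := ((((hasDerivAt_id x).sub_const (ζ τ)).pow 2).div_const (Λ * σ τ)).const_sub 1
      refine HasDerivAt.congr_deriv (f' := _) h3 ?_
      simp
    have d3 := (hasDerivAt_posPart_pow 1 (barrierArg Λ σ ζ x τ)).comp x dq
    have := d3.const_mul (Real.exp (g τ))
    refine HasDerivAt.congr_deriv (f' := _) this ?_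
    simp only [barrierSpace]
    push_cast
    ring
  deriv_space_two τ hτ x := by
    have hσ := P.width_pos τ hτ
    have dq : HasDerivAt (fun y => barrierArg Λ σ ζ y τ) (-(2 * (x - ζ τ) / (Λ * σ τ))) x := by
      have h3 := ((((hasDerivAt_id x).sub_const (ζ τ)).pow 2).div_const (Λ * σ τ)).const_sub 1
      refine HasDerivAt.congr_deriv (f' := _) h3 ?_
      simp
    have d2 := (hasDerivAt_posPart_pow 0 (barrierArg Λ σ ζ x τ)).comp x dq
    have dl := ((((hasDerivAt_id x).sub_const (ζ τ)).const_mul 2).div_const (Λ * σ τ)).neg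
    have := ((d2.const_mul 3).mul dl).const_mul (Real.exp (g τ))
    refine HasDerivAt.congr_deriv (f' := _) this ?_
    simp only [barrierSpaceTwo, Function.comp, id, Pi.neg_apply]
    field_simp
    push_cast
    ring
  cont_time := by
    have cσ : ContinuousOn (fun q : ℝ × ℝ => σ q.2) (univ ×ˢ Icc 0 T) :=
      ContinuousOn.comp (t := Icc 0 T) (fun τ hτ => (P.deriv_width τ hτ).continuousAt.continuousWithinAt)
        continuousOn_snd fun q hq => hq.2
    have cζ : ContinuousOn (fun q : ℝ × ℝ => ζ q.2) (univ ×ˢ Icc 0 T) :=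
      ContinuousOn.comp (t := Icc 0 T) (fun τ hτ => (P.deriv_centre τ hτ).continuousAt.continuousWithinAt)
        continuousOn_snd fun q hq => hq.2
    have cg : ContinuousOn (fun q : ℝ × ℝ => g q.2) (univ ×ˢ Icc 0 T) :=
      ContinuousOn.comp (t := Icc 0 T) (fun τ hτ => (P.deriv_amp τ hτ).continuousAt.continuousWithinAt)
        continuousOn_snd fun q hq => hq.2
    have cσ' : ContinuousOn (fun q : ℝ × ℝ => σ' q.2) (univ ×ˢ Icc 0 T) :=
      P.cont_width.comp continuousOn_snd fun q hq => hq.2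
    have cζ' : ContinuousOn (fun q : ℝ × ℝ => ζ' q.2) (univ ×ˢ Icc 0 T) :=
      P.cont_centre.comp continuousOn_snd fun q hq => hq.2
    have cg' : ContinuousOn (fun q : ℝ × ℝ => g' q.2) (univ ×ˢ Icc 0 T) :=
      P.cont_amp.comp continuousOn_snd fun q hq => hq.2
    have n1 : ∀ q ∈ (univ ×ˢ Icc 0 T : Set (ℝ × ℝ)), Λ * σ q.2 ≠ 0 := fun q hq =>
      (mul_pos hΛ (P.width_pos _ hq.2)).ne'
    have n2 : ∀ q ∈ (univ ×ˢ Icc 0 T : Set (ℝ × ℝ)), Λ * σ q.2 ^ 2 ≠ 0 := fun q hq =>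
      (mul_pos hΛ (pow_pos (P.width_pos _ hq.2) 2)).ne'
    have cq : ContinuousOn (fun q : ℝ × ℝ => barrierArg Λ σ ζ q.1 q.2) (univ ×ˢ Icc 0 T) := by
      exact continuousOn_const.sub (((continuousOn_fst.sub cζ).pow 2).div (continuousOn_const.mul cσ) n1)
    have cm : ContinuousOn (fun q : ℝ × ℝ => max 0 (barrierArg Λ σ ζ q.1 q.2)) (univ ×ˢ Icc 0 T) :=
      continuousOn_const.sup cq
    exact cg.rexp.mul ((cg'.mul (cm.pow 3)).add ((continuousOn_const.mul (cm.pow 2)).mul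
      ((((continuousOn_const.mul (continuousOn_fst.sub cζ)).mul cζ').div (continuousOn_const.mul cσ) n1).add
        ((((continuousOn_fst.sub cζ).pow 2).mul cσ').div (continuousOn_const.mul (cσ.pow 2)) n2))))
  cont_space := by
    have cσ : ContinuousOn (fun q : ℝ × ℝ => σ q.2) (univ ×ˢ Icc 0 T) :=
      ContinuousOn.comp (t := Icc 0 T) (fun τ hτ => (P.deriv_width τ hτ).continuousAt.continuousWithinAt)
        continuousOn_snd fun q hq => hq.2
    have cζ : ContinuousOn (fun q : ℝ × ℝ => ζ q.2) (univ ×ˢ Icc 0 T) :=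
      ContinuousOn.comp (t := Icc 0 T) (fun τ hτ => (P.deriv_centre τ hτ).continuousAt.continuousWithinAt)
        continuousOn_snd fun q hq => hq.2
    have cg : ContinuousOn (fun q : ℝ × ℝ => g q.2) (univ ×ˢ Icc 0 T) :=
      ContinuousOn.comp (t := Icc 0 T) (fun τ hτ => (P.deriv_amp τ hτ).continuousAt.continuousWithinAt)
        continuousOn_snd fun q hq => hq.2
    have n1 : ∀ q ∈ (univ ×ˢ Icc 0 T : Set (ℝ × ℝ)), Λ * σ q.2 ≠ 0 := fun q hq =>
      (mul_pos hΛ (P.width_pos _ hq.2)).ne'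
    have n2 : ∀ q ∈ (univ ×ˢ Icc 0 T : Set (ℝ × ℝ)), (Λ * σ q.2) ^ 2 ≠ 0 := fun q hq =>
      (pow_pos (mul_pos hΛ (P.width_pos _ hq.2)) 2).ne'
    have cq : ContinuousOn (fun q : ℝ × ℝ => barrierArg Λ σ ζ q.1 q.2) (univ ×ˢ Icc 0 T) := by
      exact continuousOn_const.sub (((continuousOn_fst.sub cζ).pow 2).div (continuousOn_const.mul cσ) n1)
    have cm : ContinuousOn (fun q : ℝ × ℝ => max 0 (barrierArg Λ σ ζ q.1 q.2)) (univ ×ˢ Icc 0 T) :=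
      continuousOn_const.sup cq
    exact cg.rexp.mul (((continuousOn_const.mul cm).mul
      (((continuousOn_fst.sub cζ).pow 2).div ((continuousOn_const.mul cσ).pow 2) n2)).sub
        ((continuousOn_const.mul (cm.pow 2)).div (continuousOn_const.mul cσ) n1))
  zero_time x hx τ hτ := by
    unfold barrierTime; rw [max_eq_left (hR x hx τ hτ)]; ring
  zero_space x hx τ hτ := by
    unfold barrierSpaceTwo; rw [max_eq_left (hR x hx τ hτ)]; ring

theorem barrierTime_le_of_arg_nonpos {Λ L α x τ : ℝ} {σ σ' ζ ζ' g g' : ℝ → ℝ}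
    (hq : barrierArg Λ σ ζ x τ ≤ 0) :
    barrierTime Λ σ σ' ζ ζ' g g' x τ ≤ α * barrierSpaceTwo Λ σ ζ g x τ - L * barrier Λ σ ζ g x τ := by
  unfold barrierTime barrierSpaceTwo barrier
  rw [max_eq_left hq]
  simp

theorem barrierTime_le {Λ L α x τ k κ : ℝ} {σ σ' ζ ζ' g g' : ℝ → ℝ} (hΛ : 0 < Λ) (hσ : 0 < σ τ)
    (hg : g' τ = -k * σ' τ / σ τ - κ)
    (h : ∀ q s, 0 < q → 0 ≤ s → q + s = 1 → q = barrierArg Λ σ ζ x τ →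
      0 ≤ (k * σ' τ + (κ - L) * σ τ) * q ^ 2 + 24 * (α / Λ) * s - 6 * (α / Λ) * q
        - 3 * q * s * σ' τ - 6 * q * ((x - ζ τ) * ζ' τ / Λ)) :
    barrierTime Λ σ σ' ζ ζ' g g' x τ ≤ α * barrierSpaceTwo Λ σ ζ g x τ - L * barrier Λ σ ζ g x τ := by
  rcases le_or_gt (barrierArg Λ σ ζ x τ) 0 with hq | hq
  · exact barrierTime_le_of_arg_nonpos hq
  have hs : 0 ≤ (x - ζ τ) ^ 2 / (Λ * σ τ) := by positivity
  have key := h _ _ hq hs (by unfold barrierArg; ring) rfl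
  unfold barrierTime barrierSpaceTwo barrier
  rw [max_eq_right hq.le, hg]
  set q := barrierArg Λ σ ζ x τ
  have : α * (Real.exp (g τ) * (24 * q * ((x - ζ τ) ^ 2 / (Λ * σ τ) ^ 2) - 6 * q ^ 2 / (Λ * σ τ))) -
      L * (Real.exp (g τ) * q ^ 3) - Real.exp (g τ) * ((-k * σ' τ / σ τ - κ) * q ^ 3 + 3 * q ^ 2 *
      (2 * (x - ζ τ) * ζ' τ / (Λ * σ τ) + (x - ζ τ) ^ 2 * σ' τ / (Λ * σ τ ^ 2))) =
      Real.exp (g τ) * q / σ τ * ((k * σ' τ + (κ - L) * σ τ) * q ^ 2 + 24 * (α / Λ) * ((x - ζ τ) ^ 2 / (Λ * σ τ)) - 6 * (α / Λ) * q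
        - 3 * q * ((x - ζ τ) ^ 2 / (Λ * σ τ)) * σ' τ - 6 * q * ((x - ζ τ) * ζ' τ / Λ)) := by
    field_simp
    ring
  have h0 : 0 ≤ Real.exp (g τ) * q / σ τ * ((k * σ' τ + (κ - L) * σ τ) * q ^ 2 + 24 * (α / Λ) * ((x - ζ τ) ^ 2 / (Λ * σ τ)) - 6 * (α / Λ) * q
        - 3 * q * ((x - ζ τ) ^ 2 / (Λ * σ τ)) * σ' τ - 6 * q * ((x - ζ τ) * ζ' τ / Λ)) :=
    mul_nonneg (by positivity) key
  linarith

theorem sharp_form_nonneg {A σ' e q s : ℝ} (hA : 3 / 50 ≤ A) (hA' : A ≤ 9 / 50) (h1 : 9 / 10 ≤ σ')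
    (h2 : σ' ≤ 1) (he : 0 ≤ e) (hq : 0 < q) (hs : 0 ≤ s) (hqs : q + s = 1) :
    0 ≤ (5 / 4 * σ' + e) * q ^ 2 + 24 * A * s - 6 * A * q - 3 * q * s * σ' := by
  have a1 : 0 ≤ e * q ^ 2 := by positivity
  have a2 : 9 / 8 * q ^ 2 ≤ 5 / 4 * σ' * q ^ 2 := by
    have : 0 ≤ q ^ 2 := by positivity
    nlinarith
  have a3 : 3 * q * s * σ' ≤ 3 * q * s := by
    have : 0 ≤ 3 * q * s := by positivity
    nlinarith
  have e1 : 24 * A * s = 24 * A * s * (q + s) := by rw [hqs]; ring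
  have e2 : 6 * A * q = 6 * A * q * (q + s) := by rw [hqs]; ring
  have b : 0 ≤ 24 * A * s ^ 2 + (18 * A - 3) * (q * s) + (9 / 8 - 6 * A) * q ^ 2 := by
    have c1 : 0 ≤ 24 * (3/50) * s ^ 2 + (18 * (3/50) - 3) * (q * s) + (9 / 8 - 6 * (3/50)) * q ^ 2 := by
      nlinarith [sq_nonneg (3 * s - 2 * q)]
    have c2 : 0 ≤ 24 * (9/50) * s ^ 2 + (18 * (9/50) - 3) * (q * s) + (9 / 8 - 6 * (9/50)) * q ^ 2 := by
      have : 0 ≤ q * s := by positivity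
      nlinarith [sq_nonneg s, sq_nonneg q]
    nlinarith [mul_nonneg (sub_nonneg.2 hA') c1, mul_nonneg (sub_nonneg.2 hA) c2]
  nlinarith

theorem coarse_form_nonneg {A Alo Ahi V W k σ' E q s : ℝ} (hlo : 0 < Alo) (hA : Alo ≤ A) (hA' : A ≤ Ahi)
    (h1 : 0 ≤ σ') (h2 : σ' ≤ 1) (hk : 0 ≤ k) (hW : |W| ≤ V)
    (hE : (24 * Alo + (6 * Ahi + 3 + 6 * V)) ^ 2 ≤ 96 * Alo * E) (hq : 0 < q) (hs : 0 ≤ s)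
    (hqs : q + s = 1) :
    0 ≤ (k * σ' + E) * q ^ 2 + 24 * A * s - 6 * A * q - 3 * q * s * σ' - 6 * q * W := by
  have hWa := (abs_le.1 hW).2
  set β := 6 * Ahi + 3 + 6 * V
  have a1 : 0 ≤ k * σ' * q ^ 2 := by positivity
  have a2 : 24 * Alo * s ≤ 24 * A * s := by gcongr
  have a3 : 6 * A * q + 3 * q * s * σ' + 6 * q * W ≤ β * q := by
    have : s * σ' ≤ 1 := mul_le_one₀ (by linarith) h1 h2
    have e : 6 * A * q + 3 * q * s * σ' + 6 * q * W = (6 * A + 3 * (s * σ') + 6 * W) * q := by ring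
    rw [e]
    gcongr
    simp only [β]
    linarith
  have e1 : s = 1 - q := by linarith
  have a4 : 0 ≤ E * q ^ 2 + 24 * Alo * (1 - q) - β * q := by
    have : 0 ≤ 96 * Alo * (E * q ^ 2 + 24 * Alo * (1 - q) - β * q) := by
      have := mul_le_mul_of_nonneg_right hE (sq_nonneg q)
      nlinarith [sq_nonneg ((24 * Alo + β) * q - 48 * Alo)]
    exact nonneg_of_mul_nonneg_right this (by positivity)
  rw [e1] at a2 ⊢
  rw [e1] at a3
  linarith

/-- Squared width of the standard barrier. -/
def barrierWidth (r ε₀ τ : ℝ) : ℝ := r ^ 2 + ε₀ * (1 - Real.exp (-(τ / ε₀)))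

/-- Logarithmic amplitude of the standard barrier. -/
def barrierAmp (κ r ε₀ τ : ℝ) : ℝ := -(5 / 4) * Real.log (barrierWidth r ε₀ τ / r ^ 2) - κ * τ

/-- Centre of the standard barrier: it moves from `x₀` to `z` during `[τb, τe]`. -/
def barrierCentre (x₀ z τb τe τ : ℝ) : ℝ :=
  x₀ + (z - x₀) * Real.smoothTransition ((τ - τb) / (τe - τb))

theorem barrierWidth_ge {r ε₀ τ : ℝ} (hε : 0 < ε₀) (hτ : 0 ≤ τ) : r ^ 2 ≤ barrierWidth r ε₀ τ := by
  unfold barrierWidth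
  have : Real.exp (-(τ / ε₀)) ≤ 1 := Real.exp_le_one_iff.2 (by have := div_nonneg hτ hε.le; linarith)
  have : 0 ≤ ε₀ * (1 - Real.exp (-(τ / ε₀))) := mul_nonneg hε.le (by linarith)
  linarith

theorem barrierWidth_le {r ε₀ : ℝ} (hε : 0 < ε₀) (τ : ℝ) : barrierWidth r ε₀ τ ≤ r ^ 2 + ε₀ := by
  unfold barrierWidth
  have : 0 ≤ ε₀ * Real.exp (-(τ / ε₀)) := by positivity
  linarith

theorem hasDerivAt_barrierWidth {r ε₀ : ℝ} (hε : 0 < ε₀) (τ : ℝ) :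
    HasDerivAt (barrierWidth r ε₀) (Real.exp (-(τ / ε₀))) τ := by
  have := ((((hasDerivAt_id τ).div_const ε₀).neg.exp.const_sub 1).const_mul ε₀).const_add (r ^ 2)
  refine HasDerivAt.congr_deriv (f' := _) this ?_
  simp
  field_simp

theorem contDiff_barrierCentre (x₀ z τb τe : ℝ) : ContDiff ℝ 1 (barrierCentre x₀ z τb τe) := by
  unfold barrierCentre
  exact contDiff_const.add (contDiff_const.mul (Real.smoothTransition.contDiff.comp (by fun_prop)))

theorem abs_barrierCentre_le (x₀ z τb τe τ : ℝ) : |barrierCentre x₀ z τb τe τ| ≤ |x₀| + |z| := by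
  unfold barrierCentre
  set s := Real.smoothTransition ((τ - τb) / (τe - τb))
  have h0 : 0 ≤ s := Real.smoothTransition.nonneg _
  have h1 : s ≤ 1 := Real.smoothTransition.le_one _
  have e : x₀ + (z - x₀) * s = (1 - s) * x₀ + s * z := by ring
  rw [e]
  refine (abs_add_le _ _).trans ?_
  rw [abs_mul, abs_mul, abs_of_nonneg h0, abs_of_nonneg (by linarith : (0:ℝ) ≤ 1 - s)]
  have := abs_nonneg x₀
  have := abs_nonneg z
  nlinarith

theorem barrierPath_standard {T κ r ε₀ x₀ z τb τe : ℝ} (hε : 0 < ε₀) (hr : 0 < r) (hκ : 0 ≤ κ) :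
    BarrierPath T (barrierWidth r ε₀) (fun τ => Real.exp (-(τ / ε₀)))
      (barrierCentre x₀ z τb τe) (deriv (barrierCentre x₀ z τb τe)) (barrierAmp κ r ε₀)
      (fun τ => -(5 / 4) * Real.exp (-(τ / ε₀)) / barrierWidth r ε₀ τ - κ) := by
  have pos : ∀ τ ∈ Icc 0 T, 0 < barrierWidth r ε₀ τ := fun τ hτ =>
    (by positivity : 0 < r ^ 2).trans_le (barrierWidth_ge hε hτ.1)
  have cw : Continuous (barrierWidth r ε₀) :=
    continuous_iff_continuousAt.2 fun τ => (hasDerivAt_barrierWidth hε τ).continuousAt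
  have cd := contDiff_barrierCentre x₀ z τb τe
  refine ⟨pos, fun τ _ => hasDerivAt_barrierWidth hε τ,
    fun τ _ => (cd.differentiable (by norm_num) τ).hasDerivAt, fun τ hτ => ?_, by fun_prop,
    (cd.continuous_deriv (by norm_num)).continuousOn, ?_, fun τ hτ => ?_⟩
  · have p := pos τ hτ
    have h1 := ((hasDerivAt_barrierWidth (r := r) hε τ).div_const (r ^ 2)).log (by positivity)
    have h2 := (h1.const_mul (-(5 / 4))).sub ((hasDerivAt_id τ).const_mul κ)
    refine HasDerivAt.congr_deriv (f' := _) h2 ?_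
    field_simp
  · exact (ContinuousOn.div (by fun_prop) cw.continuousOn fun τ hτ => (pos τ hτ).ne').sub continuousOn_const
  · have h1 : 0 ≤ Real.log (barrierWidth r ε₀ τ / r ^ 2) :=
      Real.log_nonneg ((one_le_div (by positivity)).2 (barrierWidth_ge hε hτ.1))
    unfold barrierAmp
    have := mul_nonneg hκ hτ.1
    linarith

/-- A smooth-enough bump of squared radius `ϱ` centred at `x₀`. -/
def bump (x₀ ϱ x : ℝ) : ℝ := max 0 (1 - (x - x₀) ^ 2 / ϱ) ^ 3

/-- `F` is a classical subsolution of the backward dual problem with terminal datum `ψ`, uniformly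
for all regularisations `max η a` with `η ≤ η₀`. -/
def DualSub (T L η₀ : ℝ) (a : ℝ → ℝ → ℝ) (ψ : ℝ → ℝ) (F : ℝ → ℝ → ℝ) : Prop :=
  ∃ (R : ℝ) (Fτ Fx Fxx : ℝ → ℝ → ℝ), SpaceTimeProfile T R 1 F Fτ Fx Fxx ∧ (∀ x, F x 0 = ψ x) ∧
    ∀ η, 0 < η → η ≤ η₀ → ∀ x, ∀ τ ∈ Ico 0 T,
      Fτ x τ ≤ max η (a x (T - τ)) * Fxx x τ - L * F x τ

theorem barrier_ne_zero {Λ x τ : ℝ} {σ ζ : ℝ → ℝ} (hΛ : 0 < Λ) (hσ : 0 < σ τ) {d : ℝ}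
    (hd : 0 < d) (hle : Λ * σ τ ≤ d ^ 2) (h : 0 < barrierArg Λ σ ζ x τ) : |x - ζ τ| < d := by
  unfold barrierArg at h
  have h1 : (x - ζ τ) ^ 2 / (Λ * σ τ) < 1 := by linarith
  rw [div_lt_one (by positivity)] at h1
  exact abs_lt_of_sq_lt_sq (by linarith) hd.le

theorem dualSub_barrier {T L K η₀ Λ κ r ε₀ x₀ z τb τe d : ℝ} {a : ℝ → ℝ → ℝ}
    (hε : 0 < ε₀) (hr : 0 < r) (hrε : r ^ 2 ≤ ε₀) (hκ : 0 ≤ κ) (hΛ : 0 < Λ) (hd : 0 < d)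
    (hΛd : 2 * Λ * ε₀ ≤ d ^ 2) (hK : 1 ≤ K) (hη₀ : η₀ ≤ 1) (haK : ∀ x t, a x t ≤ K)
    (hform : ∀ α x τ, τ ∈ Ico 0 T → α ≤ K → a x (T - τ) ≤ α → α ≤ max η₀ (a x (T - τ)) →
      |x - barrierCentre x₀ z τb τe τ| < d → ∀ q s, 0 < q → 0 ≤ s → q + s = 1 →
      0 ≤ (5 / 4 * Real.exp (-(τ / ε₀)) + (κ - L) * barrierWidth r ε₀ τ) * q ^ 2 +
        24 * (α / Λ) * s - 6 * (α / Λ) * q - 3 * q * s * Real.exp (-(τ / ε₀)) -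
        6 * q * ((x - barrierCentre x₀ z τb τe τ) * deriv (barrierCentre x₀ z τb τe) τ / Λ))
    (hb : τb < τe) (hb0 : 0 ≤ τb) :
    DualSub T L η₀ a (bump x₀ (Λ * r ^ 2))
      (barrier Λ (barrierWidth r ε₀) (barrierCentre x₀ z τb τe) (barrierAmp κ r ε₀)) := by
  have P := barrierPath_standard (T := T) (x₀ := x₀) (z := z) (τb := τb) (τe := τe) hε hr hκ
  have wd : ∀ τ, Λ * barrierWidth r ε₀ τ ≤ d ^ 2 := fun τ => by
    calc Λ * barrierWidth r ε₀ τ ≤ Λ * (r ^ 2 + ε₀) := by gcongr; exact barrierWidth_le hε τ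
      _ ≤ Λ * (ε₀ + ε₀) := by gcongr
      _ ≤ _ := by linarith
  refine ⟨|x₀| + |z| + d, _, _, _, P.profile hΛ ?_, fun x => ?_, fun η hη hηη x τ hτ => ?_⟩
  · intro x hx τ hτ
    by_contra hcon
    push Not at hcon
    have h1 := barrier_ne_zero hΛ (P.width_pos τ hτ) hd (wd τ) hcon
    have h2 := abs_barrierCentre_le x₀ z τb τe τ
    have h3 := abs_sub_abs_le_abs_sub x (barrierCentre x₀ z τb τe τ)
    linarith
  · have e1 : barrierWidth r ε₀ 0 = r ^ 2 := by simp [barrierWidth]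
    have e2 : barrierCentre x₀ z τb τe 0 = x₀ := by
      unfold barrierCentre
      rw [Real.smoothTransition.zero_of_nonpos (div_nonpos_of_nonpos_of_nonneg (by linarith) (by linarith))]
      ring
    have e3 : barrierAmp κ r ε₀ 0 = 0 := by
      unfold barrierAmp; rw [e1, div_self (by positivity)]; simp
    unfold barrier barrierArg bump
    rw [e1, e2, e3]; simp
  · have hτ' : τ ∈ Icc 0 T := ⟨hτ.1, hτ.2.le⟩
    have hσ := P.width_pos τ hτ'
    refine barrierTime_le hΛ hσ (k := 5 / 4) (κ := κ) rfl fun q s hq hs hqs hqe => ?_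
    refine hform _ x τ hτ ?_ (le_max_right _ _) ?_ ?_ q s hq hs hqs
    · exact max_le (by linarith) (haK _ _)
    · gcongr
    · exact barrier_ne_zero hΛ hσ hd (wd τ) (hqe ▸ hq)

theorem barrier_final_ge {T Λ κ r ε₀ x₀ z τb τe x : ℝ} (hε : 0 < ε₀) (hr : 0 < r)
    (hrε : r ^ 2 ≤ ε₀) (hΛ : 0 < Λ) (hb : τb < τe) (heT : τe ≤ T) (hεT : ε₀ ≤ T)
    (hx : 4 * (x - z) ^ 2 ≤ Λ * ε₀) :
    Real.exp (-(5 / 4) * Real.log (2 * ε₀ / r ^ 2) - κ * T) / 8 ≤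
      barrier Λ (barrierWidth r ε₀) (barrierCentre x₀ z τb τe) (barrierAmp κ r ε₀) x T := by
  have hT : 0 < T := hε.trans_le hεT
  have hw : ε₀ / 2 ≤ barrierWidth r ε₀ T := by
    unfold barrierWidth
    have h1 : Real.exp (-(T / ε₀)) ≤ 1 / 2 := by
      have h2 : 1 ≤ T / ε₀ := (one_le_div hε).2 hεT
      calc Real.exp (-(T / ε₀)) ≤ Real.exp (-1) := Real.exp_le_exp.2 (by linarith)
        _ ≤ 1 / 2 := by
          rw [Real.exp_neg, one_div]
          exact inv_anti₀ (by norm_num) (by linarith [Real.add_one_le_exp (1:ℝ)])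
    have : 0 ≤ r ^ 2 := by positivity
    nlinarith
  have hw0 : 0 < barrierWidth r ε₀ T := by linarith
  have hc : barrierCentre x₀ z τb τe T = z := by
    unfold barrierCentre
    rw [Real.smoothTransition.one_of_one_le ((one_le_div (by linarith)).2 (by linarith))]
    ring
  have hq : 1 / 2 ≤ barrierArg Λ (barrierWidth r ε₀) (barrierCentre x₀ z τb τe) x T := by
    unfold barrierArg
    rw [hc]
    have : (x - z) ^ 2 / (Λ * barrierWidth r ε₀ T) ≤ 1 / 2 := by
      rw [div_le_iff₀ (by positivity)]
      have : Λ * (ε₀ / 2) ≤ Λ * barrierWidth r ε₀ T := by gcongr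
      linarith
    linarith
  have hl : Real.log (barrierWidth r ε₀ T / r ^ 2) ≤ Real.log (2 * ε₀ / r ^ 2) := by
    apply Real.log_le_log (by positivity)
    gcongr
    linarith [barrierWidth_le (r := r) hε T]
  unfold barrier barrierAmp
  rw [max_eq_right (by linarith), div_eq_mul_one_div]
  gcongr ?_ * ?_
  · apply Real.exp_le_exp.2
    linarith
  · calc (1:ℝ) / 8 = (1 / 2) ^ 3 := by norm_num
      _ ≤ _ := by gcongr

/-- Bound for the drift of the centre of the standard barrier. -/
theorem exists_centre_speed (x₀ z τb τe T : ℝ) :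
    ∃ V ≥ 0, ∀ τ ∈ Icc 0 T, |deriv (barrierCentre x₀ z τb τe) τ| ≤ V := by
  have := (contDiff_barrierCentre x₀ z τb τe).continuous_deriv (by norm_num)
  obtain ⟨V, hV⟩ := isCompact_Icc.exists_bound_of_continuousOn (this.continuousOn (s := Icc 0 T))
  exact ⟨max V 0, le_max_right _ _, fun τ hτ => (hV τ hτ).trans (le_max_left _ _)⟩

theorem deriv_barrierCentre_of_lt {x₀ z τb τe τ : ℝ} (hb : τb < τe) (h : τ < τb) :
    deriv (barrierCentre x₀ z τb τe) τ = 0 := by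
  have : barrierCentre x₀ z τb τe =ᶠ[nhds τ] fun _ => x₀ := by
    filter_upwards [Iio_mem_nhds h] with y hy
    have hy' : y < τb := hy
    unfold barrierCentre
    rw [Real.smoothTransition.zero_of_nonpos (div_nonpos_of_nonpos_of_nonneg (by linarith) (by linarith))]
    ring
  rw [this.deriv_eq]; simp

theorem coarse_constant {Alo β σ L : ℝ} (h1 : 0 < Alo) (h2 : 0 < σ) (hL : 0 ≤ L) :
    ∃ κ ≥ L, ∀ w, σ ≤ w → β ^ 2 ≤ 96 * Alo * ((κ - L) * w) := by
  refine ⟨L + β ^ 2 / (96 * Alo * σ), by have : 0 ≤ β ^ 2 / (96 * Alo * σ) := by positivity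
                                         linarith, fun w hw => ?_⟩
  have : 96 * Alo * ((L + β ^ 2 / (96 * Alo * σ) - L) * w) = β ^ 2 * (w / σ) := by field_simp; ring
  rw [this]
  exact le_mul_of_one_le_right (by positivity) ((one_le_div h2).2 hw)

theorem exists_coarse_barrier {T L K η₀ x₀ z τb τe d αlo : ℝ} {a : ℝ → ℝ → ℝ}
    (hb : τb < τe) (hb0 : 0 ≤ τb) (heT : τe ≤ T) (hd : 0 < d) (hL : 0 ≤ L)
    (hK : 1 ≤ K) (hη₀ : η₀ ≤ 1) (haK : ∀ x t, a x t ≤ K) (hαlo : 0 < αlo)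
    (htube : ∀ τ ∈ Ico 0 T, ∀ x, |x - barrierCentre x₀ z τb τe τ| < d → αlo ≤ a x (T - τ)) :
    ∃ ϱ > 0, ∃ c > 0, ∃ ρ > 0, ∃ F, ϱ ≤ d ^ 2 ∧ DualSub T L η₀ a (bump x₀ ϱ) F ∧
      (∀ x, |x - z| ≤ ρ → c ≤ F x T) ∧
      ∀ x, ∀ τ ∈ Icc 0 T, F x τ ≠ 0 → |x - barrierCentre x₀ z τb τe τ| < d := by
  have hT : 0 < T := by linarith
  set ε₀ := min T (d ^ 2 / 2) with hε₀
  have hε : 0 < ε₀ := by positivity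
  have hεT : ε₀ ≤ T := min_le_left _ _
  have hεd : 2 * 1 * ε₀ ≤ d ^ 2 := by have := min_le_right T (d ^ 2 / 2); linarith
  set r := Real.sqrt ε₀ with hr
  have hr0 : 0 < r := Real.sqrt_pos.2 hε
  have hr2 : r ^ 2 = ε₀ := Real.sq_sqrt hε.le
  obtain ⟨V, hV0, hV⟩ := exists_centre_speed x₀ z τb τe T
  obtain ⟨κ, hκL, hκ⟩ := coarse_constant (β := 24 * αlo + (6 * K + 3 + 6 * (d * V))) hαlo hε hL
  have P := barrierPath_standard (T := T) (x₀ := x₀) (z := z) (τb := τb) (τe := τe) hε hr0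
    (hL.trans hκL)
  refine ⟨1 * r ^ 2, by positivity, _, ?_, Real.sqrt ε₀ / 2, by positivity,
    barrier 1 (barrierWidth r ε₀) (barrierCentre x₀ z τb τe) (barrierAmp κ r ε₀), ?_,
    dualSub_barrier (K := K) hε hr0 hr2.le (hL.trans hκL) one_pos hd hεd hK hη₀ haK ?_ hb hb0,
    fun x hx => barrier_final_ge hε hr0 hr2.le one_pos hb heT hεT ?_, ?_⟩
  · positivity
  · linarith
  · intro α x τ hτ hαK hα1 _ hx q s hq hs hqs
    have hτ' : τ ∈ Icc 0 T := ⟨hτ.1, hτ.2.le⟩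
    refine coarse_form_nonneg (Alo := αlo) (Ahi := K) (V := d * V) hαlo ?_ ?_ (Real.exp_pos _).le ?_
      (by norm_num) ?_ (hκ _ ?_) hq hs hqs
    · rw [div_one]; exact (htube τ hτ x hx).trans hα1
    · rw [div_one]; exact hαK
    · exact Real.exp_le_one_iff.2 (by have := div_nonneg hτ.1 hε.le; linarith)
    · rw [div_one, abs_mul]
      have := hV τ hτ'
      gcongr
    · have := barrierWidth_ge (r := r) hε hτ.1
      rwa [hr2] at this
  · have := sq_le_sq' (by linarith [(abs_le.1 hx).1]) (abs_le.1 hx).2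
    rw [div_pow, Real.sq_sqrt hε.le] at this
    linarith
  · intro x τ hτ hne
    refine barrier_ne_zero (Λ := 1) (σ := barrierWidth r ε₀) one_pos (P.width_pos τ hτ) hd ?_ ?_
    · linarith [barrierWidth_le (r := r) hε τ]
    · by_contra hcon
      push Not at hcon
      apply hne
      unfold barrier
      rw [max_eq_left hcon]; simp

theorem exists_sharp_barrier {T L K x₀ z τe d αlo A : ℝ} {a : ℝ → ℝ → ℝ}
    (he0 : 0 < τe) (heT : τe ≤ T) (hd : 0 < d) (hL : 0 ≤ L)
    (hK : 1 ≤ K) (haK : ∀ x t, a x t ≤ K) (hαlo : 0 < αlo) (hA : 0 < A)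
    (htube : ∀ τb, 0 < τb → τb < τe → ∀ τ ∈ Ico 0 T, ∀ x, |x - barrierCentre x₀ z τb τe τ| < d →
      αlo ≤ a x (T - τ))
    (hnear : ∀ τ ∈ Ico 0 τe, ∀ x, |x - x₀| < d →
      3 / 5 * A ≤ a x (T - τ) ∧ a x (T - τ) ≤ 9 / 5 * A) :
    ∃ τb > 0, τb < τe ∧ ∃ ω > 0, ∃ c > 0, ∃ ρ > 0, ∃ s₀ > 0, ∀ s, 0 < s → s ≤ s₀ →
      ∃ F, DualSub T L (min 1 (3 / 5 * A)) a (bump x₀ (ω * s ^ 4)) F ∧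
      (∀ x, |x - z| ≤ ρ → c * s ^ 5 ≤ F x T) ∧
      ∀ x, ∀ τ ∈ Icc 0 T, F x τ ≠ 0 → |x - barrierCentre x₀ z τb τe τ| < d := by
  have hT : 0 < T := by linarith
  set Λ := 10 * A with hΛdef
  have hΛ : 0 < Λ := by positivity
  set ε₀ := min τe (d ^ 2 / (2 * Λ)) with hε₀
  have hε : 0 < ε₀ := by positivity
  have hετ : ε₀ ≤ τe := min_le_left _ _
  have hεT : ε₀ ≤ T := hετ.trans heT
  have hεd : 2 * Λ * ε₀ ≤ d ^ 2 := by
    have := min_le_right τe (d ^ 2 / (2 * Λ))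
    rw [le_div_iff₀ (by positivity)] at this
    linarith
  set τb := ε₀ / 10 with hτb
  have hb0 : 0 < τb := by positivity
  have hb : τb < τe := by linarith
  obtain ⟨V, hV0, hV⟩ := exists_centre_speed x₀ z τb τe T
  set σ := ε₀ * (1 - Real.exp (-(τb / ε₀))) with hσ
  have hσ0 : 0 < σ := by
    have : Real.exp (-(τb / ε₀)) < 1 := Real.exp_lt_one_iff.2 (by have := div_pos hb0 hε; linarith)
    exact mul_pos hε (by linarith)
  obtain ⟨κ, hκL, hκ⟩ := coarse_constant (Alo := αlo / Λ)
    (β := 24 * (αlo / Λ) + (6 * (K / Λ) + 3 + 6 * (d * V / Λ))) (by positivity) hσ0 hL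
  have hκ0 := hL.trans hκL
  refine ⟨τb, hb0, hb, Λ, hΛ, Real.exp (-(5 / 4) * Real.log (2 * ε₀) - κ * T) / 8, by positivity,
    Real.sqrt (Λ * ε₀) / 2, by positivity, min 1 ε₀, by positivity, fun s hs hs0 => ?_⟩
  have hs1 : s ≤ 1 := hs0.trans (min_le_left _ _)
  have hsε : s ≤ ε₀ := hs0.trans (min_le_right _ _)
  have hr : 0 < s ^ 2 := by positivity
  have hrε : (s ^ 2) ^ 2 ≤ ε₀ := by
    calc (s ^ 2) ^ 2 = s * s ^ 3 := by ring
      _ ≤ s * 1 := by gcongr; exact pow_le_one₀ hs.le hs1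
      _ ≤ ε₀ := by linarith
  have P := barrierPath_standard (T := T) (x₀ := x₀) (z := z) (τb := τb) (τe := τe) hε hr hκ0
  refine ⟨barrier Λ (barrierWidth (s ^ 2) ε₀) (barrierCentre x₀ z τb τe) (barrierAmp κ (s ^ 2) ε₀),
    ?_, fun x hx => ?_, fun x τ hτ hne => ?_⟩
  · have := dualSub_barrier (K := K) (L := L) (T := T) (x₀ := x₀) (z := z) (a := a) hε hr hrε hκ0 hΛ hd hεd hK
      (min_le_left 1 (3 / 5 * A)) haK ?_ hb hb0.le
    · rwa [show Λ * (s ^ 2) ^ 2 = Λ * s ^ 4 by ring] at this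
    intro α x τ hτ hαK hα1 hα2 hx q s' hq hs' hqs
    have hτ' : τ ∈ Icc 0 T := ⟨hτ.1, hτ.2.le⟩
    have hexp : Real.exp (-(τ / ε₀)) ≤ 1 :=
      Real.exp_le_one_iff.2 (by have := div_nonneg hτ.1 hε.le; linarith)
    rcases lt_or_ge τ τb with hlt | hge
    · have hc : barrierCentre x₀ z τb τe τ = x₀ := by
        unfold barrierCentre
        rw [Real.smoothTransition.zero_of_nonpos
          (div_nonpos_of_nonpos_of_nonneg (by linarith) (by linarith))]
        ring
      rw [hc] at hx
      obtain ⟨n1, n2⟩ := hnear τ ⟨hτ.1, by linarith⟩ x hx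
      rw [deriv_barrierCentre_of_lt hb hlt]
      have hα3 : α ≤ 9 / 5 * A := hα2.trans (max_le ((min_le_right _ _).trans (by linarith)) n2)
      have := sharp_form_nonneg (A := α / Λ) (σ' := Real.exp (-(τ / ε₀)))
        (e := (κ - L) * barrierWidth (s ^ 2) ε₀ τ) ?_ ?_ ?_ hexp
        (mul_nonneg (by linarith) (P.width_pos τ hτ').le) hq hs' hqs
      · simpa using this
      · rw [le_div_iff₀ hΛ, hΛdef]; linarith
      · rw [div_le_iff₀ hΛ, hΛdef]; linarith
      · have h1 := Real.add_one_le_exp (-(τ / ε₀))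
        have h2 : τ / ε₀ ≤ 1 / 10 := by rw [div_le_iff₀ hε]; linarith
        linarith
    · refine coarse_form_nonneg (Alo := αlo / Λ) (Ahi := K / Λ) (V := d * V / Λ) (by positivity) ?_ ?_
        (Real.exp_pos _).le hexp (by norm_num) ?_ (hκ _ ?_) hq hs' hqs
      · have := (htube τb hb0 hb τ hτ x hx).trans hα1
        gcongr
      · gcongr
      · rw [abs_div, abs_mul, abs_of_pos hΛ]
        have := hV τ hτ'
        gcongr
      · unfold barrierWidth
        have h1 : ε₀ * (1 - Real.exp (-(τb / ε₀))) ≤ ε₀ * (1 - Real.exp (-(τ / ε₀))) := by gcongr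
        have : 0 ≤ (s ^ 2) ^ 2 := by positivity
        linarith
  · have h1 := barrier_final_ge (κ := κ) (x₀ := x₀) (z := z) (x := x) (T := T) hε hr hrε hΛ hb heT hεT ?_
    · refine le_trans (le_of_eq ?_) h1
      have : Real.log (2 * ε₀ / (s ^ 2) ^ 2) = Real.log (2 * ε₀) - 4 * Real.log s := by
        rw [Real.log_div (by positivity) (by positivity), ← pow_mul, Real.log_pow]; norm_num
      rw [this]
      have e : s ^ 5 = Real.exp (5 * Real.log s) := by
        rw [show (5 : ℝ) * Real.log s = Real.log (s ^ 5) by rw [Real.log_pow]; norm_num,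
          Real.exp_log (by positivity)]
      rw [e, div_mul_eq_mul_div, ← Real.exp_add]
      congr 2
      ring
    · have := sq_le_sq' (by linarith [(abs_le.1 hx).1]) (abs_le.1 hx).2
      rw [div_pow, Real.sq_sqrt (by positivity)] at this
      linarith
  · refine barrier_ne_zero (Λ := Λ) (σ := barrierWidth (s ^ 2) ε₀) hΛ (P.width_pos τ hτ) hd ?_ ?_
    · calc Λ * barrierWidth (s ^ 2) ε₀ τ ≤ Λ * ((s ^ 2) ^ 2 + ε₀) := by
            gcongr; exact barrierWidth_le hε τ
        _ ≤ Λ * (ε₀ + ε₀) := by gcongr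
        _ ≤ _ := by linarith
    · by_contra hcon
      push Not at hcon
      apply hne
      unfold barrier
      rw [max_eq_left hcon]; simp

theorem grid_time_mem {T h : ℝ} {N k : ℕ} (hh : 0 < h) (hN : N * h = T) (hk : k < N) :
    (k * h) ∈ Ico 0 T ∧ (k + 1) * h ≤ T := by
  have h1 : (k : ℝ) + 1 ≤ N := by exact_mod_cast hk
  refine ⟨⟨by positivity, ?_⟩, ?_⟩ <;> rw [← hN]
  · gcongr
  · gcongr

theorem DualSub.consistency {T L K η₀ ε : ℝ} {a : ℝ → ℝ → ℝ} {ψ : ℝ → ℝ} {F : ℝ → ℝ → ℝ}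
    (D : DualSub T L η₀ a ψ F) (hK : 0 < K) (hε : 0 < ε) :
    ∃ δ > 0, ∀ (c : ℝ → ℝ → ℝ) (η Δ h : ℝ) (N k : ℕ), 0 < η → η ≤ η₀ → Δ < δ →
      StableMesh h Δ K L → N * h = T → k < N →
      BoundedCoeff K L (gridDiff η T h Δ a k) (gridPot T h Δ c k) → ∀ j : ℤ,
      F (j * Δ) ((k + 1 : ℕ) * h) - h * ε ≤
        eulerStep h Δ (gridDiff η T h Δ a k) (gridPot T h Δ c k) (fun j => F (j * Δ) (k * h)) j := by
  obtain ⟨R, Fτ, Fx, Fxx, P, -, hs⟩ := D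
  obtain ⟨δ, hδ, hc⟩ := P.consistency (L := L) hK hε
  refine ⟨δ, hδ, fun c η Δ h N k hη hη₀ hΔ H hN hk hb j => ?_⟩
  obtain ⟨t1, t2⟩ := grid_time_mem H.h_pos hN hk
  exact hc Δ h k _ _ j hΔ H t2 hb (hs η hη hη₀ _ _ t1)

theorem DualSub.lower {T L K η₀ ε : ℝ} {a : ℝ → ℝ → ℝ} {ψ : ℝ → ℝ} {F : ℝ → ℝ → ℝ}
    (D : DualSub T L η₀ a ψ F) (hT : 0 < T) (hK : 0 < K) (hε : 0 < ε) :
    ∃ δ > 0, ∀ (c : ℝ → ℝ → ℝ) (η Δ h : ℝ) (N : ℕ), 0 < η → η ≤ η₀ → Δ < δ →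
      StableMesh h Δ K L → N * h = T →
      (∀ k, BoundedCoeff K L (gridDiff η T h Δ a k) (gridPot T h Δ c k)) → ∀ j : ℤ,
      F (j * Δ) T - ε ≤ gridDual η T h Δ a c ψ N j := by
  obtain ⟨δ, hδ, hc⟩ := D.consistency hK (show 0 < ε / (T * Real.exp (T * L)) by positivity)
  set e := ε / (T * Real.exp (T * L)) with he
  have he0 : 0 < e := by positivity
  refine ⟨δ, hδ, fun c η Δ h N hη hη₀ hΔ H hN hb => ?_⟩
  have hh := H.h_pos
  have hL := H.L_nonneg
  have hhL : 0 ≤ h * L := by positivity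
  have key : ∀ k ≤ N, ∀ j : ℤ, F (j * Δ) (k * h) - (1 + h * L) ^ k * (k * h * e) ≤
      gridDual η T h Δ a c ψ k j := by
    intro k
    induction k with
    | zero =>
      intro _ j
      obtain ⟨R, Fτ, Fx, Fxx, P, h0, -⟩ := D
      simp [gridDual, dualScheme, h0]
    | succ k ih =>
      intro hk j
      have i1 := hc c η Δ h N k hη hη₀ hΔ H hN hk (hb k) j
      set E := (1 + h * L) ^ k * (k * h * e) with hE
      have hE0 : 0 ≤ E := by positivity
      obtain ⟨l, m, hl, _, hm, hs, hw⟩ := eulerStep_weights H (hb k) j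
      have i2 : gridDual η T h Δ a c ψ (k + 1) j = eulerStep h Δ (gridDiff η T h Δ a k)
        (gridPot T h Δ c k) (gridDual η T h Δ a c ψ k) j := rfl
      rw [hw] at i1
      rw [i2, hw]
      have a1 := mul_le_mul_of_nonneg_left (ih (by omega) j) (by linarith : 0 ≤ m)
      have a2 := mul_le_mul_of_nonneg_left (ih (by omega) (j + 1)) hl
      have a3 := mul_le_mul_of_nonneg_left (ih (by omega) (j - 1)) hl
      have a4 := mul_le_mul_of_nonneg_right hs hE0
      have a5 : (1 + h * L) * E + h * e ≤
          (1 + h * L) ^ (k + 1) * (((k + 1 : ℕ) : ℝ) * h * e) := by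
        have : 1 * (h * e) ≤ (1 + h * L) ^ (k + 1) * (h * e) := by
          gcongr
          exact one_le_pow₀ (by linarith)
        push_cast
        rw [hE, pow_succ] at *
        nlinarith
      linarith
  intro j
  have := key N le_rfl j
  rw [hN] at this
  have hp := one_add_mul_pow_le hh.le hL hN.le
  have h2 : (1 + h * L) ^ N * (T * e) ≤ ε := by
    calc (1 + h * L) ^ N * (T * e) ≤ Real.exp (T * L) * (T * e) := by gcongr
      _ = ε := by rw [he]; field_simp
  linarith

theorem DualSub.minor_lower {T L K η₀ η₁ ε gap : ℝ} {a : ℝ → ℝ → ℝ} {ψ χ : ℝ → ℝ}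
    {F G : ℝ → ℝ → ℝ} (D : DualSub T L η₀ a ψ F) (D' : DualSub T L η₁ a χ G) (hT : 0 < T)
    (hK : 0 < K) (hε : 0 < ε) (hgap : 0 < gap)
    (hsep : ∀ τ ∈ Icc 0 T, ∀ x y, y ≤ x + gap → F x τ * G y τ = 0) :
    ∃ δ > 0, ∀ (c : ℝ → ℝ → ℝ) (η Δ h : ℝ) (N : ℕ), 0 < η → η ≤ η₀ → η ≤ η₁ → Δ < δ →
      StableMesh h Δ K L → N * h = T →
      (∀ k, BoundedCoeff K L (gridDiff η T h Δ a k) (gridPot T h Δ c k)) →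
      ∀ i j : ℤ, i < j → 0 ≤ minor (gridDual η T h Δ a c ψ N) (gridDual η T h Δ a c χ N) i j ∧
      F (i * Δ) T * G (j * Δ) T - ε ≤
        minor (gridDual η T h Δ a c ψ N) (gridDual η T h Δ a c χ N) i j := by
  set e := ε / (2 * T * Real.exp (2 * T * L)) with he
  have he0 : 0 < e := by positivity
  obtain ⟨δ, hδ, hc⟩ := D.consistency hK he0
  obtain ⟨δ', hδ', hc'⟩ := D'.consistency hK he0
  refine ⟨min gap (min δ δ'), by positivity, fun c η Δ h N hη hη₀ hη₁ hΔ H hN hb => ?_⟩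
  obtain ⟨g1, g2, g3⟩ : Δ < gap ∧ Δ < δ ∧ Δ < δ' := by simpa using hΔ
  obtain ⟨R, Fτ, Fx, Fxx, P, F0, -⟩ := D
  obtain ⟨R', Gτ, Gx, Gxx, P', G0, -⟩ := D'
  have hh := H.h_pos
  have hΔ0 := H.mesh_pos
  have hL := H.L_nonneg
  have hhL : 0 ≤ h * L := by positivity
  have sep : ∀ k ≤ N, ∀ i j : ℤ, j ≤ i + 1 → F (i * Δ) (k * h) * G (j * Δ) (k * h) = 0 := by
    intro k hk i j hij
    refine hsep _ ⟨by positivity, ?_⟩ _ _ ?_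
    · rw [← hN]; gcongr
    · have : (j : ℝ) ≤ i + 1 := by exact_mod_cast hij
      nlinarith
  have key : ∀ k ≤ N, ∀ i j : ℤ, i < j →
      0 ≤ minor (gridDual η T h Δ a c ψ k) (gridDual η T h Δ a c χ k) i j ∧
      F (i * Δ) (k * h) * G (j * Δ) (k * h) - ((1 + h * L) ^ 2) ^ k * (k * h * (2 * 1 * e)) ≤
        minor (gridDual η T h Δ a c ψ k) (gridDual η T h Δ a c χ k) i j := by
    intro k
    induction k with
    | zero =>
      intro _ i j hij
      have z := sep 0 (Nat.zero_le _) j i (by omega)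
      simp only [Nat.cast_zero, zero_mul, F0, G0] at z
      have e1 : minor (gridDual η T h Δ a c ψ 0) (gridDual η T h Δ a c χ 0) i j =
          ψ (i * Δ) * χ (j * Δ) := by
        show ψ (i * Δ) * χ (j * Δ) - ψ (j * Δ) * χ (i * Δ) = _
        rw [z, sub_zero]
      have n1 := P.nonneg (i * Δ) 0
      have n2 := P'.nonneg (j * Δ) 0
      rw [F0] at n1
      rw [G0] at n2
      rw [e1]
      refine ⟨mul_nonneg n1 n2, ?_⟩
      simp [F0, G0]
    | succ k ih =>
      intro hk i j hij
      have ih' := ih (by omega)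
      obtain ⟨t1, t2⟩ := grid_time_mem hh hN hk
      have t2' : ((k + 1 : ℕ) : ℝ) * h ∈ Icc 0 T := ⟨by positivity, by push_cast; exact t2⟩
      have i2 : ∀ ψ, gridDual η T h Δ a c ψ (k + 1) = eulerStep h Δ (gridDiff η T h Δ a k)
        (gridPot T h Δ c k) (gridDual η T h Δ a c ψ k) := fun _ => rfl
      rw [i2, i2]
      refine ⟨minor_eulerStep_nonneg H (hb k) (fun i j hij => (ih' i j hij).1) hij, ?_⟩
      set E := ((1 + h * L) ^ 2) ^ k * (k * h * (2 * 1 * e)) with hE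
      have hE0 : 0 ≤ E := by positivity
      have := minor_eulerStep_lower H (hb k) (E := E) (e := e) (B := 1)
        (F := fun j => F (j * Δ) (k * h)) (G := fun j => G (j * Δ) (k * h))
        (F' := fun j => F (j * Δ) ((k + 1 : ℕ) * h)) (G' := fun j => G (j * Δ) ((k + 1 : ℕ) * h))
        hE0 he0.le (fun i j hij => (ih' i j hij).1) (fun _ => P.nonneg _ _) (fun _ => P'.nonneg _ _)
        (fun _ => P.nonneg _ _) (fun _ => P'.nonneg _ _) (fun _ => P.le _ _ t2')
        (fun _ => P'.le _ _ t2') (sep k (by omega)) (sep (k + 1) hk)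
        (hc c η Δ h N k hη hη₀ g2 H hN hk (hb k)) (hc' c η Δ h N k hη hη₁ g3 H hN hk (hb k))
        (fun i j hij => (ih' i j hij).2) hij
      refine le_trans ?_ this
      have a5 : (1 + h * L) ^ 2 * E + h * (2 * 1 * e) ≤
          ((1 + h * L) ^ 2) ^ (k + 1) * (((k + 1 : ℕ) : ℝ) * h * (2 * 1 * e)) := by
        have : 1 * (h * (2 * 1 * e)) ≤ ((1 + h * L) ^ 2) ^ (k + 1) * (h * (2 * 1 * e)) := by
          gcongr
          exact one_le_pow₀ (one_le_pow₀ (by linarith))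
        push_cast at this ⊢
        have e1 : ((1 + h * L) ^ 2) ^ (k + 1) = (1 + h * L) ^ 2 * ((1 + h * L) ^ 2) ^ k :=
          pow_succ' _ _
        have e2 : (1 + h * L) ^ 2 * E =
          ((1 + h * L) ^ 2) ^ (k + 1) * (k * h * (2 * 1 * e)) := by rw [hE, e1]; ring
        rw [e2]
        linarith
      linarith
  intro i j hij
  obtain ⟨k1, k2⟩ := key N le_rfl i j hij
  refine ⟨k1, ?_⟩
  rw [hN] at k2
  have hp := one_add_mul_pow_le hh.le hL hN.le
  have h2 : ((1 + h * L) ^ 2) ^ N * (T * (2 * 1 * e)) ≤ ε := by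
    calc ((1 + h * L) ^ 2) ^ N * (T * (2 * 1 * e)) = ((1 + h * L) ^ N) ^ 2 * (T * (2 * 1 * e)) := by
          rw [← pow_mul, ← pow_mul, mul_comm 2 N]
      _ ≤ (Real.exp (T * L)) ^ 2 * (T * (2 * 1 * e)) := by gcongr
      _ = ε := by
          rw [he, ← Real.exp_nat_mul]
          push_cast
          rw [show (2 : ℝ) * (T * L) = 2 * T * L by ring]
          field_simp
  linarith

/-- Smooth mollifiers. -/
def mollifier (n : ℕ) : ContDiffBump (0 : ℝ) where
  rIn := 1 / (n + 2) / 2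
  rOut := 1 / (n + 2)
  rIn_pos := by positivity
  rIn_lt_rOut := half_lt_self (by positivity)

theorem mollifier_tendsto {q : ℝ → ℝ} (hq : Continuous q) (x : ℝ) :
    Tendsto (fun n => ∫ z, (mollifier n).normed volume z * q (x + z)) atTop (nhds (q x)) := by
  have h0 : Tendsto (fun n => (mollifier n).rOut) atTop (nhds 0) := by
    have : Tendsto (fun n : ℕ => 1 / ((n : ℝ) + 2)) atTop (nhds 0) := by
      have h := (tendsto_one_div_add_atTop_nhds_zero_nat (𝕜 := ℝ)).comp (tendsto_add_atTop_nat 1)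
      refine h.congr fun n => ?_
      simp only [Function.comp]; push_cast; ring
    exact this
  have := ContDiffBump.convolution_tendsto_right_of_continuous (μ := volume) h0
    (show Continuous fun s => q (x - s) by fun_prop) 0
  simpa [convolution, sub_zero] using this

theorem mollifier_zero (n : ℕ) {z : ℝ} (hz : 1 ≤ |z|) : (mollifier n).normed volume z = 0 := by
  have : z ∉ Function.support ((mollifier n).normed volume) := by
    rw [ContDiffBump.support_normed_eq]
    simp only [Metric.mem_ball, dist_zero_right, Real.norm_eq_abs, not_lt]
    refine le_trans ?_ hz
    show (1 : ℝ) / (n + 2) ≤ 1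
    rw [div_le_one (by positivity)]
    have : (0 : ℝ) ≤ n := n.cast_nonneg
    linarith
  simpa using this

theorem hat_eq_zero {Δ z : ℝ} (h : Δ ≤ |z|) : hat Δ z = 0 := by
  unfold hat
  rw [max_eq_left (by linarith)]; simp

theorem hat_le {Δ : ℝ} (hΔ : 0 < Δ) (z : ℝ) : hat Δ z ≤ 1 / Δ := by
  unfold hat
  rw [div_le_div_iff₀ (by positivity) hΔ]
  have : max 0 (Δ - |z|) ≤ Δ := max_le hΔ.le (by linarith [abs_nonneg z])
  nlinarith

theorem hatAvg_eq_integral {Δ : ℝ} (hΔ : 0 < Δ) (v : ℝ → ℝ) (x : ℝ) :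
    hatAvg Δ v x = ∫ z, hat Δ z * v (x + z) := by
  unfold hatAvg
  rw [intervalIntegral.integral_of_le (by linarith)]
  refine setIntegral_eq_integral_of_forall_compl_eq_zero fun z hz => ?_
  rw [hat_eq_zero, zero_mul]
  by_contra hcon
  push Not at hcon
  exact hz ⟨(abs_lt.1 hcon).1, (abs_lt.1 hcon).2.le⟩

/-- Mollified hat kernel. -/
def smoothHat (Δ : ℝ) (n : ℕ) (y : ℝ) : ℝ := hatAvg Δ ((mollifier n).normed volume) y

theorem smoothHat_eq (Δ : ℝ) (hΔ : 0 < Δ) (n : ℕ) (y : ℝ) :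
    smoothHat Δ n y = ∫ z, (mollifier n).normed volume z * hat Δ (-y + z) := by
  unfold smoothHat
  rw [hatAvg_eq_integral hΔ, ← integral_add_left_eq_self _ (-y)]
  refine integral_congr_ae (Eventually.of_forall fun z => ?_)
  simp only
  rw [mul_comm]; congr 2; ring

theorem smoothHat_tendsto {Δ : ℝ} (hΔ : 0 < Δ) (y : ℝ) :
    Tendsto (fun n => smoothHat Δ n y) atTop (nhds (hat Δ y)) := by
  have := mollifier_tendsto (continuous_hat Δ) (-y)
  rw [show hat Δ (-y) = hat Δ y by simp [hat]] at this
  exact this.congr fun n => (smoothHat_eq Δ hΔ n y).symm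

theorem smoothHat_nonneg {Δ : ℝ} (hΔ : 0 < Δ) (n : ℕ) (y : ℝ) : 0 ≤ smoothHat Δ n y := by
  rw [smoothHat_eq Δ hΔ]
  exact integral_nonneg fun z => mul_nonneg ((mollifier n).nonneg_normed z) (hat_nonneg _ _)

theorem smoothHat_le {Δ : ℝ} (hΔ : 0 < Δ) (n : ℕ) (y : ℝ) : smoothHat Δ n y ≤ 1 / Δ := by
  rw [smoothHat_eq Δ hΔ]
  have i := (mollifier n).integrable_normed (μ := volume)
  calc ∫ z, (mollifier n).normed volume z * hat Δ (-y + z)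
      ≤ ∫ z, (mollifier n).normed volume z * (1 / Δ) := by
        refine integral_mono_of_nonneg (Eventually.of_forall fun z =>
          mul_nonneg ((mollifier n).nonneg_normed z) (hat_nonneg _ _)) (i.mul_const _)
          (Eventually.of_forall fun z =>
            mul_le_mul_of_nonneg_left (hat_le hΔ _) ((mollifier n).nonneg_normed z))
    _ = 1 / Δ := by rw [integral_mul_const, (mollifier n).integral_normed, one_mul]

theorem smoothHat_zero {Δ : ℝ} (hΔ : 0 < Δ) (n : ℕ) {y : ℝ} (hy : Δ + 1 ≤ |y|) :
    smoothHat Δ n y = 0 := by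
  rw [smoothHat_eq Δ hΔ]
  rw [integral_eq_zero_of_ae (Eventually.of_forall fun z => ?_)]
  rcases le_or_gt 1 |z| with h | h
  · simp [mollifier_zero n h]
  · have : Δ ≤ |-y + z| := by
      have := abs_sub_abs_le_abs_sub y z
      rw [show -y + z = -(y - z) by ring, abs_neg]
      linarith
    simp [hat_eq_zero this]

theorem exists_second_primitive {ρ : ℝ → ℝ} (hρ : ContDiff ℝ (⊤ : ℕ∞) ρ) :
    ∃ R R' : ℝ → ℝ, (∀ x, HasDerivAt R (R' x) x) ∧ (∀ x, HasDerivAt R' (ρ x) x) ∧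
      ContDiff ℝ (⊤ : ℕ∞) R := by
  have h1 : ∀ q : ℝ → ℝ, Continuous q → ∀ x, HasDerivAt (fun y => ∫ s in (0:ℝ)..y, q s) (q x) x :=
    fun q hq x => intervalIntegral.integral_hasDerivAt_right (hq.intervalIntegrable _ _)
      (hq.stronglyMeasurableAtFilter _ _) hq.continuousAt
  have h2 : ∀ q : ℝ → ℝ, ContDiff ℝ (⊤ : ℕ∞) q → ContDiff ℝ (⊤ : ℕ∞) (fun y => ∫ s in (0:ℝ)..y, q s) :=
    fun q hq => by
      refine contDiff_infty_iff_deriv.2 ⟨fun x => (h1 q hq.continuous x).differentiableAt, ?_⟩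
      rwa [show deriv (fun y => ∫ s in (0:ℝ)..y, q s) = q from
        funext fun x => (h1 q hq.continuous x).deriv]
  exact ⟨_, _, h1 _ (h2 ρ hρ).continuous, h1 ρ hρ.continuous, h2 _ (h2 ρ hρ)⟩

theorem smoothHat_contDiff {Δ : ℝ} (hΔ : 0 < Δ) (n : ℕ) :
    ContDiff ℝ (⊤ : ℕ∞) (smoothHat Δ n) ∧ ∀ y, deriv (deriv (smoothHat Δ n)) y =
      ((mollifier n).normed volume (y + Δ) - 2 * (mollifier n).normed volume y
        + (mollifier n).normed volume (y - Δ)) / Δ ^ 2 := by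
  obtain ⟨R, R', d1, d2, hR⟩ := exists_second_primitive
    ((mollifier n).contDiff_normed (μ := volume) (n := (⊤ : ℕ∞)))
  have e : smoothHat Δ n = fun y => (R (y + Δ) - 2 * R y + R (y - Δ)) / Δ ^ 2 :=
    funext fun y => hatAvg_second_deriv hΔ d1 d2 (mollifier n).continuous_normed y
  have g : ∀ {P P' : ℝ → ℝ}, (∀ x, HasDerivAt P (P' x) x) → ∀ y,
      HasDerivAt (fun y => (P (y + Δ) - 2 * P y + P (y - Δ)) / Δ ^ 2)
        ((P' (y + Δ) - 2 * P' y + P' (y - Δ)) / Δ ^ 2) y := fun h y =>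
    ((((h (y + Δ)).comp_add_const y Δ).sub ((h y).const_mul 2)).add
      ((h (y - Δ)).comp_sub_const y Δ)).div_const _
  refine ⟨?_, fun y => ?_⟩
  · rw [e]; fun_prop
  · rw [e, show deriv (fun y => (R (y + Δ) - 2 * R y + R (y - Δ)) / Δ ^ 2) = _ from
      funext fun y => (g d1 y).deriv]
    exact (g d2 y).deriv

theorem continuousOn_integral_kernel {T M : ℝ} {w : ℝ → ℝ → ℝ} {k : ℝ → ℝ}
    (h : ContinuousOn (fun q : ℝ × ℝ => w q.1 q.2) (univ ×ˢ Ioc 0 T))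
    (hM : ∀ x, ∀ t ∈ Ioc 0 T, |w x t| ≤ M) (hk : Integrable k) (x : ℝ) :
    ContinuousOn (fun t => ∫ z, k z * w (x + z) t) (Ioc 0 T) := by
  intro t ht
  refine continuousWithinAt_of_dominated (bound := fun z => |k z| * M) ?_ ?_ ?_ ?_
  · filter_upwards [self_mem_nhdsWithin] with s hs
    exact hk.aestronglyMeasurable.mul ((continuous_slice h hs).comp
      (continuous_const.add continuous_id)).aestronglyMeasurable
  · filter_upwards [self_mem_nhdsWithin] with s hs
    refine Eventually.of_forall fun z => ?_
    rw [Real.norm_eq_abs, abs_mul]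
    exact mul_le_mul_of_nonneg_left (hM _ s hs) (abs_nonneg _)
  · exact hk.abs.mul_const M
  · exact Eventually.of_forall fun z =>
      continuousWithinAt_const.mul (continuousOn_time h (x + z) t ht)

theorem integrable_smoothHat {Δ : ℝ} (hΔ : 0 < Δ) (n : ℕ) : Integrable (smoothHat Δ n) := by
  refine (smoothHat_contDiff hΔ n).1.continuous.integrable_of_hasCompactSupport ?_
  exact HasCompactSupport.of_support_subset_isCompact (isCompact_Icc (a := -(Δ + 1)) (b := Δ + 1))
    fun y hy => by
      by_contra hcon
      refine hy (smoothHat_zero hΔ n ?_)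
      by_contra h2
      push Not at h2
      exact hcon ⟨(abs_lt.1 h2).1.le, (abs_lt.1 h2).2.le⟩

theorem abs_integral_smoothHat_le {Δ M : ℝ} (hΔ : 0 < Δ) (n : ℕ) {q : ℝ → ℝ} (x : ℝ) (hM0 : 0 ≤ M)
    (hq : ∀ y, |q y| ≤ M) : |∫ z, smoothHat Δ n z * q (x + z)| ≤
      ∫ z : ℝ, (Icc (-(Δ + 1)) (Δ + 1)).indicator (fun _ => 1 / Δ * M) z ∂volume := by
  refine norm_integral_le_of_norm_le (f := fun z => smoothHat Δ n z * q (x + z)) ?_ (Eventually.of_forall fun z => ?_)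
  · exact (integrableOn_const (by simp)).integrable_indicator measurableSet_Icc
  · by_cases hz : z ∈ Icc (-(Δ + 1)) (Δ + 1)
    · rw [indicator_of_mem hz, Real.norm_eq_abs, abs_mul, abs_of_nonneg (smoothHat_nonneg hΔ n z)]
      exact mul_le_mul (smoothHat_le hΔ n z) (hq _) (abs_nonneg _) (by positivity)
    · rw [indicator_of_notMem hz, smoothHat_zero hΔ n, zero_mul, norm_zero]
      by_contra h2
      push Not at h2
      exact hz ⟨(abs_lt.1 h2).1.le, (abs_lt.1 h2).2.le⟩

theorem smoothHat_pairing_tendsto {Δ M : ℝ} (hΔ : 0 < Δ) {q : ℝ → ℝ} (x : ℝ) (hM0 : 0 ≤ M)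
    (hqm : AEStronglyMeasurable (fun z => q (x + z)) volume) (hq : ∀ y, |q y| ≤ M) :
    Tendsto (fun n => ∫ z, smoothHat Δ n z * q (x + z)) atTop (nhds (hatAvg Δ q x)) := by
  rw [hatAvg_eq_integral hΔ]
  refine tendsto_integral_of_dominated_convergence
    ((Icc (-(Δ + 1)) (Δ + 1)).indicator (fun _ => 1 / Δ * M)) (fun n => ?_) ?_ (fun n => ?_) ?_
  · exact (smoothHat_contDiff hΔ n).1.continuous.aestronglyMeasurable.mul hqm
  · exact (integrableOn_const (by simp)).integrable_indicator measurableSet_Icc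
  · refine Eventually.of_forall fun z => ?_
    by_cases hz : z ∈ Icc (-(Δ + 1)) (Δ + 1)
    · rw [indicator_of_mem hz, Real.norm_eq_abs, abs_mul, abs_of_nonneg (smoothHat_nonneg hΔ n z)]
      exact mul_le_mul (smoothHat_le hΔ n z) (hq _) (abs_nonneg _) (by positivity)
    · rw [indicator_of_notMem hz, smoothHat_zero hΔ n, zero_mul, norm_zero]
      by_contra h2
      push Not at h2
      exact hz ⟨(abs_lt.1 h2).1.le, (abs_lt.1 h2).2.le⟩
  · exact Eventually.of_forall fun z => (smoothHat_tendsto hΔ z).mul_const _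

theorem abs_integral_mollifier_le {M : ℝ} (n : ℕ) {q : ℝ → ℝ} (x : ℝ) (hq : ∀ y, |q y| ≤ M) :
    |∫ z, (mollifier n).normed volume z * q (x + z)| ≤ M := by
  have i := (mollifier n).integrable_normed (μ := volume)
  calc |∫ z, (mollifier n).normed volume z * q (x + z)|
      ≤ ∫ z, (mollifier n).normed volume z * M :=
        norm_integral_le_of_norm_le (f := fun z => (mollifier n).normed volume z * q (x + z)) (i.mul_const M) (Eventually.of_forall fun z => by
          rw [Real.norm_eq_abs, abs_mul, abs_of_nonneg ((mollifier n).nonneg_normed (μ := volume) z)]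
          exact mul_le_mul_of_nonneg_left (hq (x + z)) ((mollifier n).nonneg_normed z))
    _ = M := by rw [integral_mul_const, (mollifier n).integral_normed, one_mul]

theorem integral_mul_second_deriv_smoothHat {Δ M : ℝ} (hΔ : 0 < Δ) (n : ℕ) {q : ℝ → ℝ}
    (hqc : Continuous q) (hq : ∀ y, |q y| ≤ M) (x : ℝ) :
    ∫ y, q y * deriv (deriv fun y => smoothHat Δ n (y - x)) y =
      ((∫ z, (mollifier n).normed volume z * q (x + Δ + z)) -
        2 * (∫ z, (mollifier n).normed volume z * q (x + z)) +
        ∫ z, (mollifier n).normed volume z * q (x - Δ + z)) / Δ ^ 2 := by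
  set ρ := (mollifier n).normed volume with hρ
  have e1 : ∀ y, deriv (deriv fun y => smoothHat Δ n (y - x)) y =
      (ρ (y - x + Δ) - 2 * ρ (y - x) + ρ (y - x - Δ)) / Δ ^ 2 := fun y => by
    have : deriv (fun y => smoothHat Δ n (y - x)) = fun y => deriv (smoothHat Δ n) (y - x) :=
      funext fun y => deriv_comp_sub_const ..
    rw [this, ← (smoothHat_contDiff hΔ n).2 (y - x)]
    exact deriv_comp_sub_const (f := deriv (smoothHat Δ n)) ..
  have i : ∀ s, Integrable (fun z => ρ z * q (s + z)) := fun s =>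
    ((mollifier n).integrable_normed (μ := volume)).mul_bdd (c := M)
      (hqc.comp (continuous_const.add continuous_id)).aestronglyMeasurable
      (Eventually.of_forall fun z => hq _)
  have sh : ∀ s, (fun y => ρ (y - s) * q y) = fun y => (fun z => ρ z * q (s + z)) (y - s) := fun s =>
    funext fun y => by simp
  have i' : ∀ s, Integrable (fun y => ρ (y - s) * q y) := fun s => by
    rw [sh s]; exact (i s).comp_sub_right s
  have v' : ∀ s, ∫ y, ρ (y - s) * q y = ∫ z, ρ z * q (s + z) := fun s => by
    rw [sh s]; exact integral_sub_right_eq_self (fun z => ρ z * q (s + z)) s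
  have e2 : ∀ y, q y * deriv (deriv fun y => smoothHat Δ n (y - x)) y =
      (ρ (y - (x - Δ)) * q y - 2 * (ρ (y - x) * q y) + ρ (y - (x + Δ)) * q y) / Δ ^ 2 := fun y => by
    rw [e1, show y - x + Δ = y - (x - Δ) by ring, show y - x - Δ = y - (x + Δ) by ring]
    ring
  simp only [e2]
  have i2 : Integrable fun y => ρ (y - (x - Δ)) * q y - 2 * (ρ (y - x) * q y) :=
    (i' _).sub ((i' _).const_mul 2)
  rw [integral_div, integral_add i2 (i' _),
    integral_sub (i' _) ((i' _).const_mul 2), integral_const_mul, v', v', v']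
  ring

theorem hat_identity_of_weak {τ M Δ : ℝ} {w₀ : ℝ → ℝ} {w A g : ℝ → ℝ → ℝ} (hτ : 0 < τ)
    (hΔ : 0 < Δ) (hM0 : 0 ≤ M)
    (cw : ContinuousOn (fun q : ℝ × ℝ => w q.1 q.2) (univ ×ˢ Ioc 0 τ))
    (cA : ContinuousOn (fun q : ℝ × ℝ => A q.1 q.2) (univ ×ˢ Ioc 0 τ))
    (cg : ContinuousOn (fun q : ℝ × ℝ => g q.1 q.2) (univ ×ˢ Ioc 0 τ))
    (bw : ∀ x, ∀ t ∈ Ioc 0 τ, |w x t| ≤ M) (bA : ∀ x, ∀ t ∈ Ioc 0 τ, |A x t| ≤ M)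
    (bg : ∀ x, ∀ t ∈ Ioc 0 τ, |g x t| ≤ M)
    (m0 : Measurable w₀) (b0 : ∀ x, |w₀ x| ≤ M)
    (weak : ∀ ψ : ℝ → ℝ, ContDiff ℝ (⊤ : ℕ∞) ψ → HasCompactSupport ψ →
      ∫ y, w y τ * ψ y = (∫ y, w₀ y * ψ y) + (∫ t in Ioo 0 τ, ∫ y, g y t * ψ y) +
        ∫ t in Ioo 0 τ, ∫ y, A y t * deriv (deriv ψ) y) (x : ℝ) :
    hatAvg Δ (fun y => w y τ) x - hatAvg Δ w₀ x =
      ((∫ t in 0..τ, A (x + Δ) t) - 2 * (∫ t in 0..τ, A x t) + ∫ t in 0..τ, A (x - Δ) t)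
        / Δ ^ 2 + ∫ t in 0..τ, hatAvg Δ (fun y => g y t) x := by
  have hτ' : τ ∈ Ioc 0 τ := ⟨hτ, le_rfl⟩
  have sh : ∀ (q : ℝ → ℝ) n, ∫ y, q y * smoothHat Δ n (y - x) =
      ∫ z, smoothHat Δ n z * q (x + z) := fun q n => by
    rw [← integral_sub_right_eq_self (fun z => smoothHat Δ n z * q (x + z)) x]
    refine integral_congr_ae (Eventually.of_forall fun y => ?_)
    simp only [add_sub_cancel]; ring
  have mk : ∀ n s, ContinuousOn (fun t => ∫ z, (mollifier n).normed volume z * A (s + z) t)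
      (Ioc 0 τ) := fun n s =>
    continuousOn_integral_kernel cA bA ((mollifier n).integrable_normed (μ := volume)) s
  have mi : ∀ n s, IntervalIntegrable
      (fun t => ∫ z, (mollifier n).normed volume z * A (s + z) t) volume 0 τ := fun n s =>
    intervalIntegrable_time (mk n s) (fun t ht => abs_integral_mollifier_le n s fun y => bA y t ht)
      le_rfl hτ.le le_rfl
  have id : ∀ n, (∫ z, smoothHat Δ n z * w (x + z) τ) = (∫ z, smoothHat Δ n z * w₀ (x + z)) +
      (∫ t in 0..τ, ∫ z, smoothHat Δ n z * g (x + z) t) +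
      ((∫ t in 0..τ, ∫ z, (mollifier n).normed volume z * A (x + Δ + z) t) -
        2 * (∫ t in 0..τ, ∫ z, (mollifier n).normed volume z * A (x + z) t) +
        ∫ t in 0..τ, ∫ z, (mollifier n).normed volume z * A (x - Δ + z) t) / Δ ^ 2 := by
    intro n
    have cs : HasCompactSupport fun y => smoothHat Δ n (y - x) :=
      HasCompactSupport.of_support_subset_isCompact
        (isCompact_Icc (a := x - (Δ + 1)) (b := x + (Δ + 1))) fun y hy => by
          by_contra hcon
          refine hy (smoothHat_zero hΔ n ?_)
          by_contra h2
          push Not at h2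
          have := abs_lt.1 h2
          exact hcon ⟨by linarith, by linarith⟩
    have := weak (fun y => smoothHat Δ n (y - x))
      ((smoothHat_contDiff hΔ n).1.comp (contDiff_id.sub contDiff_const)) cs
    rw [sh, sh] at this
    simp only [sh] at this
    rw [this, ← integral_Ioc_eq_integral_Ioo, ← integral_Ioc_eq_integral_Ioo,
      intervalIntegral.integral_of_le hτ.le]
    congr 1
    rw [← intervalIntegral.integral_const_mul, ← intervalIntegral.integral_sub (mi _ _)
      ((mi _ _).const_mul 2), ← intervalIntegral.integral_add ((mi _ _).sub ((mi _ _).const_mul 2))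
      (mi _ _), ← intervalIntegral.integral_div, intervalIntegral.integral_of_le hτ.le]
    exact setIntegral_congr_fun measurableSet_Ioc fun t ht =>
      integral_mul_second_deriv_smoothHat hΔ n (continuous_slice cA ht) (fun y => bA y t ht) x
  have lA : ∀ s, Tendsto (fun n => ∫ t in 0..τ, ∫ z, (mollifier n).normed volume z * A (s + z) t)
      atTop (nhds (∫ t in 0..τ, A s t)) := fun s => by
    refine intervalIntegral.tendsto_integral_filter_of_dominated_convergence (fun _ => M)
      (Eventually.of_forall fun n => ?_) (Eventually.of_forall fun n => ?_) (by simp) ?_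
    · rw [uIoc_of_le hτ.le]
      exact (mk n s).aestronglyMeasurable measurableSet_Ioc
    · refine Eventually.of_forall fun t ht => ?_
      rw [uIoc_of_le hτ.le] at ht
      exact abs_integral_mollifier_le n s fun y => bA y t ht
    · refine Eventually.of_forall fun t ht => ?_
      rw [uIoc_of_le hτ.le] at ht
      exact mollifier_tendsto (continuous_slice cA ht) s
  have lg : Tendsto (fun n => ∫ t in 0..τ, ∫ z, smoothHat Δ n z * g (x + z) t)
      atTop (nhds (∫ t in 0..τ, hatAvg Δ (fun y => g y t) x)) := by
    refine intervalIntegral.tendsto_integral_filter_of_dominated_convergence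
      (fun _ => ∫ z : ℝ, (Icc (-(Δ + 1)) (Δ + 1)).indicator (fun _ => 1 / Δ * M) z ∂volume)
      (Eventually.of_forall fun n => ?_) (Eventually.of_forall fun n => ?_) (by simp) ?_
    · rw [uIoc_of_le hτ.le]
      exact (continuousOn_integral_kernel cg bg (integrable_smoothHat hΔ n) x).aestronglyMeasurable
        measurableSet_Ioc
    · refine Eventually.of_forall fun t ht => ?_
      rw [uIoc_of_le hτ.le] at ht
      exact abs_integral_smoothHat_le hΔ n (q := fun y => g y t) x hM0 fun y => bg y t ht
    · refine Eventually.of_forall fun t ht => ?_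
      rw [uIoc_of_le hτ.le] at ht
      exact smoothHat_pairing_tendsto hΔ (q := fun y => g y t) x hM0
        ((continuous_slice cg ht).comp (continuous_const.add continuous_id)).aestronglyMeasurable
        fun y => bg y t ht
  have l1 := smoothHat_pairing_tendsto hΔ (q := fun y => w y τ) x hM0
        ((continuous_slice cw hτ').comp (continuous_const.add continuous_id)).aestronglyMeasurable
        fun y => bw y τ hτ'
  have l2 := smoothHat_pairing_tendsto hΔ (q := w₀) x hM0
        (m0.comp (measurable_const_add x)).aestronglyMeasurable b0
  have l3 := (l2.add lg).add ((((lA (x + Δ)).sub ((lA x).const_mul 2)).add (lA (x - Δ))).div_const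
    (Δ ^ 2))
  have := tendsto_nhds_unique (l1.congr id) l3
  rw [this]; ring

theorem VeryWeakSol.weak {m τ : ℝ} {f : ℝ → ℝ → ℝ} {κ u₀ : ℝ → ℝ} {u : ℝ → ℝ → ℝ}
    (h : VeryWeakSol m f κ τ u₀ u) (hτ : 0 < τ) {ψ : ℝ → ℝ} (hψ : ContDiff ℝ (⊤ : ℕ∞) ψ)
    (hs : HasCompactSupport ψ) :
    ∫ y, u y τ * ψ y = (∫ y, u₀ y * ψ y) +
      (∫ t in Ioo 0 τ, ∫ y, f y (u y t) * (κ y - u y t) * ψ y) +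
      ∫ t in Ioo 0 τ, ∫ y, u y t ^ m * deriv (deriv ψ) y := by
  let χ : ContDiffBump (0 : ℝ) := ⟨τ + 1, τ + 2, by linarith, by linarith⟩
  have hχ : ∀ t, |t| ≤ τ + 1 → χ t = 1 := fun t ht =>
    χ.one_of_mem_closedBall (by simpa [Metric.mem_closedBall] using ht)
  have hχd : ∀ t ∈ Ioo 0 τ, ∀ x, deriv (fun s => ψ x * χ s) t = 0 := by
    intro t ht x
    have : (fun s => ψ x * χ s) =ᶠ[nhds t] fun _ => ψ x := by
      filter_upwards [Ioo_mem_nhds ht.1 ht.2] with s hs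
      rw [hχ s (by rw [abs_of_pos hs.1]; linarith [hs.2]), mul_one]
    rw [this.deriv_eq]; simp
  have := h.2.2 (fun x t => ψ x * χ t) ?_ ?_
  · rw [hχ τ (by rw [abs_of_pos hτ]; linarith), hχ 0 (by simp; linarith)] at this
    simp only [mul_one] at this
    rw [this]
    congr 1
    · congr 1
      refine setIntegral_congr_fun measurableSet_Ioo fun t ht => ?_
      simp only [hχ t (by rw [abs_of_pos ht.1]; linarith [ht.2]), mul_one]
    · refine setIntegral_congr_fun measurableSet_Ioo fun t ht => ?_
      simp only [hχ t (by rw [abs_of_pos ht.1]; linarith [ht.2]), mul_one, hχd t ht, mul_zero,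
        zero_add]
  · exact (hψ.comp contDiff_fst).mul ((χ.contDiff (n := (⊤ : ℕ∞))).comp contDiff_snd)
  · refine HasCompactSupport.intro (hs.isCompact.prod χ.hasCompactSupport.isCompact) fun q hq => ?_
    simp only [Function.uncurry]
    by_contra hne
    exact hq ⟨subset_tsupport _ (left_ne_zero_of_mul hne), subset_tsupport _ (right_ne_zero_of_mul hne)⟩

/-- Reaction terms which are uniformly Lipschitz and bounded on `[0, M]`. -/
structure Reaction (M Q L : ℝ) (q : ℝ → ℝ → ℝ) : Prop where
  cont : Continuous (Function.uncurry q)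
  bdd : ∀ x, ∀ v ∈ Icc 0 M, |q x v| ≤ Q
  lip : ∀ x, ∀ v ∈ Icc 0 M, ∀ y ∈ Icc 0 M, |q x v - q x y| ≤ L * |v - y|

/-- Bounded nonnegative solutions of `U_t = (U^m)_xx + q(x,U)` in hat-averaged form. -/
structure HatSol (T M m : ℝ) (q : ℝ → ℝ → ℝ) (U : ℝ → ℝ → ℝ) : Prop where
  cont : ContinuousOn (fun p : ℝ × ℝ => U p.1 p.2) (univ ×ˢ Ioc 0 T)
  mem : ∀ x, ∀ t ∈ Icc 0 T, U x t ∈ Icc 0 M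
  meas : Measurable fun x => U x 0
  hat_eq : ∀ x Δ t₁ t₂, 0 < Δ → 0 ≤ t₁ → t₁ ≤ t₂ → t₂ ≤ T →
    hatAvg Δ (fun y => U y t₂) x - hatAvg Δ (fun y => U y t₁) x =
      ((∫ t in t₁..t₂, U (x + Δ) t ^ m) - 2 * (∫ t in t₁..t₂, U x t ^ m) +
        ∫ t in t₁..t₂, U (x - Δ) t ^ m) / Δ ^ 2 +
      ∫ t in t₁..t₂, hatAvg Δ (fun y => q y (U y t)) x

/-- The solution extended by its initial datum. -/
def withInitial (u₀ : ℝ → ℝ) (u : ℝ → ℝ → ℝ) (x t : ℝ) : ℝ := if t ≤ 0 then u₀ x else u x t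

theorem continuousOn_rpow_comp {T m : ℝ} (hm : 0 ≤ m) {U : ℝ → ℝ → ℝ}
    (h : ContinuousOn (fun p : ℝ × ℝ => U p.1 p.2) (univ ×ˢ Ioc 0 T)) :
    ContinuousOn (fun p : ℝ × ℝ => U p.1 p.2 ^ m) (univ ×ˢ Ioc 0 T) :=
  (Real.continuous_rpow_const hm).comp_continuousOn h

theorem continuousOn_reaction_comp {T : ℝ} {U q : ℝ → ℝ → ℝ} (hq : Continuous (Function.uncurry q))
    (h : ContinuousOn (fun p : ℝ × ℝ => U p.1 p.2) (univ ×ˢ Ioc 0 T)) :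
    ContinuousOn (fun p : ℝ × ℝ => q p.1 (U p.1 p.2)) (univ ×ˢ Ioc 0 T) :=
  hq.comp_continuousOn (f := fun p : ℝ × ℝ => (p.1, U p.1 p.2)) (continuousOn_fst.prodMk h)

theorem abs_rpow_le_of_mem {m M v : ℝ} (hm : 0 ≤ m) (h : v ∈ Icc 0 M) : |v ^ m| ≤ M ^ m := by
  rw [abs_of_nonneg (Real.rpow_nonneg h.1 m)]
  exact Real.rpow_le_rpow h.1 h.2 hm

theorem hatSol_withInitial {T M Q L m : ℝ} {f : ℝ → ℝ → ℝ} {κ u₀ : ℝ → ℝ} {u : ℝ → ℝ → ℝ}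
    (hT : 0 < T) (hm : 0 < m)
    (hq : Reaction M Q L fun x v => f x v * (κ x - v)) (hu : GlobalVeryWeakSol m f κ u₀ u)
    (m0 : Measurable u₀) (b0 : ∀ x, u₀ x ∈ Icc 0 M) (bu : ∀ x, ∀ t ∈ Ioc 0 T, u x t ∈ Icc 0 M) :
    HatSol T M m (fun x v => f x v * (κ x - v)) (withInitial u₀ u) := by
  have pos : ∀ t, 0 < t → ∀ x, withInitial u₀ u x t = u x t := fun t ht x => by
    simp [withInitial, ht]
  have z : ∀ x, withInitial u₀ u x 0 = u₀ x := fun x => by simp [withInitial]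
  have hM : 0 ≤ M := (b0 0).1.trans (b0 0).2
  have hQ : 0 ≤ Q := (abs_nonneg _).trans (hq.bdd 0 0 ⟨le_rfl, hM⟩)
  have cu : ContinuousOn (fun q : ℝ × ℝ => u q.1 q.2) (univ ×ˢ Ioc 0 T) := (hu T hT).1
  have cA := continuousOn_rpow_comp hm.le cu
  have cq := continuousOn_reaction_comp hq.cont cu
  have bA : ∀ x, ∀ t ∈ Ioc 0 T, |u x t ^ m| ≤ M ^ m := fun x t ht =>
    abs_rpow_le_of_mem hm.le (bu x t ht)
  have bq : ∀ x, ∀ t ∈ Ioc 0 T, |f x (u x t) * (κ x - u x t)| ≤ Q := fun x t ht =>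
    hq.bdd x _ (bu x t ht)
  refine ⟨cu.congr fun p hp => pos _ hp.2.1 _, fun x t ht => ?_, by simpa only [z] using m0, ?_⟩
  · rcases ht.1.eq_or_lt with h | h
    · rw [← h, z]; exact b0 x
    · rw [pos t h]; exact bu x t ⟨h, ht.2⟩
  · have base : ∀ x Δ τ, 0 < Δ → 0 ≤ τ → τ ≤ T →
        hatAvg Δ (fun y => withInitial u₀ u y τ) x - hatAvg Δ u₀ x =
        ((∫ t in 0..τ, u (x + Δ) t ^ m) - 2 * (∫ t in 0..τ, u x t ^ m) +
          ∫ t in 0..τ, u (x - Δ) t ^ m) / Δ ^ 2 +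
        ∫ t in 0..τ, hatAvg Δ (fun y => f y (u y t) * (κ y - u y t)) x := by
      intro x Δ τ hΔ h0 hτ
      rcases h0.eq_or_lt with h | h
      · simp [← h, z]
      · simp only [pos τ h]
        have sub : (univ : Set ℝ) ×ˢ Ioc 0 τ ⊆ univ ×ˢ Ioc 0 T :=
          prod_mono_right (Ioc_subset_Ioc_right hτ)
        have mem : ∀ t ∈ Ioc 0 τ, t ∈ Ioc 0 T := fun t ht => Ioc_subset_Ioc_right hτ ht
        refine hat_identity_of_weak (M := M + M ^ m + Q) (w := u) (A := fun x t => u x t ^ m)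
          (g := fun x t => f x (u x t) * (κ x - u x t)) h hΔ (by positivity) (cu.mono sub)
          (cA.mono sub) (cq.mono sub) ?_ ?_ ?_ m0 ?_ ?_ x
        · intro x t ht
          have := bu x t (mem t ht)
          rw [abs_of_nonneg this.1]
          have : 0 ≤ M ^ m := by positivity
          linarith [(bu x t (mem t ht)).2]
        · intro x t ht
          linarith [bA x t (mem t ht)]
        · intro x t ht
          have : 0 ≤ M ^ m := by positivity
          linarith [bq x t (mem t ht)]
        · intro x
          rw [abs_of_nonneg (b0 x).1]
          have : 0 ≤ M ^ m := by positivity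
          linarith [(b0 x).2]
        · intro ψ hψ hs
          exact (hu τ h).weak h hψ hs
    intro x Δ t₁ t₂ hΔ h1 h12 h2
    have b1 := base x Δ t₁ hΔ h1 (h12.trans h2)
    have b2 := base x Δ t₂ hΔ (h1.trans h12) h2
    have iA : ∀ y t, 0 ≤ t → t ≤ T → IntervalIntegrable (fun t => u y t ^ m) volume 0 t :=
      fun y t h0 ht => intervalIntegrable_time (continuousOn_time (w := fun x t => u x t ^ m) cA y) (bA y) le_rfl h0 ht
    have iq : ∀ t, 0 ≤ t → t ≤ T → IntervalIntegrable
        (fun t => hatAvg Δ (fun y => f y (u y t) * (κ y - u y t)) x) volume 0 t :=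
      fun t h0 ht => by
        refine intervalIntegrable_time (M := Q + 1)
          (continuousOn_hatAvg hΔ (w := fun y t => f y (u y t) * (κ y - u y t)) cq bq x)
          (fun s hs => ?_) le_rfl h0 ht
        have := abs_hatAvg_sub_le hΔ (C := 0) (μ := Q) (x := x)
          (v := fun y => f y (u y s) * (κ y - u y s))
          ((continuous_slice (w := fun y t => f y (u y t) * (κ y - u y t)) cq
            hs).intervalIntegrable _ _) (fun z _ => by simpa using bq (x + z) s hs)
        rw [sub_zero] at this
        linarith
    have cong : ∀ {F G : ℝ → ℝ}, (∀ t, 0 < t → F t = G t) → ∫ t in t₁..t₂, F t = ∫ t in t₁..t₂, G t :=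
      fun h => by
        rw [intervalIntegral.integral_of_le h12, intervalIntegral.integral_of_le h12]
        exact setIntegral_congr_fun measurableSet_Ioc fun t ht => h t (h1.trans_lt ht.1)
    have sA : ∀ y, ∫ t in t₁..t₂, withInitial u₀ u y t ^ m =
        (∫ t in 0..t₂, u y t ^ m) - ∫ t in 0..t₁, u y t ^ m := fun y => by
      rw [intervalIntegral.integral_interval_sub_left (iA y t₂ (h1.trans h12) h2)
        (iA y t₁ h1 (h12.trans h2))]
      exact cong fun t ht => by rw [pos t ht]
    have sq : ∫ t in t₁..t₂, hatAvg Δ (fun y => f y (withInitial u₀ u y t) *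
          (κ y - withInitial u₀ u y t)) x =
        (∫ t in 0..t₂, hatAvg Δ (fun y => f y (u y t) * (κ y - u y t)) x) -
          ∫ t in 0..t₁, hatAvg Δ (fun y => f y (u y t) * (κ y - u y t)) x := by
      rw [intervalIntegral.integral_interval_sub_left (iq t₂ (h1.trans h12) h2)
        (iq t₁ h1 (h12.trans h2))]
      exact cong fun t ht => by simp only [pos t ht]
    rw [sA, sA, sA, sq]
    linear_combination b2 - b1

theorem HatSol.shift {T M m s : ℝ} {q U : ℝ → ℝ → ℝ} (h : HatSol (T + s) M m q U) (hT : 0 < T)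
    (hs : 0 < s) (hq : ∀ x v, q (x + 1) v = q x v) :
    HatSol T M m q fun x t => U (x + 1) (t + s) where
  cont := h.cont.comp (f := fun p : ℝ × ℝ => (p.1 + 1, p.2 + s)) (by fun_prop)
    fun p hp => ⟨mem_univ _, by have := hp.2.1; dsimp; linarith, by have := hp.2.2; dsimp; linarith⟩
  mem x t ht := h.mem _ _ ⟨by linarith [ht.1], by linarith [ht.2]⟩
  meas := by
    have : Continuous fun x => U x (0 + s) := continuous_slice h.cont ⟨by linarith, by linarith⟩
    exact (this.comp (continuous_id.add continuous_const)).measurable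
  hat_eq x Δ t₁ t₂ hΔ h1 h12 h2 := by
    have e : ∀ (F : ℝ → ℝ), hatAvg Δ (fun y => F (y + 1)) x = hatAvg Δ F (x + 1) := fun F => by
      unfold hatAvg
      congr 1; funext z
      show hat Δ z * F (x + z + 1) = hat Δ z * F (x + 1 + z)
      rw [show x + z + 1 = x + 1 + z by ring]
    have e2 : ∀ t, hatAvg Δ (fun y => q y (U (y + 1) (t + s))) x =
        hatAvg Δ (fun y => q y (U y (t + s))) (x + 1) := fun t => by
      rw [← e]; simp only [hq]
    rw [e (fun y => U y (t₂ + s)), e (fun y => U y (t₁ + s)),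
      h.hat_eq (x + 1) Δ _ _ hΔ (by linarith) (by linarith) (by linarith)]
    simp only [e2]
    have sh : ∀ F : ℝ → ℝ, ∫ t in t₁..t₂, F (t + s) = ∫ t in (t₁ + s)..(t₂ + s), F t := fun F =>
      intervalIntegral.integral_comp_add_right F s
    rw [sh (fun t => U (x + Δ + 1) t ^ m), sh (fun t => U (x + 1) t ^ m),
      sh (fun t => U (x - Δ + 1) t ^ m), sh (fun t => hatAvg Δ (fun y => q y (U y t)) (x + 1))]
    rw [show x + 1 + Δ = x + Δ + 1 by ring, show x + 1 - Δ = x - Δ + 1 by ring]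

theorem HatSol.mono {T T' M m : ℝ} {q U : ℝ → ℝ → ℝ} (h : HatSol T M m q U) (hT : T' ≤ T) :
    HatSol T' M m q U where
  cont := h.cont.mono (prod_mono_right (Ioc_subset_Ioc_right hT))
  mem x t ht := h.mem x t ⟨ht.1, ht.2.trans hT⟩
  meas := h.meas
  hat_eq x Δ t₁ t₂ hΔ h1 h12 h2 := h.hat_eq x Δ t₁ t₂ hΔ h1 h12 (h2.trans hT)

theorem hatSol_stationary {T M m : ℝ} {q : ℝ → ℝ → ℝ} {p : ℝ → ℝ} (hp : ContDiff ℝ 2 p)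
    (pos : ∀ x, 0 < p x) (hM : ∀ x, p x ≤ M) (hq : Continuous (Function.uncurry q))
    (eq : ∀ x, deriv (deriv fun y => p y ^ m) x + q x (p x) = 0) :
    HatSol T M m q fun x _ => p x where
  cont := (hp.continuous.comp continuous_fst).continuousOn
  mem x t _ := ⟨(pos x).le, hM x⟩
  meas := hp.continuous.measurable
  hat_eq x Δ t₁ t₂ hΔ _ _ _ := by
    have hF : ContDiff ℝ 2 fun y => p y ^ m :=
      hp.rpow_const_of_ne fun x => (pos x).ne'
    have hF' : ContDiff ℝ 1 (deriv fun y => p y ^ m) := by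
      exact ((contDiff_succ_iff_deriv (n := 1)).1 hF).2.2
    have hc : Continuous fun y => q y (p y) := hq.comp (continuous_id.prodMk hp.continuous)
    have := hatAvg_second_deriv hΔ (F := fun y => p y ^ m) (F' := deriv fun y => p y ^ m)
      (F'' := fun y => -q y (p y))
      (fun x => (hF.differentiable (by norm_num) x).hasDerivAt)
      (fun x => by
        have := (hF'.differentiable (by norm_num) x).hasDerivAt
        rwa [show deriv (deriv fun y => p y ^ m) x = -q x (p x) by linarith [eq x]] at this)
      hc.neg x
    have e : hatAvg Δ (fun y => -q y (p y)) x = -hatAvg Δ (fun y => q y (p y)) x := by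
      unfold hatAvg
      rw [← intervalIntegral.integral_neg]
      congr 1; funext z; ring
    rw [e] at this
    simp only [intervalIntegral.integral_const, smul_eq_mul, sub_self]
    have e3 : ((t₂ - t₁) * p (x + Δ) ^ m - 2 * ((t₂ - t₁) * p x ^ m) + (t₂ - t₁) * p (x - Δ) ^ m) /
      Δ ^ 2 = (t₂ - t₁) * ((p (x + Δ) ^ m - 2 * p x ^ m + p (x - Δ) ^ m) / Δ ^ 2) := by ring
    rw [e3, ← this]; ring

/-- Divided difference of the power `v ↦ v ^ m`. -/
def powSlope (m v v' : ℝ) : ℝ := if v = v' then m * v ^ (m - 1) else (v ^ m - v' ^ m) / (v - v')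

theorem powSlope_mul (m v v' : ℝ) : powSlope m v v' * (v - v') = v ^ m - v' ^ m := by
  unfold powSlope
  split_ifs with h
  · simp [h]
  · exact div_mul_cancel₀ _ (sub_ne_zero.2 h)

theorem powSlope_comm (m v v' : ℝ) : powSlope m v v' = powSlope m v' v := by
  unfold powSlope
  by_cases h : v = v'
  · simp [h]
  · rw [if_neg h, if_neg (Ne.symm h), ← neg_sub (v' ^ m), ← neg_sub v', neg_div_neg_eq]

theorem powSlope_bounds {m v v' : ℝ} (hm : 1 < m) (h0 : 0 ≤ v') (h : v' ≤ v) :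
    m * v' ^ (m - 1) ≤ powSlope m v v' ∧ powSlope m v v' ≤ m * v ^ (m - 1) ∧
      v ^ (m - 1) ≤ powSlope m v v' := by
  rcases h.eq_or_lt with rfl | h
  · unfold powSlope
    rw [if_pos rfl]
    have : 0 ≤ v' ^ (m - 1) := Real.rpow_nonneg h0 _
    exact ⟨le_rfl, le_rfl, by nlinarith⟩
  · unfold powSlope
    rw [if_neg h.ne']
    have hv : 0 < v := h0.trans_lt h
    have hd : 0 < v - v' := by linarith
    have hder : ∀ x ∈ Ioo v' v, HasDerivAt (fun x : ℝ => x ^ m) (m * x ^ (m - 1)) x := fun x hx =>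
      Real.hasDerivAt_rpow_const (Or.inl (h0.trans_lt hx.1).ne')
    obtain ⟨ξ, hξ, e⟩ := exists_hasDerivAt_eq_slope (fun x : ℝ => x ^ m) (fun x => m * x ^ (m - 1)) h
      ((Real.continuous_rpow_const (by linarith)).continuousOn) hder
    rw [← e]
    have hξ0 := h0.trans hξ.1.le
    refine ⟨?_, ?_, ?_⟩
    · have := Real.rpow_le_rpow h0 hξ.1.le (by linarith : 0 ≤ m - 1)
      nlinarith
    · have := Real.rpow_le_rpow hξ0 hξ.2.le (by linarith : 0 ≤ m - 1)
      nlinarith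
    · rw [e, le_div_iff₀ hd]
      have e1 : v ^ m = v ^ (m - 1) * v := by
        rw [← Real.rpow_add_one hv.ne']; congr 1; ring
      have e2 : v' ^ m ≤ v ^ (m - 1) * v' := by
        rcases h0.eq_or_lt with h00 | h00
        · rw [← h00, Real.zero_rpow (by linarith)]; simp
        · rw [show v' ^ m = v' ^ (m - 1) * v' by rw [← Real.rpow_add_one h00.ne']; congr 1; ring]
          have := Real.rpow_le_rpow h0 h.le (by linarith : 0 ≤ m - 1)
          gcongr
      nlinarith

theorem powSlope_ge_min {m v v' : ℝ} (hm : 1 < m) (h : 0 ≤ v) (h' : 0 ≤ v') :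
    m * min v v' ^ (m - 1) ≤ powSlope m v v' := by
  rcases le_total v' v with hle | hle
  · rw [min_eq_right hle]; exact (powSlope_bounds hm h' hle).1
  · rw [min_eq_left hle, powSlope_comm]; exact (powSlope_bounds hm h hle).1

theorem powSlope_le_max {m v v' : ℝ} (hm : 1 < m) (h : 0 ≤ v) (h' : 0 ≤ v') :
    powSlope m v v' ≤ m * max v v' ^ (m - 1) := by
  rcases le_total v' v with hle | hle
  · rw [max_eq_left hle]; exact (powSlope_bounds hm h' hle).2.1
  · rw [max_eq_right hle, powSlope_comm]; exact (powSlope_bounds hm h hle).2.1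

theorem powSlope_ge_max {m v v' : ℝ} (hm : 1 < m) (h : 0 ≤ v) (h' : 0 ≤ v') :
    max v v' ^ (m - 1) ≤ powSlope m v v' := by
  rcases le_total v' v with hle | hle
  · rw [max_eq_left hle]; exact (powSlope_bounds hm h' hle).2.2
  · rw [max_eq_right hle, powSlope_comm]; exact (powSlope_bounds hm h hle).2.2

theorem powSlope_nonneg {m v w : ℝ} (hm : 1 < m) (h : 0 ≤ v) (hw : 0 ≤ w) :
    0 ≤ powSlope m v w :=
  (Real.rpow_nonneg (h.trans (le_max_left v w)) _).trans (powSlope_ge_max hm h hw)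

/-- Diffusion coefficient of the linearised equation for `U - V`. -/
def linDiff (m T : ℝ) (U V : ℝ → ℝ → ℝ) (x t : ℝ) : ℝ :=
  if t ∈ Ioc 0 T then powSlope m (U x t) (V x t) else 0

/-- Zeroth order coefficient of the linearised equation for `U - V`. -/
def linPot (T : ℝ) (q U V : ℝ → ℝ → ℝ) (x t : ℝ) : ℝ :=
  if t ∈ Ioc 0 T then (q x (U x t) - q x (V x t)) / (U x t - V x t) else 0

theorem HatSol.linSol {T M m Q L : ℝ} {q U V : ℝ → ℝ → ℝ} (hT : 0 < T) (hm : 1 < m) (hL : 0 ≤ L)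
    (hq : Reaction M Q L q) (hU : HatSol T M m q U) (hV : HatSol T M m q V) :
    LinSol T (2 * (M + M ^ m + Q)) (max 1 (m * M ^ (m - 1))) L (fun x t => U x t - V x t)
      (fun x t => U x t ^ m - V x t ^ m) (fun x t => q x (U x t) - q x (V x t)) (linDiff m T U V)
      (linPot T q U V) := by
  have hm0 : 0 ≤ m := by linarith
  have hMm := hU.mem 0 0 ⟨le_rfl, hT.le⟩
  have hM : 0 ≤ M := hMm.1.trans hMm.2
  have hMp : 0 ≤ M ^ m := by positivity
  have hQ : 0 ≤ Q := (abs_nonneg _).trans (hq.bdd 0 0 ⟨le_rfl, hM⟩)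
  have sub : ∀ t ∈ Ioc 0 T, t ∈ Icc 0 T := fun t ht => ⟨ht.1.le, ht.2⟩
  have cA := fun {W} (h : HatSol T M m q W) => continuousOn_rpow_comp hm0 h.cont
  have cq := fun {W} (h : HatSol T M m q W) => continuousOn_reaction_comp hq.cont h.cont
  have bA : ∀ {W}, HatSol T M m q W → ∀ x, ∀ t ∈ Ioc 0 T, |W x t ^ m| ≤ M ^ m := fun h x t ht =>
    abs_rpow_le_of_mem hm0 (h.mem x t (sub t ht))
  have bq : ∀ {W}, HatSol T M m q W → ∀ x, ∀ t ∈ Ioc 0 T, |q x (W x t)| ≤ Q := fun h x t ht =>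
    hq.bdd x _ (h.mem x t (sub t ht))
  have i0 : ∀ {W}, HatSol T M m q W → ∀ t ∈ Icc 0 T, ∀ x y,
      IntervalIntegrable (fun x => W x t) volume x y := fun {W} h t ht x y => by
    rcases ht.1.eq_or_lt with h0 | h0
    · refine (intervalIntegrable_const (c := M)).mono_fun ?_ ?_
      · rw [← h0]; exact h.meas.aestronglyMeasurable
      · refine Eventually.of_forall fun x => ?_
        have := h.mem x t ht
        show ‖W x t‖ ≤ ‖M‖
        rw [Real.norm_eq_abs, Real.norm_eq_abs, abs_of_nonneg this.1, abs_of_nonneg hM]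
        exact this.2
    · exact (continuous_slice h.cont ⟨h0, ht.2⟩).intervalIntegrable _ _
  have hav : ∀ {Δ : ℝ} {F G : ℝ → ℝ} (x : ℝ), (∀ x y, IntervalIntegrable F volume x y) →
      (∀ x y, IntervalIntegrable G volume x y) →
      hatAvg Δ (fun y => F y - G y) x = hatAvg Δ F x - hatAvg Δ G x := fun {Δ F G} x hF hG => by
    have j : ∀ {F : ℝ → ℝ}, (∀ x y, IntervalIntegrable F volume x y) →
        IntervalIntegrable (fun z => hat Δ z * F (x + z)) volume (-Δ) Δ := fun {F} hF => by
      have := (hF (x + -Δ) (x + Δ)).comp_add_left x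
      exact (by simpa using this : IntervalIntegrable (fun z => F (x + z)) volume (-Δ) Δ).continuousOn_mul
        (continuous_hat Δ).continuousOn
    unfold hatAvg
    rw [← intervalIntegral.integral_sub (j hF) (j hG)]
    congr 1; funext z; ring
  refine ⟨hT, le_max_left _ _, hL, hU.cont.sub hV.cont, (cA hU).sub (cA hV), (cq hU).sub (cq hV),
    fun x t ht => ?_, fun x t ht => ?_, fun x t ht => ?_, fun x y => ?_, fun x t ht => ?_,
    fun x t => ?_, fun x t => ?_, fun x t ht => ?_, fun x t => ?_, fun ε hε => ?_, ?_⟩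
  · have h1 := hU.mem x t ht
    have h2 := hV.mem x t ht
    rw [abs_le]; constructor <;> linarith [h1.1, h1.2, h2.1, h2.2]
  · have := abs_sub (U x t ^ m) (V x t ^ m)
    linarith [bA hU x t ht, bA hV x t ht]
  · have := abs_sub (q x (U x t)) (q x (V x t))
    linarith [bq hU x t ht, bq hV x t ht]
  · exact (i0 hU 0 ⟨le_rfl, hT.le⟩ x y).sub (i0 hV 0 ⟨le_rfl, hT.le⟩ x y)
  · simp only [linDiff, if_pos ht, powSlope_mul]
  · unfold linDiff
    split_ifs with ht
    · exact powSlope_nonneg hm (hU.mem x t (sub t ht)).1 (hV.mem x t (sub t ht)).1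
    · exact le_rfl
  · unfold linDiff
    split_ifs with ht
    · have h1 := hU.mem x t (sub t ht)
      have h2 := hV.mem x t (sub t ht)
      refine (powSlope_le_max hm h1.1 h2.1).trans (le_trans ?_ (le_max_right _ _))
      gcongr
      · exact h1.1.trans (le_max_left _ _)
      · exact max_le h1.2 h2.2
    · positivity
  · simp only [linPot, if_pos ht]
    by_cases h : U x t - V x t = 0
    · rw [h, mul_zero, sub_eq_zero.1 h, sub_self]
    · rw [div_mul_cancel₀ _ h]
  · unfold linPot
    split_ifs with ht
    · by_cases h : U x t - V x t = 0
      · rw [h]; simpa using hL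
      · rw [abs_div, div_le_iff₀ (abs_pos.2 h)]
        exact hq.lip x _ (hU.mem x t (sub t ht)) _ (hV.mem x t (sub t ht))
    · simpa using hL
  · refine ⟨ε ^ (m - 1), by positivity, fun x t ht hlt => ?_⟩
    rw [linDiff, if_pos ht] at hlt
    have h1 := (hU.mem x t (sub t ht)).1
    have h2 := (hV.mem x t (sub t ht)).1
    by_contra hcon
    push Not at hcon
    have h3 : ε < max (U x t) (V x t) := by
      rcases lt_abs.1 hcon with h | h
      · exact lt_max_of_lt_left (by linarith)
      · exact lt_max_of_lt_right (by linarith)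
    have := Real.rpow_le_rpow hε.le h3.le (by linarith : 0 ≤ m - 1)
    linarith [powSlope_ge_max hm h1 h2]
  · intro x Δ t₁ t₂ hΔ h1 h12 h2
    have e1 := hU.hat_eq x Δ t₁ t₂ hΔ h1 h12 h2
    have e2 := hV.hat_eq x Δ t₁ t₂ hΔ h1 h12 h2
    have iA : ∀ {W}, HatSol T M m q W → ∀ y, IntervalIntegrable (fun t => W y t ^ m) volume t₁ t₂ :=
      fun {W} h y => intervalIntegrable_time (continuousOn_time (w := fun x t => W x t ^ m) (cA h) y)
        (bA h y) h1 h12 h2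
    have iq : ∀ {W}, HatSol T M m q W → IntervalIntegrable
        (fun t => hatAvg Δ (fun y => q y (W y t)) x) volume t₁ t₂ := fun {W} h => by
      refine intervalIntegrable_time (M := Q)
        (continuousOn_hatAvg hΔ (w := fun y t => q y (W y t)) (cq h) (bq h) x)
        (fun s hs => ?_) h1 h12 h2
      have := abs_hatAvg_sub_le hΔ (C := 0) (μ := Q) (x := x) (v := fun y => q y (W y s))
        ((continuous_slice (w := fun y t => q y (W y t)) (cq h) hs).intervalIntegrable _ _)
        (fun z _ => by simpa using bq h (x + z) s hs)
      rwa [sub_zero] at this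
    have eγ : ∫ t in t₁..t₂, hatAvg Δ (fun y => q y (U y t) - q y (V y t)) x =
        (∫ t in t₁..t₂, hatAvg Δ (fun y => q y (U y t)) x) -
          ∫ t in t₁..t₂, hatAvg Δ (fun y => q y (V y t)) x := by
      rw [← intervalIntegral.integral_sub (iq hU) (iq hV), intervalIntegral.integral_of_le h12,
        intervalIntegral.integral_of_le h12]
      refine setIntegral_congr_fun measurableSet_Ioc fun t ht => ?_
      have ht' : t ∈ Ioc 0 T := ⟨h1.trans_lt ht.1, ht.2.trans h2⟩
      exact hav x
        (fun _ _ => (continuous_slice (w := fun y t => q y (U y t)) (cq hU) ht').intervalIntegrable _ _)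
        (fun _ _ => (continuous_slice (w := fun y t => q y (V y t)) (cq hV) ht').intervalIntegrable _ _)
    have t1 : t₁ ∈ Icc 0 T := ⟨h1, h12.trans h2⟩
    have t2 : t₂ ∈ Icc 0 T := ⟨h1.trans h12, h2⟩
    rw [hav x (i0 hU t₂ t2) (i0 hV t₂ t2), hav x (i0 hU t₁ t1) (i0 hV t₁ t1), eγ,
      intervalIntegral.integral_sub (iA hU _) (iA hV _),
      intervalIntegral.integral_sub (iA hU _) (iA hV _),
      intervalIntegral.integral_sub (iA hU _) (iA hV _)]
    linear_combination e1 - e2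

/-- `P` holds for all sufficiently small regularisations and then all sufficiently fine stable
meshes of `[0, T]`. -/
def FineMesh (T K L : ℝ) (P : ℝ → ℝ → ℝ → ℕ → Prop) : Prop :=
  ∃ η₁ > 0, η₁ ≤ 1 ∧ ∀ η, 0 < η → η ≤ η₁ → ∃ δ > 0, ∀ (Δ h : ℝ) (N : ℕ), Δ < δ →
    StableMesh h Δ K L → N * h = T → P η Δ h N

theorem FineMesh.and {T K L : ℝ} {P Q : ℝ → ℝ → ℝ → ℕ → Prop} (hP : FineMesh T K L P)
    (hQ : FineMesh T K L Q) : FineMesh T K L fun η Δ h N => P η Δ h N ∧ Q η Δ h N := by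
  obtain ⟨η₁, h1, h1', hP⟩ := hP
  obtain ⟨η₂, h2, h2', hQ⟩ := hQ
  refine ⟨min η₁ η₂, lt_min h1 h2, (min_le_left _ _).trans h1', fun η hη hle => ?_⟩
  obtain ⟨δ₁, d1, hP⟩ := hP η hη (hle.trans (min_le_left _ _))
  obtain ⟨δ₂, d2, hQ⟩ := hQ η hη (hle.trans (min_le_right _ _))
  exact ⟨min δ₁ δ₂, lt_min d1 d2, fun Δ h N hΔ H hN =>
    ⟨hP Δ h N (hΔ.trans_le (min_le_left _ _)) H hN, hQ Δ h N (hΔ.trans_le (min_le_right _ _)) H hN⟩⟩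

theorem FineMesh.mono {T K L : ℝ} {P Q : ℝ → ℝ → ℝ → ℕ → Prop} (hP : FineMesh T K L P)
    (h : ∀ (η Δ k : ℝ) (N : ℕ), 0 < η → η ≤ 1 → StableMesh k Δ K L → N * k = T → P η Δ k N → Q η Δ k N) :
    FineMesh T K L Q := by
  obtain ⟨η₁, h1, h1', hP⟩ := hP
  refine ⟨η₁, h1, h1', fun η hη hle => ?_⟩
  obtain ⟨δ₁, d1, hP⟩ := hP η hη hle
  exact ⟨δ₁, d1, fun Δ k N hΔ H hN => h η Δ k N hη (hle.trans h1') H hN (hP Δ k N hΔ H hN)⟩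

theorem fineMesh_lt {T K L δ : ℝ} (hδ : 0 < δ) : FineMesh T K L fun _ Δ _ _ => Δ < δ :=
  ⟨1, one_pos, le_rfl, fun _ _ _ => ⟨δ, hδ, fun _ _ _ h _ _ => h⟩⟩

theorem FineMesh.of_const {T K L : ℝ} (hT : 0 < T) (hK : 1 ≤ K) (hL : 0 ≤ L) {p : Prop}
    (h : FineMesh T K L fun _ _ _ _ => p) : p := by
  obtain ⟨η₁, h1, h1', h⟩ := h
  obtain ⟨δ, hδ, h⟩ := h η₁ h1 le_rfl
  set Δ := min (δ / 2) (1 / 2) with hΔ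
  have d0 : 0 < Δ := by positivity
  obtain ⟨N, hN⟩ := exists_nat_gt (T * (24 * K / Δ ^ 2 + 4 * L) + 1)
  have hK0 : 0 < K := by linarith
  have hpos : 0 ≤ T * (24 * K / Δ ^ 2 + 4 * L) := by positivity
  have hN0 : (0:ℝ) < N := by linarith
  have key : T / N * (24 * K / Δ ^ 2 + 4 * L) ≤ 1 := by
    rw [div_mul_eq_mul_div, div_le_one hN0]; linarith
  have k1 : T / N * (24 * K / Δ ^ 2) ≤ 1 := by
    have : 0 ≤ T / N * (4 * L) := by positivity
    linarith
  have k2 : T / N * (4 * L) ≤ 1 := by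
    have : 0 ≤ T / N * (24 * K / Δ ^ 2) := by positivity
    linarith
  refine h Δ (T / N) N ((min_le_left _ _).trans_lt (by linarith))
    ⟨by positivity, d0, min_le_right _ _, hK, hL, ?_, by linarith⟩ (by field_simp)
  rw [← mul_div_assoc, div_le_one (by positivity)] at k1
  linarith

/-- Mesh approximation of the integral of `W * Ψ`. -/
def meshPair (Δ : ℝ) (W Ψ : ℤ → ℝ) : ℝ := Δ * ∑' j, W j * Ψ j

theorem meshPair_nonneg {Δ : ℝ} {W Ψ : ℤ → ℝ} (hΔ : 0 ≤ Δ) (hW : ∀ j, 0 ≤ W j) (hΨ : ∀ j, 0 ≤ Ψ j) :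
    0 ≤ meshPair Δ W Ψ :=
  mul_nonneg hΔ (tsum_nonneg fun j => mul_nonneg (hW j) (hΨ j))

theorem meshPair_eq_sum {Δ : ℝ} {W Ψ : ℤ → ℝ} {S : Finset ℤ} (h : ∀ j ∉ S, Ψ j = 0) :
    meshPair Δ W Ψ = Δ * ∑ j ∈ S, W j * Ψ j := by
  unfold meshPair
  rw [tsum_eq_sum fun j hj => by rw [h j hj, mul_zero]]

theorem BddSupp.exists_finset {Ψ : ℤ → ℝ} (h : BddSupp Ψ) : ∃ S : Finset ℤ, ∀ j ∉ S, Ψ j = 0 := by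
  obtain ⟨J, hJ⟩ := h
  refine ⟨Finset.Icc (-J) J, fun j hj => hJ j ?_⟩
  by_contra hcon
  push Not at hcon
  exact hj (Finset.mem_Icc.2 (abs_le.1 hcon))

theorem meshPair_ge_card {Δ γ μ : ℝ} (hΔ : 0 ≤ Δ) (hμ : 0 ≤ μ) {W Ψ : ℤ → ℝ}
    (hΨ : BddSupp Ψ) (hW0 : ∀ j, 0 ≤ W j) (hΨ0 : ∀ j, 0 ≤ Ψ j) {A : Finset ℤ}
    (hW : ∀ j ∈ A, γ ≤ W j) (hA : ∀ j ∈ A, μ ≤ Ψ j) :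
    γ * μ * (Δ * A.card) ≤ meshPair Δ W Ψ := by
  have h1 : ∑ j ∈ A, γ * μ ≤ ∑ j ∈ A, W j * Ψ j := Finset.sum_le_sum fun j hj =>
    mul_le_mul (hW j hj) (hA j hj) hμ (hW0 j)
  have h2 := (hΨ.mul_left W).summable.sum_le_tsum A fun j _ => mul_nonneg (hW0 j) (hΨ0 j)
  rw [Finset.sum_const, nsmul_eq_mul] at h1
  have := mul_le_mul_of_nonneg_left (h1.trans h2) hΔ
  unfold meshPair
  linarith

theorem meshPair_minor {Δ γ₁ γ₂ μ : ℝ} {J : ℤ} (hμ : 0 ≤ μ)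
    (hγ₂ : 0 ≤ γ₂) {W Ψ₁ Ψ₂ : ℤ → ℝ} (h₁ : BddSupp Ψ₁) (h₂ : BddSupp Ψ₂)
    (hm : ∀ i j, i < j → 0 ≤ minor Ψ₁ Ψ₂ i j) (hW : ∀ i < J, 0 ≤ W i) (hW' : ∀ i, J ≤ i → W i ≤ 0)
    {A B : Finset ℤ} (hA : ∀ i ∈ A, i < J ∧ γ₁ ≤ W i) (hB : ∀ j ∈ B, J ≤ j ∧ W j ≤ -γ₂)
    (hAB : ∀ i ∈ A, ∀ j ∈ B, μ ≤ minor Ψ₁ Ψ₂ i j) :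
    γ₁ * γ₂ * μ * ((Δ * A.card) * (Δ * B.card)) ≤
      meshPair Δ W Ψ₁ * meshPair Δ (fun j => max (W j) 0) Ψ₂ -
        meshPair Δ W Ψ₂ * meshPair Δ (fun j => max (W j) 0) Ψ₁ := by
  classical
  obtain ⟨S₁, hS₁⟩ := h₁.exists_finset
  obtain ⟨S₂, hS₂⟩ := h₂.exists_finset
  set S := S₁ ∪ S₂ ∪ (A ∪ B) with hS
  have e₁ : ∀ j ∉ S, Ψ₁ j = 0 := fun j hj => hS₁ j fun h => hj (by simp [hS, h])
  have e₂ : ∀ j ∉ S, Ψ₂ j = 0 := fun j hj => hS₂ j fun h => hj (by simp [hS, h])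
  rw [meshPair_eq_sum e₁, meshPair_eq_sum e₂, meshPair_eq_sum e₁, meshPair_eq_sum e₂]
  have key : Δ * (∑ j ∈ S, W j * Ψ₁ j) * (Δ * ∑ j ∈ S, max (W j) 0 * Ψ₂ j) -
      Δ * (∑ j ∈ S, W j * Ψ₂ j) * (Δ * ∑ j ∈ S, max (W j) 0 * Ψ₁ j) =
      Δ ^ 2 * ∑ i ∈ S, ∑ j ∈ S, max (W i) 0 * max (-W j) 0 * minor Ψ₁ Ψ₂ i j := by
    have sp : ∀ j, W j = max (W j) 0 - max (-W j) 0 := fun j => by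
      rcases le_total 0 (W j) with h | h
      · rw [max_eq_left h, max_eq_right (by linarith)]; ring
      · rw [max_eq_right h, max_eq_left (by linarith)]; ring
    have sW : ∀ Ψ : ℤ → ℝ, ∑ j ∈ S, W j * Ψ j =
        (∑ j ∈ S, max (W j) 0 * Ψ j) - ∑ j ∈ S, max (-W j) 0 * Ψ j := fun Ψ => by
      rw [← Finset.sum_sub_distrib]
      refine Finset.sum_congr rfl fun j _ => ?_
      rw [← sub_mul, ← sp]
    have sp2 : ∑ i ∈ S, ∑ j ∈ S, max (W i) 0 * max (-W j) 0 * minor Ψ₁ Ψ₂ i j =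
        (∑ i ∈ S, max (W i) 0 * Ψ₁ i) * (∑ j ∈ S, max (-W j) 0 * Ψ₂ j) -
        (∑ i ∈ S, max (W i) 0 * Ψ₂ i) * (∑ j ∈ S, max (-W j) 0 * Ψ₁ j) := by
      rw [Finset.sum_mul_sum, Finset.sum_mul_sum, ← Finset.sum_sub_distrib]
      refine Finset.sum_congr rfl fun i _ => ?_
      rw [← Finset.sum_sub_distrib]
      refine Finset.sum_congr rfl fun j _ => ?_
      unfold minor; ring
    rw [sp2, sW, sW]; ring
  rw [key]
  have nn : ∀ i j, 0 ≤ max (W i) 0 * max (-W j) 0 * minor Ψ₁ Ψ₂ i j := fun i j => by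
    rcases lt_or_ge i J with hi | hi
    · rcases lt_or_ge j J with hj | hj
      · rw [max_eq_right (by linarith [hW j hj] : -W j ≤ 0)]; simp
      · exact mul_nonneg (mul_nonneg (le_max_right _ _) (le_max_right _ _)) (hm i j (hi.trans_le hj))
    · rw [max_eq_right (hW' i hi)]; simp
  have hAS : A ⊆ S := fun j hj => by simp [hS, hj]
  have hBS : B ⊆ S := fun j hj => by simp [hS, hj]
  have l1 : ∑ i ∈ A, ∑ j ∈ B, γ₁ * γ₂ * μ ≤
      ∑ i ∈ S, ∑ j ∈ S, max (W i) 0 * max (-W j) 0 * minor Ψ₁ Ψ₂ i j := by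
    refine le_trans (Finset.sum_le_sum fun i hi => Finset.sum_le_sum fun j hj => ?_)
      ((Finset.sum_le_sum fun i _ => Finset.sum_le_sum_of_subset_of_nonneg hBS fun j _ _ => nn i j).trans
        (Finset.sum_le_sum_of_subset_of_nonneg hAS fun i _ _ => Finset.sum_nonneg fun j _ => nn i j))
    have a1 := (hA i hi).2
    have b1 := (hB j hj).2
    refine mul_le_mul (mul_le_mul (a1.trans (le_max_left _ _))
      ((by linarith : γ₂ ≤ -W j).trans (le_max_left _ _)) hγ₂ (le_max_right _ _)) (hAB i hi j hj) hμ
      (mul_nonneg (le_max_right _ _) (le_max_right _ _))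
  simp only [Finset.sum_const, nsmul_eq_mul] at l1
  have := mul_le_mul_of_nonneg_left l1 (sq_nonneg Δ)
  linarith

/-- The mesh points within `ρ` of `z`. -/
def meshBall (Δ z ρ : ℝ) : Finset ℤ := Finset.Icc ⌈(z - ρ) / Δ⌉ ⌊(z + ρ) / Δ⌋

theorem mem_meshBall {Δ z ρ : ℝ} (hΔ : 0 < Δ) {j : ℤ} : j ∈ meshBall Δ z ρ ↔ |j * Δ - z| ≤ ρ := by
  rw [meshBall, Finset.mem_Icc, Int.ceil_le, Int.le_floor, div_le_iff₀ hΔ, le_div_iff₀ hΔ, abs_le]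
  constructor <;> rintro ⟨h1, h2⟩ <;> constructor <;> linarith

theorem le_mul_card_meshBall {Δ z ρ : ℝ} (hΔ : 0 < Δ) (h : Δ ≤ ρ) :
    ρ ≤ Δ * (meshBall Δ z ρ).card := by
  have h1 : ((z + ρ) / Δ - 1 + 1 - ((z - ρ) / Δ + 1) : ℝ) ≤ (meshBall Δ z ρ).card := by
    have := Int.self_le_toNat (⌊(z + ρ) / Δ⌋ + 1 - ⌈(z - ρ) / Δ⌉)
    rw [meshBall, Int.card_Icc]
    have t : ((⌊(z + ρ) / Δ⌋ + 1 - ⌈(z - ρ) / Δ⌉ : ℤ) : ℝ) ≤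
        ((⌊(z + ρ) / Δ⌋ + 1 - ⌈(z - ρ) / Δ⌉).toNat : ℝ) := by exact_mod_cast this
    push_cast at t
    have := Int.sub_one_lt_floor ((z + ρ) / Δ)
    have := Int.ceil_lt_add_one ((z - ρ) / Δ)
    linarith
  have := mul_le_mul_of_nonneg_left h1 hΔ.le
  have e : Δ * ((z + ρ) / Δ - 1 + 1 - ((z - ρ) / Δ + 1)) = 2 * ρ - Δ := by field_simp; ring
  linarith

theorem mul_card_meshBall_le {Δ z ρ : ℝ} (hΔ : 0 < Δ) (hρ : 0 ≤ ρ) (h : Δ ≤ ρ) :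
    Δ * (meshBall Δ z ρ).card ≤ 3 * ρ := by
  have h1 : ((meshBall Δ z ρ).card : ℝ) ≤ (z + ρ) / Δ + 1 - (z - ρ) / Δ := by
    rw [meshBall, Int.card_Icc]
    have t : ((⌊(z + ρ) / Δ⌋ + 1 - ⌈(z - ρ) / Δ⌉).toNat : ℝ) =
        ((max (⌊(z + ρ) / Δ⌋ + 1 - ⌈(z - ρ) / Δ⌉) 0 : ℤ) : ℝ) := by
      exact_mod_cast congrArg (Int.cast : ℤ → ℝ) (Int.toNat_eq_max _)
    rw [t]; push_cast
    have := Int.floor_le ((z + ρ) / Δ)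
    have := Int.le_ceil ((z - ρ) / Δ)
    refine max_le (by linarith) ?_
    have : (z - ρ) / Δ ≤ (z + ρ) / Δ := by gcongr; linarith
    linarith
  have := mul_le_mul_of_nonneg_left h1 hΔ.le
  have e : Δ * ((z + ρ) / Δ + 1 - (z - ρ) / Δ) = 2 * ρ + Δ := by field_simp; ring
  linarith

theorem bump_nonneg (x₀ ϱ x : ℝ) : 0 ≤ bump x₀ ϱ x := pow_nonneg (le_max_left _ _) 3

theorem bump_le_one {ϱ : ℝ} (hϱ : 0 < ϱ) (x₀ x : ℝ) : bump x₀ ϱ x ≤ 1 := by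
  unfold bump
  have : 0 ≤ (x - x₀) ^ 2 / ϱ := by positivity
  exact pow_le_one₀ (le_max_left _ _) (max_le zero_le_one (by linarith))

theorem bump_eq_zero {x₀ ϱ x : ℝ} (hϱ : 0 < ϱ) (h : √ϱ ≤ |x - x₀|) : bump x₀ ϱ x = 0 := by
  unfold bump
  have h1 : ϱ ≤ (x - x₀) ^ 2 := by
    rw [← sq_abs, ← Real.sq_sqrt hϱ.le]
    exact pow_le_pow_left₀ (Real.sqrt_nonneg _) h 2
  rw [max_eq_left]
  · norm_num
  · have := (one_le_div hϱ).2 h1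
    linarith

theorem le_bump {x₀ ϱ x : ℝ} (hϱ : 0 < ϱ) (h : |x - x₀| ≤ √ϱ / 2) : 27 / 64 ≤ bump x₀ ϱ x := by
  unfold bump
  have h1 : (x - x₀) ^ 2 ≤ ϱ / 4 := by
    rw [← sq_abs]
    calc |x - x₀| ^ 2 ≤ (√ϱ / 2) ^ 2 := pow_le_pow_left₀ (abs_nonneg _) h 2
      _ = ϱ / 4 := by rw [div_pow, Real.sq_sqrt hϱ.le]; norm_num
  have h2 : (x - x₀) ^ 2 / ϱ ≤ 1 / 4 := by rw [div_le_iff₀ hϱ]; linarith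
  have h3 : (3 / 4 : ℝ) ≤ max 0 (1 - (x - x₀) ^ 2 / ϱ) := le_max_of_le_right (by linarith)
  calc (27 / 64 : ℝ) = (3 / 4) ^ 3 := by norm_num
    _ ≤ _ := pow_le_pow_left₀ (by norm_num) h3 3

theorem abs_bump_sub_le {ϱ : ℝ} (hϱ : 0 < ϱ) (x₀ x y : ℝ) :
    |bump x₀ ϱ x - bump x₀ ϱ y| ≤ 6 / √ϱ * |x - y| := by
  have hs : 0 < √ϱ := Real.sqrt_pos.2 hϱ
  set g : ℝ → ℝ := fun x => min 1 (|x - x₀| / √ϱ) with hg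
  have g0 : ∀ x, 0 ≤ g x := fun x => le_min zero_le_one (by positivity)
  have g1 : ∀ x, g x ≤ 1 := fun x => min_le_left _ _
  have e : ∀ x, max 0 (1 - (x - x₀) ^ 2 / ϱ) = 1 - g x ^ 2 := fun x => by
    have e1 : (x - x₀) ^ 2 / ϱ = (|x - x₀| / √ϱ) ^ 2 := by
      rw [div_pow, sq_abs, Real.sq_sqrt hϱ.le]
    rw [e1]
    set q := |x - x₀| / √ϱ with hq
    have q0 : 0 ≤ q := by positivity
    rcases le_total 1 q with h | h
    · rw [hg]; simp only [← hq]; rw [min_eq_left h, max_eq_left]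
      · norm_num
      · nlinarith
    · rw [hg]; simp only [← hq]; rw [min_eq_right h, max_eq_right]
      nlinarith
  have hl : |g x - g y| ≤ |x - y| / √ϱ := by
    refine (abs_min_sub_min_le_max _ _ _ _).trans ?_
    rw [sub_self, abs_zero, max_eq_right (abs_nonneg _), ← sub_div, abs_div, abs_of_pos hs]
    refine div_le_div_of_nonneg_right ?_ hs.le
    have := abs_abs_sub_abs_le (x - x₀) (y - x₀)
    rwa [sub_sub_sub_cancel_right] at this
  unfold bump
  rw [e, e]
  have h0 := g0 x; have h0' := g0 y; have h1 := g1 x; have h1' := g1 y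
  generalize g x = a at *
  generalize g y = c at *
  have f : (1 - a ^ 2) ^ 3 - (1 - c ^ 2) ^ 3 = -(a - c) * ((a + c) *
      ((1 - a ^ 2) ^ 2 + (1 - a ^ 2) * (1 - c ^ 2) + (1 - c ^ 2) ^ 2)) := by ring
  have a2 : 0 ≤ 1 - a ^ 2 := by nlinarith
  have c2 : 0 ≤ 1 - c ^ 2 := by nlinarith
  have a3 : 1 - a ^ 2 ≤ 1 := by nlinarith
  have c3 : 1 - c ^ 2 ≤ 1 := by nlinarith
  have b1 : (1 - a ^ 2) ^ 2 + (1 - a ^ 2) * (1 - c ^ 2) + (1 - c ^ 2) ^ 2 ≤ 3 := by nlinarith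
  have b0 : 0 ≤ (1 - a ^ 2) ^ 2 + (1 - a ^ 2) * (1 - c ^ 2) + (1 - c ^ 2) ^ 2 := by positivity
  have b2 : (a + c) * ((1 - a ^ 2) ^ 2 + (1 - a ^ 2) * (1 - c ^ 2) + (1 - c ^ 2) ^ 2) ≤ 2 * 3 :=
    mul_le_mul (by linarith) b1 b0 (by norm_num)
  rw [f, abs_mul, abs_neg, abs_of_nonneg (mul_nonneg (by linarith) b0)]
  calc _ ≤ |x - y| / √ϱ * (2 * 3) := mul_le_mul hl b2 (mul_nonneg (by linarith) b0) (by positivity)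
    _ = _ := by ring

theorem testProfile_bump {ϱ : ℝ} (hϱ : 0 < ϱ) (x₀ : ℝ) :
    TestProfile (|x₀| + √ϱ) (1 + 6 / √ϱ) (bump x₀ ϱ) where
  nonneg := bump_nonneg x₀ ϱ
  le x := (bump_le_one hϱ x₀ x).trans (by have : 0 ≤ 6 / √ϱ := by positivity
                                          linarith)
  zero x h := bump_eq_zero hϱ (by linarith [abs_sub_abs_le_abs_sub x x₀])
  lip x y := (abs_bump_sub_le hϱ x₀ x y).trans
    (mul_le_mul_of_nonneg_right (by linarith) (abs_nonneg _))

theorem intervalIntegrable_hat_mul {Δ : ℝ} {v : ℝ → ℝ} (x : ℝ)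
    (hv : ∀ x y, IntervalIntegrable v volume x y) :
    IntervalIntegrable (fun z => hat Δ z * v (x + z)) volume (-Δ) Δ := by
  have := (hv (x + -Δ) (x + Δ)).comp_add_left x
  exact (by simpa using this : IntervalIntegrable (fun z => v (x + z)) volume (-Δ) Δ).continuousOn_mul
    (continuous_hat Δ).continuousOn

theorem hatAvg_le {Δ C : ℝ} (hΔ : 0 < Δ) {v : ℝ → ℝ} {x : ℝ}
    (hv : ∀ x y, IntervalIntegrable v volume x y) (h : ∀ y, |y - x| < Δ → v y ≤ C) :
    hatAvg Δ v x ≤ C := by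
  have e : ∫ z in (-Δ)..Δ, hat Δ z * C = C := by
    rw [intervalIntegral.integral_mul_const, integral_hat hΔ, one_mul]
  rw [← e]
  refine intervalIntegral.integral_mono_on (by linarith) (intervalIntegrable_hat_mul x hv)
    (((continuous_hat Δ).mul continuous_const).intervalIntegrable _ _) fun z _ => ?_
  rcases lt_or_ge |z| Δ with hz | hz
  · exact mul_le_mul_of_nonneg_left (h _ (by rwa [add_sub_cancel_left])) (hat_nonneg Δ z)
  · rw [hat_eq_zero hz]; simp

theorem le_hatAvg {Δ C : ℝ} (hΔ : 0 < Δ) {v : ℝ → ℝ} {x : ℝ}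
    (hv : ∀ x y, IntervalIntegrable v volume x y) (h : ∀ y, |y - x| < Δ → C ≤ v y) :
    C ≤ hatAvg Δ v x := by
  have e : ∫ z in (-Δ)..Δ, hat Δ z * C = C := by
    rw [intervalIntegral.integral_mul_const, integral_hat hΔ, one_mul]
  rw [← e]
  refine intervalIntegral.integral_mono_on (by linarith)
    (((continuous_hat Δ).mul continuous_const).intervalIntegrable _ _)
    (intervalIntegrable_hat_mul x hv) fun z _ => ?_
  rcases lt_or_ge |z| Δ with hz | hz
  · exact mul_le_mul_of_nonneg_left (h _ (by rwa [add_sub_cancel_left])) (hat_nonneg Δ z)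
  · rw [hat_eq_zero hz]; simp

theorem meshPair_bump_le {Δ C ϱ x₀ : ℝ} (hΔ : 0 < Δ) (hϱ : 0 < ϱ) {v : ℝ → ℝ} (hv : Continuous v)
    (h : ∀ x, |x - x₀| ≤ √ϱ + Δ → v x ≤ C) :
    meshPair Δ (fun j => hatAvg Δ v (j * Δ)) (fun j => bump x₀ ϱ (j * Δ)) ≤
      C * meshPair Δ (fun _ => 1) fun j => bump x₀ ϱ (j * Δ) := by
  have bs := (testProfile_bump hϱ x₀).bddSupp hΔ
  unfold meshPair
  rw [mul_left_comm, ← tsum_mul_left (a := C)]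
  refine mul_le_mul_of_nonneg_left ((bs.mul_left _).summable.tsum_le_tsum (fun j => ?_)
    ((bs.mul_left fun _ => 1).const_mul C).summable) hΔ.le
  dsimp only
  rcases le_or_gt √ϱ |j * Δ - x₀| with hj | hj
  · rw [bump_eq_zero hϱ hj]; simp
  · rw [one_mul]
    refine mul_le_mul_of_nonneg_right (hatAvg_le hΔ (fun _ _ => hv.intervalIntegrable _ _)
      fun y hy => h y ?_) (bump_nonneg _ _ _)
    have := abs_add_le (y - j * Δ) (j * Δ - x₀)
    rw [sub_add_sub_cancel] at this
    linarith

theorem le_meshPair_bump {Δ C ϱ x₀ : ℝ} (hΔ : 0 < Δ) (hϱ : 0 < ϱ) {v : ℝ → ℝ} (hv : Continuous v)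
    (h : ∀ x, |x - x₀| ≤ √ϱ + Δ → C ≤ v x) :
    C * meshPair Δ (fun _ => 1) (fun j => bump x₀ ϱ (j * Δ)) ≤
      meshPair Δ (fun j => hatAvg Δ v (j * Δ)) fun j => bump x₀ ϱ (j * Δ) := by
  have bs := (testProfile_bump hϱ x₀).bddSupp hΔ
  unfold meshPair
  rw [mul_left_comm, ← tsum_mul_left (a := C)]
  refine mul_le_mul_of_nonneg_left (((bs.mul_left _).const_mul C).summable.tsum_le_tsum (fun j => ?_)
    (bs.mul_left _).summable) hΔ.le
  dsimp only
  rcases le_or_gt √ϱ |j * Δ - x₀| with hj | hj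
  · rw [bump_eq_zero hϱ hj]; simp
  · rw [one_mul]
    refine mul_le_mul_of_nonneg_right (le_hatAvg hΔ (fun _ _ => hv.intervalIntegrable _ _)
      fun y hy => h y ?_) (bump_nonneg _ _ _)
    have := abs_add_le (y - j * Δ) (j * Δ - x₀)
    rw [sub_add_sub_cancel] at this
    linarith

theorem bump_mass_le {Δ ϱ x₀ : ℝ} (hΔ : 0 < Δ) (hϱ : 0 < ϱ) (h : Δ ≤ √ϱ) :
    meshPair Δ (fun _ => 1) (fun j => bump x₀ ϱ (j * Δ)) ≤ 3 * √ϱ := by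
  refine le_trans ?_ (mul_card_meshBall_le (z := x₀) hΔ (Real.sqrt_nonneg _) h)
  rw [meshPair_eq_sum (S := meshBall Δ x₀ √ϱ) fun j hj => bump_eq_zero hϱ ?_]
  · refine mul_le_mul_of_nonneg_left ?_ hΔ.le
    refine (Finset.sum_le_card_nsmul _ _ 1 fun j _ => ?_).trans (by simp)
    rw [one_mul]; exact bump_le_one hϱ _ _
  · rw [mem_meshBall hΔ] at hj
    exact (not_le.1 hj).le

theorem le_bump_mass {Δ ϱ x₀ : ℝ} (hΔ : 0 < Δ) (hϱ : 0 < ϱ) (h : Δ ≤ √ϱ / 2) :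
    27 / 128 * √ϱ ≤ meshPair Δ (fun _ => 1) fun j => bump x₀ ϱ (j * Δ) := by
  have h1 := meshPair_ge_card (γ := 1) (μ := 27 / 64) hΔ.le (by norm_num)
    ((testProfile_bump hϱ x₀).bddSupp hΔ) (fun _ => zero_le_one) (fun j => bump_nonneg x₀ ϱ (j * Δ))
    (A := meshBall Δ x₀ (√ϱ / 2)) (W := fun _ => 1) (fun _ _ => le_rfl)
    (fun j hj => le_bump hϱ ((mem_meshBall hΔ).1 hj))
  have h2 := le_mul_card_meshBall (z := x₀) hΔ h
  linarith

theorem gridDual_mass_le {η T h Δ K L R Q : ℝ} {a c : ℝ → ℝ → ℝ} {ψ : ℝ → ℝ} {N : ℕ} {W : ℤ → ℝ}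
    (H : StableMesh h Δ K L)
    (hc : ∀ k, BoundedCoeff K L (gridDiff η T h Δ a k) (gridPot T h Δ c k)) (hN : N * h = T)
    (h0 : ∀ x, 0 ≤ ψ x) (h1 : ∀ x, ψ x ≤ 1) (hR : ∀ x, R ≤ |x| → ψ x = 0)
    (bs : BddSupp fun j : ℤ => ψ (j * Δ)) (hW : ∀ j, W j ≤ Q) (hQ : 0 ≤ Q) :
    meshPair Δ W (gridDual η T h Δ a c ψ N) ≤
      4 * (Q * (Real.exp (T * (8 * K + L)) * Real.exp (2 * R))) := by
  have hΔ := H.mesh_pos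
  have nn : ∀ j, 0 ≤ gridDual η T h Δ a c ψ N j := dualScheme_nonneg H hc (fun j => h0 _) N
  have le := dualScheme_le_exp (T := T) (k := N) H hc (φ := fun j => ψ (j * Δ)) (Real.exp_pos (2 * R)).le
    (fun j => by
      rcases le_or_gt R |(j:ℝ) * Δ| with hj | hj
      · rw [hR _ hj]; positivity
      · rw [abs_mul, abs_of_pos hΔ] at hj
        rw [← Real.exp_add]
        exact (h1 _).trans (Real.one_le_exp (by linarith))) hN.le
  refine mesh_tsum_le_of_le_expDecay hΔ H.mesh_le (by positivity)
    (BddSupp.mul_left _ (dualScheme_bddSupp bs N)) fun j => ?_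
  have l2 : Real.exp (-(2 * (|(j:ℝ)| * Δ))) ≤ expDecay Δ j := by
    unfold expDecay
    have : 0 ≤ |(j:ℝ)| * Δ := by positivity
    exact Real.exp_le_exp.2 (by linarith)
  calc _ ≤ Q * gridDual η T h Δ a c ψ N j := mul_le_mul_of_nonneg_right (hW j) (nn j)
    _ ≤ Q * (Real.exp (T * (8 * K + L)) * Real.exp (2 * R) * expDecay Δ j) := by
      refine mul_le_mul_of_nonneg_left ((le j).trans ?_) hQ
      gcongr
    _ = _ := by ring

/-- Hat averages of `v` at the mesh points. -/
def meshTrace (Δ : ℝ) (v : ℝ → ℝ) (j : ℤ) : ℝ := hatAvg Δ v (j * Δ)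

section
variable {T M K L : ℝ} {w v γ a c : ℝ → ℝ → ℝ}

theorem LinSol.fine_duality (S : LinSol T M K L w v γ a c) {R₀ B : ℝ} {ψ : ℝ → ℝ}
    (hψ : TestProfile R₀ B ψ) {ε : ℝ} (hε : 0 < ε) :
    FineMesh T K L fun η Δ h N =>
      |meshPair Δ (meshTrace Δ fun y => w y T) (fun j => ψ (j * Δ)) -
        meshPair Δ (meshTrace Δ fun y => w y 0) (gridDual η T h Δ a c ψ N)| ≤ ε :=
  S.duality hψ hε

theorem LinSol.fine_lower (S : LinSol T M K L w v γ a c) {η₀ ε : ℝ} {ψ : ℝ → ℝ} {F : ℝ → ℝ → ℝ}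
    (D : DualSub T L η₀ a ψ F) (hη : 0 < η₀) (hε : 0 < ε) :
    FineMesh T K L fun η Δ h N => ∀ j : ℤ, F (j * Δ) T - ε ≤ gridDual η T h Δ a c ψ N j := by
  have hK : 0 < K := by linarith [S.one_le]
  obtain ⟨δ, hδ, H⟩ := D.lower S.T_pos hK hε
  refine ⟨min 1 η₀, by positivity, min_le_left _ _, fun η h0 hle => ⟨δ, hδ, fun Δ h N hΔ H' hN =>
    H c η Δ h N h0 (hle.trans (min_le_right _ _)) hΔ H' hN
      (S.boundedCoeff h0 (hle.trans (min_le_left _ _)) h Δ)⟩⟩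

theorem LinSol.fine_minor (S : LinSol T M K L w v γ a c) {η₀ η₁ ε gap : ℝ} {ψ χ : ℝ → ℝ}
    {F G : ℝ → ℝ → ℝ} (D : DualSub T L η₀ a ψ F) (D' : DualSub T L η₁ a χ G) (hη : 0 < η₀)
    (hη' : 0 < η₁) (hε : 0 < ε) (hgap : 0 < gap)
    (hsep : ∀ τ ∈ Icc 0 T, ∀ x y, y ≤ x + gap → F x τ * G y τ = 0) :
    FineMesh T K L fun η Δ h N => ∀ i j : ℤ, i < j →
      0 ≤ minor (gridDual η T h Δ a c ψ N) (gridDual η T h Δ a c χ N) i j ∧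
      F (i * Δ) T * G (j * Δ) T - ε ≤
        minor (gridDual η T h Δ a c ψ N) (gridDual η T h Δ a c χ N) i j := by
  have hK : 0 < K := by linarith [S.one_le]
  obtain ⟨δ, hδ, H⟩ := D.minor_lower D' S.T_pos hK hε hgap hsep
  refine ⟨min 1 (min η₀ η₁), by positivity, min_le_left _ _, fun η h0 hle => ⟨δ, hδ,
    fun Δ h N hΔ H' hN =>
    H c η Δ h N h0 (hle.trans ((min_le_right _ _).trans (min_le_left _ _)))
      (hle.trans ((min_le_right _ _).trans (min_le_right _ _))) hΔ H' hN
      (S.boundedCoeff h0 (hle.trans (min_le_left _ _)) h Δ)⟩⟩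

theorem LinSol.meshTrace_le (S : LinSol T M K L w v γ a c) {Δ : ℝ} (hΔ : 0 < Δ) (j : ℤ) :
    meshTrace Δ (fun y => w y 0) j ≤ M :=
  hatAvg_le hΔ S.int_zero fun y _ => (le_abs_self _).trans (S.bdd_w y 0 ⟨le_rfl, S.T_pos.le⟩)

theorem LinSol.bound_nonneg (S : LinSol T M K L w v γ a c) : 0 ≤ M :=
  (abs_nonneg _).trans (S.bdd_w 0 T ⟨S.T_pos.le, le_rfl⟩)

theorem LinSol.slice (S : LinSol T M K L w v γ a c) : Continuous fun y => w y T :=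
  continuous_slice S.cont_w ⟨S.T_pos, le_rfl⟩

theorem exists_pos_radius {g : ℝ → ℝ} (hg : Continuous g) {x₀ : ℝ} (h : 0 < g x₀) {r : ℝ}
    (hr : 0 < r) : ∃ ρ > 0, ρ ≤ r ∧ ∃ δ > 0, ∀ x, |x - x₀| ≤ 2 * ρ → δ ≤ g x := by
  have h1 : ∀ᶠ x in nhds x₀, g x₀ / 2 < g x := hg.continuousAt.eventually_const_lt (by linarith)
  obtain ⟨e, he, hb⟩ := Metric.eventually_nhds_iff.1 h1
  refine ⟨min r (e / 3), by positivity, min_le_left _ _, g x₀ / 2, by positivity, fun x hx => ?_⟩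
  refine (hb ?_).le
  rw [Real.dist_eq]
  have := min_le_right r (e / 3)
  linarith

theorem LinSol.nonneg (S : LinSol T M K L w v γ a c) (h0 : ∀ x, 0 ≤ w x 0) (x₀ : ℝ) :
    0 ≤ w x₀ T := by
  by_contra hneg
  push Not at hneg
  obtain ⟨ρ, hρ, -, δ, hδ, hle⟩ := exists_pos_radius S.slice.neg (x₀ := x₀)
    (by linarith : 0 < -w x₀ T) one_pos
  have hϱ : 0 < ρ ^ 2 := by positivity
  have hs : √(ρ ^ 2) = ρ := Real.sqrt_sq hρ.le
  refine FineMesh.of_const S.T_pos S.one_le S.L_nonneg (p := False)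
    (((S.fine_duality (testProfile_bump hϱ x₀) (ε := δ * ρ / 10) (by positivity)).and
      (fineMesh_lt (half_pos hρ))).mono fun η Δ h N hη hη1 H hN ⟨h1, h2⟩ => ?_)
  have hΔ := H.mesh_pos
  have e1 := meshPair_bump_le (C := -δ) (x₀ := x₀) hΔ hϱ S.slice fun x hx => by
    have : δ ≤ -w x T := hle x (by rw [hs] at hx; linarith)
    linarith
  have e2 := le_bump_mass (x₀ := x₀) hΔ hϱ (by rw [hs]; exact h2.le)
  rw [hs] at e2
  have e3 : 0 ≤ meshPair Δ (meshTrace Δ fun y => w y 0) (gridDual η T h Δ a c (bump x₀ (ρ ^ 2)) N) :=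
    meshPair_nonneg hΔ.le (fun j => le_hatAvg hΔ S.int_zero fun y _ => h0 y)
      (dualScheme_nonneg H (S.boundedCoeff hη hη1 h Δ) (fun j => bump_nonneg _ _ _) N)
  have h1 := (abs_le.1 h1).1
  change meshPair Δ (meshTrace Δ fun y => w y T) _ ≤ _ at e1
  nlinarith

/-- A nonnegative solution cannot vanish on an interval that is joined to a set of positive initial
values by a tube of positive diffusivity. -/
theorem LinSol.not_vanishing (S : LinSol T M K L w v γ a c) (h0 : ∀ x, 0 ≤ w x 0)
    {x₀ z d αlo γ₀ ρ₀ : ℝ} (hd : 0 < d) (hαlo : 0 < αlo) (hγ₀ : 0 < γ₀) (hρ₀ : 0 < ρ₀)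
    (htube : ∀ τ ∈ Ico 0 T, ∀ x, |x - barrierCentre x₀ z 0 T τ| < d → αlo ≤ a x (T - τ))
    (hz : ∀ x, |x - z| ≤ ρ₀ → γ₀ ≤ w x 0) (hv : ∀ x, |x - x₀| ≤ 2 * d → w x T = 0) : False := by
  obtain ⟨ϱ, hϱ, k, hk, ρ, hρ, F, hϱd, D, hF, -⟩ := exists_coarse_barrier S.T_pos le_rfl le_rfl hd
    S.L_nonneg S.one_le (le_refl 1) S.a_le hαlo htube
  have hs : √ϱ ≤ d := by rw [← Real.sqrt_sq hd.le]; exact Real.sqrt_le_sqrt hϱd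
  set r := min ρ₀ ρ / 2 with hr
  have hr0 : 0 < r := by positivity
  have r1 : 2 * r ≤ ρ₀ := by rw [hr]; linarith [min_le_left ρ₀ ρ]
  have r2 : 2 * r ≤ ρ := by rw [hr]; linarith [min_le_right ρ₀ ρ]
  refine FineMesh.of_const S.T_pos S.one_le S.L_nonneg (p := False)
    ((((S.fine_duality (testProfile_bump hϱ x₀) (ε := γ₀ * (k / 2) * r / 2) (by positivity)).and
      (fineMesh_lt hr0)).and ((S.fine_lower D one_pos (half_pos hk)).and (fineMesh_lt hd))).mono
      fun η Δ h N hη hη1 H hN ⟨⟨h1, h2⟩, h3, h4⟩ => ?_)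
  have hΔ := H.mesh_pos
  have e1 := le_meshPair_bump (C := 0) (x₀ := x₀) hΔ hϱ S.slice fun x hx =>
    (hv x (by linarith)).ge
  have e1' := meshPair_bump_le (C := 0) (x₀ := x₀) hΔ hϱ S.slice fun x hx =>
    (hv x (by linarith)).le
  change _ ≤ meshPair Δ (meshTrace Δ fun y => w y T) _ at e1
  change meshPair Δ (meshTrace Δ fun y => w y T) _ ≤ _ at e1'
  have e2 := meshPair_ge_card (γ := γ₀) (μ := k / 2) (W := meshTrace Δ fun y => w y 0)
    (Ψ := gridDual η T h Δ a c (bump x₀ ϱ) N) (A := meshBall Δ z r) hΔ.le (by positivity)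
    (dualScheme_bddSupp ((testProfile_bump hϱ x₀).bddSupp hΔ) N)
    (fun j => le_hatAvg hΔ S.int_zero fun y _ => h0 y)
    (dualScheme_nonneg H (S.boundedCoeff hη hη1 h Δ) (fun j => bump_nonneg _ _ _) N)
    (fun j hj => le_hatAvg hΔ S.int_zero fun y hy => hz y (by
      have := (mem_meshBall hΔ).1 hj
      have := abs_add_le (y - j * Δ) (j * Δ - z)
      rw [sub_add_sub_cancel] at this
      linarith))
    (fun j hj => by
      have := hF (j * Δ) (((mem_meshBall hΔ).1 hj).trans (by linarith))
      linarith [h3 j])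
  have e3 := mul_le_mul_of_nonneg_left (le_mul_card_meshBall (z := z) hΔ h2.le)
    (by positivity : 0 ≤ γ₀ * (k / 2))
  have h1 := (abs_le.1 h1).1
  have : 0 < γ₀ * (k / 2) * r := by positivity
  linarith

theorem minor_dualScheme_nonneg {h Δ K L : ℝ} (H : StableMesh h Δ K L) {α c : ℕ → ℤ → ℝ}
    (hc : ∀ k, BoundedCoeff K L (α k) (c k)) {φ χ : ℤ → ℝ} (hD : ∀ i j, i < j → 0 ≤ minor φ χ i j)
    (k : ℕ) : ∀ i j, i < j → 0 ≤ minor (dualScheme h Δ α c φ k) (dualScheme h Δ α c χ k) i j := by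
  induction k with
  | zero => exact hD
  | succ k ih => exact fun i j hij => minor_eulerStep_nonneg H (hc k) ih hij

theorem minor_bump_nonneg {Δ x₁ x₂ ϱ₁ ϱ₂ : ℝ} (hΔ : 0 < Δ) (h₁ : 0 < ϱ₁) (h₂ : 0 < ϱ₂)
    (h : √ϱ₁ + √ϱ₂ ≤ x₂ - x₁) (i j : ℤ) (hij : i < j) :
    0 ≤ minor (fun j : ℤ => bump x₁ ϱ₁ (j * Δ)) (fun j : ℤ => bump x₂ ϱ₂ (j * Δ)) i j := by
  unfold minor
  have e : bump x₁ ϱ₁ (j * Δ) * bump x₂ ϱ₂ (i * Δ) = 0 := by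
    by_cases h1 : √ϱ₁ ≤ |j * Δ - x₁|
    · rw [bump_eq_zero h₁ h1, zero_mul]
    · by_cases h2 : √ϱ₂ ≤ |i * Δ - x₂|
      · rw [bump_eq_zero h₂ h2, mul_zero]
      · push Not at h1 h2
        have : (i:ℝ) * Δ ≤ j * Δ := by gcongr
        linarith [(abs_lt.1 h1).2, (abs_lt.1 h2).1]
  have := mul_nonneg (bump_nonneg x₁ ϱ₁ (i * Δ)) (bump_nonneg x₂ ϱ₂ (j * Δ))
  linarith

theorem LinSol.sign_pattern (S : LinSol T M K L w v γ a c) (hl : ∀ x ≤ 0, 0 ≤ w x 0)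
    (hr : ∀ x > 0, w x 0 ≤ 0) {Δ : ℝ} (hΔ : 0 < Δ) :
    ∃ J : ℤ, 0 ≤ J ∧ J ≤ 1 ∧ (∀ i < J, 0 ≤ meshTrace Δ (fun y => w y 0) i) ∧
      ∀ i, J ≤ i → meshTrace Δ (fun y => w y 0) i ≤ 0 := by
  have h1 : ∀ i < 0, 0 ≤ meshTrace Δ (fun y => w y 0) i := fun i hi =>
    le_hatAvg hΔ S.int_zero fun y hy => hl y (by
      have : (i:ℝ) ≤ -1 := by exact_mod_cast (by omega : i ≤ -1)
      have := (abs_lt.1 hy).2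
      nlinarith)
  have h2 : ∀ i, 1 ≤ i → meshTrace Δ (fun y => w y 0) i ≤ 0 := fun i hi =>
    hatAvg_le hΔ S.int_zero fun y hy => hr y (by
      have : (1:ℝ) ≤ i := by exact_mod_cast hi
      have := (abs_lt.1 hy).1
      nlinarith)
  rcases le_total 0 (meshTrace Δ (fun y => w y 0) 0) with h | h
  · refine ⟨1, by norm_num, le_rfl, fun i hi => ?_, h2⟩
    rcases (by omega : i < 0 ∨ i = 0) with hi | rfl
    · exact h1 i hi
    · exact h
  · refine ⟨0, le_rfl, by norm_num, h1, fun i hi => ?_⟩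
    rcases (by omega : 1 ≤ i ∨ i = 0) with hi | rfl
    · exact h2 i hi
    · exact h

/-- Sign changes from plus to minus cannot turn into sign changes from minus to plus. -/
theorem LinSol.no_reversal (S : LinSol T M K L w v γ a c) (hl : ∀ x ≤ 0, 0 ≤ w x 0)
    (hr : ∀ x > 0, w x 0 ≤ 0) {x₁ x₂ : ℝ} (hx : x₁ < x₂) (hneg : w x₁ T < 0) : w x₂ T ≤ 0 := by
  by_contra hpos
  push Not at hpos
  have hx3 : 0 < (x₂ - x₁) / 2 := by linarith
  obtain ⟨ρ₁, hρ₁, hρ₁', δ₁, hδ₁, hle₁⟩ := exists_pos_radius S.slice.neg (x₀ := x₁)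
    (by linarith : 0 < -w x₁ T) hx3
  obtain ⟨ρ₂, hρ₂, hρ₂', δ₂, hδ₂, hle₂⟩ := exists_pos_radius S.slice hpos hx3
  have hϱ₁ : 0 < ρ₁ ^ 2 := by positivity
  have hϱ₂ : 0 < ρ₂ ^ 2 := by positivity
  have hs₁ : √(ρ₁ ^ 2) = ρ₁ := Real.sqrt_sq hρ₁.le
  have hs₂ : √(ρ₂ ^ 2) = ρ₂ := Real.sqrt_sq hρ₂.le
  refine FineMesh.of_const S.T_pos S.one_le S.L_nonneg (p := False)
    ((((S.fine_duality (testProfile_bump hϱ₁ x₁) (ε := δ₁ * ρ₁ / 10) (by positivity)).and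
      (fineMesh_lt (half_pos hρ₁))).and
      ((S.fine_duality (testProfile_bump hϱ₂ x₂) (ε := δ₂ * ρ₂ / 10) (by positivity)).and
      (fineMesh_lt (half_pos hρ₂)))).mono fun η Δ h N hη hη1 H hN ⟨⟨h1, h2⟩, h3, h4⟩ => ?_)
  have hΔ := H.mesh_pos
  have e1 := meshPair_bump_le (C := -δ₁) (x₀ := x₁) hΔ hϱ₁ S.slice fun x hx => by
    have : δ₁ ≤ -w x T := hle₁ x (by rw [hs₁] at hx; linarith)
    linarith
  have e2 := le_bump_mass (x₀ := x₁) hΔ hϱ₁ (by rw [hs₁]; exact h2.le)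
  rw [hs₁] at e2
  have e3 := le_meshPair_bump (C := δ₂) (x₀ := x₂) hΔ hϱ₂ S.slice fun x hx =>
    hle₂ x (by rw [hs₂] at hx; linarith)
  have e4 := le_bump_mass (x₀ := x₂) hΔ hϱ₂ (by rw [hs₂]; exact h4.le)
  rw [hs₂] at e4
  change meshPair Δ (meshTrace Δ fun y => w y T) _ ≤ _ at e1
  change _ ≤ meshPair Δ (meshTrace Δ fun y => w y T) _ at e3
  have h1 := (abs_le.1 h1).1
  have h3 := (abs_le.1 h3).2
  obtain ⟨J, -, -, hJ, hJ'⟩ := S.sign_pattern hl hr hΔ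
  have hb := S.boundedCoeff hη hη1 h Δ
  have b1 := dualScheme_bddSupp (h := h) (Δ := Δ) (α := gridDiff η T h Δ a) (c := gridPot T h Δ c)
    ((testProfile_bump hϱ₁ x₁).bddSupp hΔ) N
  have b2 := dualScheme_bddSupp (h := h) (Δ := Δ) (α := gridDiff η T h Δ a) (c := gridPot T h Δ c)
    ((testProfile_bump hϱ₂ x₂).bddSupp hΔ) N
  have n1 := dualScheme_nonneg H hb (φ := fun j : ℤ => bump x₁ (ρ₁ ^ 2) (j * Δ))
    (fun j => bump_nonneg _ _ _) N
  have n2 := dualScheme_nonneg H hb (φ := fun j : ℤ => bump x₂ (ρ₂ ^ 2) (j * Δ))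
    (fun j => bump_nonneg _ _ _) N
  have key := meshPair_minor (Δ := Δ) (γ₁ := 0) (γ₂ := 0) (μ := 0) (A := ∅) (B := ∅) le_rfl le_rfl b1 b2
    (minor_dualScheme_nonneg H hb (minor_bump_nonneg hΔ hϱ₁ hϱ₂ (by rw [hs₁, hs₂]; linarith)) N)
    hJ hJ' (by simp) (by simp) (by simp)
  have p1 := meshPair_nonneg (W := fun j => max (meshTrace Δ (fun y => w y 0) j) 0) hΔ.le
    (fun j => le_max_right _ _) n1
  have p2 : meshPair Δ (meshTrace Δ fun y => w y 0) (gridDual η T h Δ a c (bump x₂ (ρ₂ ^ 2)) N) ≤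
      meshPair Δ (fun j => max (meshTrace Δ (fun y => w y 0) j) 0)
        (gridDual η T h Δ a c (bump x₂ (ρ₂ ^ 2)) N) := by
    refine mul_le_mul_of_nonneg_left ((b2.mul_left _).summable.tsum_le_tsum (fun j => ?_)
      (b2.mul_left _).summable) hΔ.le
    exact mul_le_mul_of_nonneg_right (le_max_left _ _) (n2 j)
  change _ ≤ meshPair Δ _ (gridDual η T h Δ a c (bump x₁ (ρ₁ ^ 2)) N) *
    meshPair Δ _ (gridDual η T h Δ a c (bump x₂ (ρ₂ ^ 2)) N) -
    meshPair Δ _ (gridDual η T h Δ a c (bump x₂ (ρ₂ ^ 2)) N) *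
    meshPair Δ _ (gridDual η T h Δ a c (bump x₁ (ρ₁ ^ 2)) N) at key
  change 0 ≤ meshPair Δ _ (gridDual η T h Δ a c (bump x₁ (ρ₁ ^ 2)) N) at p1
  have q1 : 0 < δ₁ * ρ₁ := by positivity
  have q2 : 0 < δ₂ * ρ₂ := by positivity
  have m1 := mul_le_mul_of_nonneg_left e2 hδ₁.le
  have m2 := mul_le_mul_of_nonneg_left e4 hδ₂.le
  have E1 : meshPair Δ (meshTrace Δ fun y => w y 0)
    (gridDual η T h Δ a c (bump x₁ (ρ₁ ^ 2)) N) < 0 := by linarith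
  have E2 : 0 < meshPair Δ (meshTrace Δ fun y => w y 0)
    (gridDual η T h Δ a c (bump x₂ (ρ₂ ^ 2)) N) := by linarith
  have t1 := mul_neg_of_neg_of_pos E1 (E2.trans_le p2)
  have t2 := mul_nonneg E2.le p1
  simp only [zero_mul] at key
  linarith

end

theorem false_of_pow_bound {s₀ e D : ℝ} (hs₀ : 0 < s₀) (he : 0 < e) (hD : 0 ≤ D)
    (h : ∀ s, 0 < s → s ≤ s₀ → e * s ^ 5 ≤ D * s ^ 6) : False := by
  set s := min s₀ (e / (D + 1)) with hs
  have s0 : 0 < s := by positivity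
  have h1 := h s s0 (min_le_left _ _)
  have h2 : s * (D + 1) ≤ e := by
    rw [← le_div_iff₀ (by linarith)]; exact min_le_right _ _
  have h3 : e ≤ D * s := by
    have : e * s ^ 5 ≤ D * s * s ^ 5 := by linarith
    exact le_of_mul_le_mul_right this (by positivity)
  linarith

section
variable {T M K L : ℝ} {w v γ a c : ℝ → ℝ → ℝ}

theorem LinSol.touch_upper (S : LinSol T M K L w v γ a c) {x₀ d C ϱ s : ℝ} (hϱ : 0 < ϱ) (hs : 0 < s)
    (hC0 : 0 ≤ C) (hϱd : 2 * √ϱ < d)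
    (hC : ∀ x, |x - x₀| < d → w x T ≤ C * (x - x₀) ^ 2) :
    FineMesh T K L fun η Δ h N =>
      meshPair Δ (meshTrace Δ fun y => w y 0) (gridDual η T h Δ a c (bump x₀ ϱ) N) ≤
        12 * C * ϱ * √ϱ + s := by
  have hs0 : 0 < √ϱ := Real.sqrt_pos.2 hϱ
  refine ((S.fine_duality (testProfile_bump hϱ x₀) hs).and (fineMesh_lt hs0)).mono
    fun η Δ h N hη hη1 H hN ⟨h1, h2⟩ => ?_
  have hΔ := H.mesh_pos
  have e1 := meshPair_bump_le (C := C * (4 * ϱ)) (x₀ := x₀) hΔ hϱ S.slice fun x hx => by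
    refine (hC x (by linarith)).trans (mul_le_mul_of_nonneg_left ?_ hC0)
    rw [← sq_abs]
    calc |x - x₀| ^ 2 ≤ (2 * √ϱ) ^ 2 := pow_le_pow_left₀ (abs_nonneg _) (by linarith) 2
      _ = 4 * ϱ := by rw [mul_pow, Real.sq_sqrt hϱ.le]; norm_num
  change meshPair Δ (meshTrace Δ fun y => w y T) _ ≤ _ at e1
  have e2 := mul_le_mul_of_nonneg_left (bump_mass_le (x₀ := x₀) hΔ hϱ h2.le)
    (by positivity : 0 ≤ C * (4 * ϱ))
  linarith [(abs_le.1 h1).1]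

theorem LinSol.le_meshTrace_of_ball (S : LinSol T M K L w v γ a c) {z ρ γ₀ Δ : ℝ}
    (hΔ : 0 < Δ) (hΔρ : Δ ≤ ρ) (hz : ∀ x, |x - z| ≤ 2 * ρ → γ₀ ≤ w x 0) {j : ℤ}
    (hj : j ∈ meshBall Δ z ρ) : γ₀ ≤ meshTrace Δ (fun y => w y 0) j :=
  le_hatAvg hΔ S.int_zero fun y hy => hz y (by
    have := (mem_meshBall hΔ).1 hj
    have := abs_add_le (y - j * Δ) (j * Δ - z)
    rw [sub_add_sub_cancel] at this
    linarith)

theorem LinSol.meshTrace_le_of_ball (S : LinSol T M K L w v γ a c) {z ρ γ₀ Δ : ℝ}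
    (hΔ : 0 < Δ) (hΔρ : Δ ≤ ρ) (hz : ∀ x, |x - z| ≤ 2 * ρ → w x 0 ≤ γ₀) {j : ℤ}
    (hj : j ∈ meshBall Δ z ρ) : meshTrace Δ (fun y => w y 0) j ≤ γ₀ :=
  hatAvg_le hΔ S.int_zero fun y hy => hz y (by
    have := (mem_meshBall hΔ).1 hj
    have := abs_add_le (y - j * Δ) (j * Δ - z)
    rw [sub_add_sub_cancel] at this
    linarith)

/-- A nonnegative solution with positive initial values somewhere cannot touch zero to second
order at a point joined to them by a tube of positive diffusivity. -/
theorem LinSol.no_touch_of_nonneg (S : LinSol T M K L w v γ a c) (h0 : ∀ x, 0 ≤ w x 0)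
    {x₀ z τe d αlo A C γ₀ ρ₀ : ℝ} (he0 : 0 < τe) (heT : τe ≤ T) (hd : 0 < d) (hαlo : 0 < αlo)
    (hA : 0 < A) (hC0 : 0 ≤ C) (hγ₀ : 0 < γ₀) (hρ₀ : 0 < ρ₀)
    (htube : ∀ τb, 0 < τb → τb < τe → ∀ τ ∈ Ico 0 T, ∀ x, |x - barrierCentre x₀ z τb τe τ| < d →
      αlo ≤ a x (T - τ))
    (hnear : ∀ τ ∈ Ico 0 τe, ∀ x, |x - x₀| < d →
      3 / 5 * A ≤ a x (T - τ) ∧ a x (T - τ) ≤ 9 / 5 * A)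
    (hz : ∀ x, |x - z| ≤ ρ₀ → γ₀ ≤ w x 0)
    (hC : ∀ x, |x - x₀| < d → w x T ≤ C * (x - x₀) ^ 2) : False := by
  obtain ⟨τb, hτb, hτb', ω, hω, k, hk, ρ, hρ, s₀, hs₀, hF⟩ := exists_sharp_barrier he0 heT hd
    S.L_nonneg S.one_le S.a_le hαlo hA htube hnear
  set r := min ρ₀ ρ / 2 with hr
  have hr0 : 0 < r := by positivity
  have r1 : 2 * r ≤ ρ₀ := by rw [hr]; linarith [min_le_left ρ₀ ρ]
  have r2 : 2 * r ≤ ρ := by rw [hr]; linarith [min_le_right ρ₀ ρ]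
  set s₁ := min s₀ (min 1 (d / (3 * (√ω + 1)))) with hs₁
  have hω' : 0 < √ω := Real.sqrt_pos.2 hω
  refine false_of_pow_bound (s₀ := s₁) (e := γ₀ * (k / 2) * r) (D := 12 * C * ω * √ω + 1)
    (by positivity) (by positivity) (by positivity) fun s hs hss => ?_
  obtain ⟨F, D, hFl, -⟩ := hF s hs (hss.trans (min_le_left _ _))
  have hs1 : s ≤ 1 := hss.trans ((min_le_right _ _).trans (min_le_left _ _))
  have hs2 : s * (3 * (√ω + 1)) ≤ d := by
    rw [← le_div_iff₀ (by positivity)]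
    exact hss.trans ((min_le_right _ _).trans (min_le_right _ _))
  have hϱ : 0 < ω * s ^ 4 := by positivity
  have hsq : √(ω * s ^ 4) = √ω * s ^ 2 := by
    rw [Real.sqrt_mul hω.le, show s ^ 4 = (s ^ 2) ^ 2 by ring, Real.sqrt_sq (by positivity)]
  have hsd : 2 * √(ω * s ^ 4) < d := by
    rw [hsq]
    have : √ω * s ^ 2 ≤ √ω * s := mul_le_mul_of_nonneg_left (by nlinarith) hω'.le
    nlinarith
  refine FineMesh.of_const S.T_pos S.one_le S.L_nonneg
    (((S.touch_upper hϱ (pow_pos hs 6) hC0 hsd hC).and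
    ((S.fine_lower D (by positivity) (ε := k * s ^ 5 / 2) (by positivity)).and (fineMesh_lt hr0))).mono
      fun η Δ h N hη hη1 H hN ⟨h1, h2, h3⟩ => ?_)
  have hΔ := H.mesh_pos
  have e2 := meshPair_ge_card (γ := γ₀) (μ := k / 2 * s ^ 5) (W := meshTrace Δ fun y => w y 0)
    (Ψ := gridDual η T h Δ a c (bump x₀ (ω * s ^ 4)) N) (A := meshBall Δ z r) hΔ.le (by positivity)
    (dualScheme_bddSupp ((testProfile_bump hϱ x₀).bddSupp hΔ) N)
    (fun j => le_hatAvg hΔ S.int_zero fun y _ => h0 y)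
    (dualScheme_nonneg H (S.boundedCoeff hη hη1 h Δ) (fun j => bump_nonneg _ _ _) N)
    (fun j hj => S.le_meshTrace_of_ball hΔ h3.le (fun x hx => hz x (hx.trans r1)) hj)
    (fun j hj => by
      have := hFl (j * Δ) (((mem_meshBall hΔ).1 hj).trans (by linarith))
      linarith [h2 j])
  have e3 := mul_le_mul_of_nonneg_left (le_mul_card_meshBall (z := z) hΔ h3.le)
    (by positivity : 0 ≤ γ₀ * (k / 2 * s ^ 5))
  rw [hsq] at h1
  calc _ = γ₀ * (k / 2 * s ^ 5) * r := by ring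
    _ ≤ _ := e3.trans (e2.trans h1)
    _ = _ := by ring

set_option maxHeartbeats 800000 in
/-- A solution which is nonnegative at the final time and whose initial values change sign from plus
to minus cannot touch zero to second order. -/
theorem LinSol.no_touch_of_pattern (S : LinSol T M K L w v γ a c) (hl : ∀ x ≤ 0, 0 ≤ w x 0)
    (hr : ∀ x > 0, w x 0 ≤ 0) (hT0 : ∀ x, 0 ≤ w x T)
    {x₀ x₂ z₁ z₂ τe d αlo A C γ₀ ρ₀ : ℝ} (he0 : 0 < τe) (heT : τe ≤ T) (hd : 0 < d) (hαlo : 0 < αlo)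
    (hA : 0 < A) (hC0 : 0 ≤ C) (hγ₀ : 0 < γ₀) (hρ₀ : 0 < ρ₀)
    (htube : ∀ τb, 0 < τb → τb < τe → ∀ τ ∈ Ico 0 T, ∀ x, |x - barrierCentre x₀ z₁ τb τe τ| < d →
      αlo ≤ a x (T - τ))
    (htube' : ∀ τb, 0 < τb → τb < τe → ∀ τ ∈ Ico 0 T, ∀ x, |x - barrierCentre x₂ z₂ τb τe τ| < d →
      αlo ≤ a x (T - τ))
    (hx : 3 * d ≤ x₂ - x₀) (hz : 3 * d ≤ z₂ - z₁)
    (hnear : ∀ τ ∈ Ico 0 τe, ∀ x, |x - x₀| < d →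
      3 / 5 * A ≤ a x (T - τ) ∧ a x (T - τ) ≤ 9 / 5 * A)
    (hz₁ : ∀ x, |x - z₁| ≤ ρ₀ → γ₀ ≤ w x 0) (hz₁' : z₁ + ρ₀ < 0)
    (hz₂ : ∀ x, |x - z₂| ≤ ρ₀ → w x 0 ≤ -γ₀) (hz₂' : ρ₀ < z₂)
    (hC : ∀ x, |x - x₀| < d → w x T ≤ C * (x - x₀) ^ 2) : False := by
  obtain ⟨τb, hτb, hτb', ω, hω, k, hk, ρ, hρ, s₀, hs₀, hF⟩ := exists_sharp_barrier he0 heT hd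
    S.L_nonneg S.one_le S.a_le hαlo hA htube hnear
  obtain ⟨ϱ₂, hϱ₂, k₂, hk₂, ρ₂, hρ₂, G, hϱd, D₂, hG, hGs⟩ := exists_coarse_barrier hτb' hτb.le heT hd
    S.L_nonneg S.one_le (le_refl 1) S.a_le hαlo (htube' τb hτb hτb')
  have hs₂ : √ϱ₂ ≤ d := by rw [← Real.sqrt_sq hd.le]; exact Real.sqrt_le_sqrt hϱd
  set r := min ρ₀ (min ρ ρ₂) / 2 with hrdef
  have hr0 : 0 < r := by positivity
  have r1 : 2 * r ≤ ρ₀ := by rw [hrdef]; linarith [min_le_left ρ₀ (min ρ ρ₂)]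
  have r' : 2 * r ≤ min ρ ρ₂ := by rw [hrdef]; linarith [min_le_right ρ₀ (min ρ ρ₂)]
  have r2 : 2 * r ≤ ρ := r'.trans (min_le_left _ _)
  have r3 : 2 * r ≤ ρ₂ := r'.trans (min_le_right _ _)
  set s₁ := min s₀ (min 1 (d / (3 * (√ω + 1)))) with hs₁
  have hω' : 0 < √ω := Real.sqrt_pos.2 hω
  set R := |x₀| + |x₂| + d with hR
  have hM := S.bound_nonneg
  set Pm := 4 * (M * (Real.exp (T * (8 * K + L)) * Real.exp (2 * R))) with hPm
  have hPm0 : 0 ≤ Pm := by positivity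
  refine false_of_pow_bound (s₀ := s₁) (e := γ₀ * γ₀ * (k * k₂ / 2) * (r * r))
    (D := (12 * C * ω * √ω + 1) * Pm + Pm)
    (by positivity) (by positivity) (by positivity) fun s hs hss => ?_
  obtain ⟨F, D, hFl, hFs⟩ := hF s hs (hss.trans (min_le_left _ _))
  have hs1 : s ≤ 1 := hss.trans ((min_le_right _ _).trans (min_le_left _ _))
  have hs2 : s * (3 * (√ω + 1)) ≤ d := by
    rw [← le_div_iff₀ (by positivity)]
    exact hss.trans ((min_le_right _ _).trans (min_le_right _ _))
  have hϱ : 0 < ω * s ^ 4 := by positivity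
  have hsq : √(ω * s ^ 4) = √ω * s ^ 2 := by
    rw [Real.sqrt_mul hω.le, show s ^ 4 = (s ^ 2) ^ 2 by ring, Real.sqrt_sq (by positivity)]
  have hsd : 2 * √(ω * s ^ 4) < d := by
    rw [hsq]
    have : √ω * s ^ 2 ≤ √ω * s := mul_le_mul_of_nonneg_left (by nlinarith) hω'.le
    nlinarith
  have hsep : ∀ τ ∈ Icc 0 T, ∀ x y, y ≤ x + d → F x τ * G y τ = 0 := fun τ hτ x y hxy => by
    by_contra hne
    have h1 := hFs x τ hτ (left_ne_zero_of_mul hne)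
    have h2 := hGs y τ hτ (right_ne_zero_of_mul hne)
    unfold barrierCentre at h1 h2
    set θ := Real.smoothTransition ((τ - τb) / (τe - τb))
    have θ0 : 0 ≤ θ := Real.smoothTransition.nonneg _
    have θ1 : θ ≤ 1 := Real.smoothTransition.le_one _
    have g1 := (abs_lt.1 h1).2
    have g2 := (abs_lt.1 h2).1
    have g3 := mul_le_mul_of_nonneg_right hx (sub_nonneg.2 θ1)
    have g4 := mul_le_mul_of_nonneg_right hz θ0
    linarith
  have hs6 : 0 < s ^ 6 := by positivity
  refine FineMesh.of_const S.T_pos S.one_le S.L_nonneg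
    ((((S.touch_upper hϱ hs6 hC0 hsd hC).and
    (S.fine_duality (testProfile_bump hϱ₂ x₂) hs6)).and
    ((S.fine_minor D D₂ (by positivity) one_pos (ε := k * k₂ * s ^ 5 / 2) (by positivity) hd hsep).and
      (fineMesh_lt hr0))).mono
      fun η Δ h N hη hη1 H hN ⟨⟨h1, h2⟩, h3, h4⟩ => ?_)
  have hΔ := H.mesh_pos
  obtain ⟨J, hJ0, hJ1, hJ, hJ'⟩ := S.sign_pattern hl hr hΔ
  have hb := S.boundedCoeff hη hη1 h Δ
  have t1 := (testProfile_bump hϱ x₀).bddSupp hΔ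
  have t2 := (testProfile_bump hϱ₂ x₂).bddSupp hΔ
  set Ψ₁ := gridDual η T h Δ a c (bump x₀ (ω * s ^ 4)) N with hΨ₁
  set Ψ₂ := gridDual η T h Δ a c (bump x₂ ϱ₂) N with hΨ₂
  set W := meshTrace Δ fun y => w y 0 with hW
  have b1 : BddSupp Ψ₁ := dualScheme_bddSupp t1 N
  have b2 : BddSupp Ψ₂ := dualScheme_bddSupp t2 N
  have n1 : ∀ j, 0 ≤ Ψ₁ j := dualScheme_nonneg H hb (fun j => bump_nonneg _ _ _) N
  have n2 : ∀ j, 0 ≤ Ψ₂ j := dualScheme_nonneg H hb (fun j => bump_nonneg _ _ _) N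
  have key := meshPair_minor (Δ := Δ) (γ₁ := γ₀) (γ₂ := γ₀) (μ := k * k₂ / 2 * s ^ 5)
    (A := meshBall Δ z₁ r) (B := meshBall Δ z₂ r) (by positivity) hγ₀.le b1 b2
    (fun i j hij => (h3 i j hij).1) hJ hJ'
    (fun i hi => ⟨by
      have := (abs_le.1 ((mem_meshBall hΔ).1 hi)).2
      have h0 : (i:ℝ) * Δ < 0 := by linarith
      have h0 : (i:ℝ) < 0 := by
        by_contra hcon
        push Not at hcon
        exact absurd h0 (not_lt.2 (by positivity))
      exact (by exact_mod_cast h0 : i < 0).trans_le hJ0,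
      S.le_meshTrace_of_ball hΔ h4.le (fun x hx => hz₁ x (hx.trans r1)) hi⟩)
    (fun j hj => ⟨by
      have := (abs_le.1 ((mem_meshBall hΔ).1 hj)).1
      have h0 : 0 < (j:ℝ) * Δ := by linarith
      have h0 : (0:ℝ) < j := pos_of_mul_pos_left h0 hΔ.le
      have : 0 < j := by exact_mod_cast h0
      omega,
      S.meshTrace_le_of_ball hΔ h4.le (fun x hx => hz₂ x (hx.trans r1)) hj⟩)
    (fun i hi j hj => by
      have hi := (mem_meshBall hΔ).1 hi
      have hj := (mem_meshBall hΔ).1 hj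
      have hij : i < j := by
        have h1 := (abs_le.1 hi).2
        have h2 := (abs_le.1 hj).1
        have : (i:ℝ) * Δ < j * Δ := by linarith
        exact_mod_cast lt_of_mul_lt_mul_right this hΔ.le
      have f1 := hFl (i * Δ) (by linarith)
      have f2 := hG (j * Δ) (by linarith)
      have := mul_le_mul f1 f2 hk₂.le ((by positivity : 0 ≤ k * s ^ 5).trans f1)
      linarith [(h3 i j hij).2])
  have p1 : 0 ≤ meshPair Δ (fun j => max (W j) 0) Ψ₁ :=
    meshPair_nonneg hΔ.le (fun j => le_max_right _ _) n1
  have p2 : 0 ≤ meshPair Δ (fun j => max (W j) 0) Ψ₂ :=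
    meshPair_nonneg hΔ.le (fun j => le_max_right _ _) n2
  have hWM : ∀ j, max (W j) 0 ≤ M := fun j => max_le (S.meshTrace_le hΔ j) hM
  have q1 : meshPair Δ (fun j => max (W j) 0) Ψ₁ ≤ Pm :=
    gridDual_mass_le H hb hN (bump_nonneg _ _) (bump_le_one hϱ _)
      (fun x hx => (testProfile_bump hϱ x₀).zero x (by linarith [abs_nonneg x₂])) t1 hWM hM
  have q2 : meshPair Δ (fun j => max (W j) 0) Ψ₂ ≤ Pm :=
    gridDual_mass_le H hb hN (bump_nonneg _ _) (bump_le_one hϱ₂ _)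
      (fun x hx => (testProfile_bump hϱ₂ x₂).zero x (by linarith [abs_nonneg x₀])) t2 hWM hM
  have e2 : 0 ≤ meshPair Δ (meshTrace Δ fun y => w y T) fun j => bump x₂ ϱ₂ (j * Δ) :=
    meshPair_nonneg hΔ.le (fun j => le_hatAvg hΔ (fun _ _ => S.slice.intervalIntegrable _ _)
      fun y _ => hT0 y) fun j => bump_nonneg _ _ _
  have E2 : -meshPair Δ W Ψ₂ ≤ s ^ 6 := by linarith [(abs_le.1 h2).2]
  have c1 := le_mul_card_meshBall (z := z₁) hΔ h4.le
  have c2 := le_mul_card_meshBall (z := z₂) hΔ h4.le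
  have e3 := mul_le_mul_of_nonneg_left (mul_le_mul c1 c2 hr0.le (hr0.le.trans c1))
    (by positivity : 0 ≤ γ₀ * γ₀ * (k * k₂ / 2 * s ^ 5))
  rw [hsq] at h1
  have u1 : meshPair Δ W Ψ₁ * meshPair Δ (fun j => max (W j) 0) Ψ₂ ≤
      (12 * C * ω * √ω + 1) * s ^ 6 * Pm := by
    refine (mul_le_mul_of_nonneg_right (h1.trans_eq ?_) p2).trans
      (mul_le_mul_of_nonneg_left q2 (by positivity))
    ring
  have u2 : -meshPair Δ W Ψ₂ * meshPair Δ (fun j => max (W j) 0) Ψ₁ ≤ s ^ 6 * Pm :=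
    (mul_le_mul_of_nonneg_right E2 p1).trans (mul_le_mul_of_nonneg_left q1 hs6.le)
  calc _ = γ₀ * γ₀ * (k * k₂ / 2 * s ^ 5) * (r * r) := by ring
    _ ≤ γ₀ * γ₀ * (k * k₂ / 2 * s ^ 5) * ((Δ * (meshBall Δ z₁ r).card) *
        (Δ * (meshBall Δ z₂ r).card)) := e3
    _ ≤ _ := key
    _ ≤ _ := by linarith

end

theorem exists_reaction {f : ℝ → ℝ → ℝ} {κ : ℝ → ℝ} (hf : ContDiff ℝ 2 (Function.uncurry f))
    (hκ : ContDiff ℝ 2 κ) (pf : ∀ x u, f (x + 1) u = f x u) (pκ : ∀ x, κ (x + 1) = κ x) (M : ℝ) :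
    ∃ Q L, 0 ≤ L ∧ Reaction M Q L fun x v => f x v * (κ x - v) := by
  set g : ℝ × ℝ → ℝ := Function.uncurry fun x v => f x v * (κ x - v) with hg
  have hgd : ContDiff ℝ 1 g := by
    have h2 : ContDiff ℝ 2 g :=
      hf.mul ((hκ.comp contDiff_fst).sub contDiff_snd)
    exact h2.of_le (by norm_num)
  have hK : IsCompact (Icc (0:ℝ) 1 ×ˢ Icc (0:ℝ) M) := isCompact_Icc.prod isCompact_Icc
  have hKc : Convex ℝ (Icc (0:ℝ) 1 ×ˢ Icc (0:ℝ) M) := (convex_Icc 0 1).prod (convex_Icc 0 M)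
  obtain ⟨Q, hQ⟩ := hK.exists_bound_of_continuousOn hgd.continuous.continuousOn
  obtain ⟨L, hL⟩ := hK.exists_bound_of_continuousOn
    (hgd.continuous_fderiv one_ne_zero).continuousOn
  have hfr : ∀ x v, f x v * (κ x - v) = g (Int.fract x, v) := fun x v => by
    have h1 : Function.Periodic (fun x => f x v * (κ x - v)) 1 := fun x => by
      simp only [pf, pκ]
    have := h1.sub_int_mul_eq (x := x) ⌊x⌋
    simp only [mul_one] at this
    exact this.symm
  have hmem : ∀ x, ∀ v ∈ Icc (0:ℝ) M, (Int.fract x, v) ∈ Icc (0:ℝ) 1 ×ˢ Icc (0:ℝ) M :=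
    fun x v hv => ⟨⟨Int.fract_nonneg x, (Int.fract_lt_one x).le⟩, hv⟩
  refine ⟨Q, max L 0, le_max_right _ _, hgd.continuous, fun x v hv => ?_, fun x v hv v' hv' => ?_⟩
  · rw [hfr]
    exact hQ _ (hmem x v hv)
  · simp only [hfr]
    have := hKc.norm_image_sub_le_of_norm_fderiv_le (f := g)
      (fun z _ => (hgd.differentiable one_ne_zero) z)
      (fun z hz => (hL z hz).trans (le_max_left L 0)) (hmem x v' hv') (hmem x v hv)
    have hn : ‖((Int.fract x, v) : ℝ × ℝ) - (Int.fract x, v')‖ = |v - v'| := by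
      simp [Prod.norm_def]
    rw [hn] at this
    exact this

/-- At a zero minimum, a function which is twice differentiable there is bounded above by a
parabola. -/
theorem exists_le_sq_of_touch {g : ℝ → ℝ} {x₀ : ℝ} (h0 : ∀ x, 0 ≤ g x) (hx₀ : g x₀ = 0)
    (hd : ∀ᶠ x in nhds x₀, DifferentiableAt ℝ g x) (hd2 : DifferentiableAt ℝ (deriv g) x₀) :
    ∃ C, 0 ≤ C ∧ ∃ δ > 0, ∀ x, |x - x₀| < δ → g x ≤ C * (x - x₀) ^ 2 := by
  have hmin : IsLocalMin g x₀ := Eventually.of_forall fun x => hx₀.trans_le (h0 x)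
  have hz : deriv g x₀ = 0 := hmin.deriv_eq_zero
  obtain ⟨C, hC⟩ := hd2.isBigO_sub.bound
  obtain ⟨δ, hδ, hb⟩ := Metric.eventually_nhds_iff.1 (hd.and hC)
  refine ⟨max C 0, le_max_right _ _, δ, hδ, fun x hx => ?_⟩
  have hball : ∀ z ∈ Metric.closedBall x₀ |x - x₀|, DifferentiableAt ℝ g z ∧
      ‖deriv g z‖ ≤ max C 0 * |x - x₀| := fun z hz' => by
    rw [Metric.mem_closedBall] at hz'
    obtain ⟨h1, h2⟩ := hb (hz'.trans_lt hx)
    refine ⟨h1, ?_⟩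
    rw [hz, sub_zero] at h2
    rw [Real.dist_eq] at hz'
    exact h2.trans (mul_le_mul (le_max_left _ _) hz' (norm_nonneg _) (le_max_right _ _))
  have := (convex_closedBall x₀ |x - x₀|).norm_image_sub_le_of_norm_deriv_le
    (fun z hz' => (hball z hz').1) (fun z hz' => (hball z hz').2)
    (Metric.mem_closedBall_self (abs_nonneg _)) (y := x) (by simp [Real.dist_eq])
  rw [hx₀, sub_zero, Real.norm_eq_abs, Real.norm_eq_abs] at this
  calc g x ≤ |g x| := le_abs_self _
    _ ≤ _ := this
    _ = max C 0 * (x - x₀) ^ 2 := by rw [← sq_abs (x - x₀)]; ring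

/-- A solution `U` on `[0, T]` of the porous medium equation with initial data `p` on the left and
zero on the right of the origin, positive exactly on the left of the interface `b`. -/
structure FrontSol (T M m Q L : ℝ) (q : ℝ → ℝ → ℝ) (p b : ℝ → ℝ) (U : ℝ → ℝ → ℝ) : Prop where
  one_lt : 1 < m
  L_nonneg : 0 ≤ L
  reaction : Reaction M Q L q
  periodic : ∀ x v, q (x + 1) v = q x v
  stationary : HatSol T M m q fun x _ => p x
  sol : HatSol T M m q U
  cont_profile : Continuous p
  profile_pos : ∀ x, 0 < p x
  profile_periodic : ∀ x, p (x + 1) = p x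
  init_left : ∀ x ≤ 0, U x 0 = p x
  init_right : ∀ x > 0, U x 0 = 0
  pos : ∀ t ∈ Ioc 0 T, ∀ x < b t, 0 < U x t
  zero : ∀ t ∈ Ioc 0 T, ∀ x, b t ≤ x → U x t = 0
  mono : StrictMonoOn b (Ioi 0)
  cont : ContinuousOn b (Ioi 0)

section
variable {T M m Q L : ℝ} {q : ℝ → ℝ → ℝ} {p b : ℝ → ℝ} {U : ℝ → ℝ → ℝ}

theorem FrontSol.restrict (F : FrontSol T M m Q L q p b U) {T' : ℝ} (h : T' ≤ T) :
    FrontSol T' M m Q L q p b U :=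
  { F with
    stationary := F.stationary.mono h
    sol := F.sol.mono h
    pos := fun t ht => F.pos t ⟨ht.1, ht.2.trans h⟩
    zero := fun t ht => F.zero t ⟨ht.1, ht.2.trans h⟩ }

theorem FrontSol.exists_profile_lower (F : FrontSol T M m Q L q p b U) :
    ∃ δ > 0, ∀ x, δ ≤ p x := by
  obtain ⟨δ, hδ, h⟩ := isCompact_Icc.exists_forall_le' (s := Icc (0:ℝ) 1)
    F.cont_profile.continuousOn (a := 0) fun x _ => F.profile_pos x
  refine ⟨δ, hδ, fun x => ?_⟩
  have h1 : Function.Periodic p 1 := F.profile_periodic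
  have h2 := h1.sub_int_mul_eq (x := x) ⌊x⌋
  rw [mul_one] at h2
  rw [← h2]
  exact h _ ⟨Int.fract_nonneg x, (Int.fract_lt_one x).le⟩

theorem FrontSol.linSol_profile (F : FrontSol T M m Q L q p b U) (hT : 0 < T) :
    LinSol T (2 * (M + M ^ m + Q)) (max 1 (m * M ^ (m - 1))) L (fun x t => p x - U x t)
      (fun x t => p x ^ m - U x t ^ m) (fun x t => q x (p x) - q x (U x t))
      (linDiff m T (fun x _ => p x) U) (linPot T q (fun x _ => p x) U) :=
  F.stationary.linSol hT F.one_lt F.L_nonneg F.reaction F.sol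

theorem FrontSol.init_le (F : FrontSol T M m Q L q p b U) (x : ℝ) : U x 0 ≤ p x := by
  rcases le_or_gt x 0 with h | h
  · exact (F.init_left x h).le
  · exact (F.init_right x h).trans_le (F.profile_pos x).le

theorem FrontSol.le_profile (F : FrontSol T M m Q L q p b U) {t : ℝ} (ht : t ∈ Ioc 0 T) (x : ℝ) :
    U x t ≤ p x :=
  sub_nonneg.1 (((F.restrict ht.2).linSol_profile ht.1).nonneg
    (fun y => sub_nonneg.2 (F.init_le y)) x)

theorem FrontSol.exists_lt_profile (F : FrontSol T M m Q L q p b U) {t : ℝ} (ht : t ∈ Ioc 0 T)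
    {α β : ℝ} (h : α < β) : ∃ z ∈ Ioo α β, U z t < p z := by
  by_contra hcon
  push Not at hcon
  obtain ⟨δ, hδ, hp⟩ := F.exists_profile_lower
  have G := F.restrict ht.2
  refine (G.linSol_profile ht.1).not_vanishing (fun y => sub_nonneg.2 (F.init_le y))
    (x₀ := (α + β) / 2) (z := 1) (d := (β - α) / 5) (αlo := δ ^ (m - 1)) (γ₀ := δ) (ρ₀ := 1 / 2)
    (by linarith) (Real.rpow_pos_of_pos hδ _) hδ (by norm_num)
    (fun τ hτ x _ => ?_) (fun x hx => ?_) (fun x hx => ?_)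
  · have hτ' : t - τ ∈ Ioc 0 t := ⟨by linarith [hτ.2], by linarith [hτ.1]⟩
    rw [linDiff, if_pos hτ']
    refine le_trans ?_ (powSlope_ge_max F.one_lt (F.profile_pos x).le
      (G.sol.mem x _ (Ioc_subset_Icc_self hτ')).1)
    exact Real.rpow_le_rpow hδ.le ((hp x).trans (le_max_left _ _)) (by linarith [F.one_lt])
  · have := (abs_le.1 hx).1
    rw [F.init_right x (by linarith), sub_zero]
    exact hp x
  · have := abs_le.1 hx
    exact sub_eq_zero.2 (le_antisymm (hcon x ⟨by linarith, by linarith⟩) (F.le_profile ht x))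

/-- The solution translated by one period in space and `s` in time. -/
def shifted (s : ℝ) (U : ℝ → ℝ → ℝ) (x t : ℝ) : ℝ := U (x + 1) (t + s)

theorem FrontSol.sol_shifted {s : ℝ} (F : FrontSol (T + s) M m Q L q p b U) (hT : 0 < T)
    (hs : 0 < s) : HatSol T M m q (shifted s U) :=
  F.sol.shift hT hs F.periodic

theorem FrontSol.linSol_shifted {s : ℝ} (F : FrontSol (T + s) M m Q L q p b U) (hT : 0 < T)
    (hs : 0 < s) :
    LinSol T (2 * (M + M ^ m + Q)) (max 1 (m * M ^ (m - 1))) L (fun x t => U x t - shifted s U x t)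
      (fun x t => U x t ^ m - shifted s U x t ^ m)
      (fun x t => q x (U x t) - q x (shifted s U x t))
      (linDiff m T U (shifted s U)) (linPot T q U (shifted s U)) :=
  (F.sol.mono (by linarith : T ≤ T + s)).linSol hT F.one_lt F.L_nonneg F.reaction
    (F.sol_shifted hT hs)

theorem shifted_zero {s x : ℝ} : shifted s U x 0 = U (x + 1) s := by
  rw [shifted, zero_add]

theorem FrontSol.shifted_init_left {s : ℝ} (F : FrontSol (T + s) M m Q L q p b U) (hT : 0 < T)
    (hs : 0 < s) : ∀ x ≤ 0, 0 ≤ U x 0 - shifted s U x 0 := fun x hx => by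
  rw [F.init_left x hx, shifted_zero, ← F.profile_periodic]
  exact sub_nonneg.2 (F.le_profile ⟨hs, by linarith⟩ _)

theorem FrontSol.shifted_init_right {s : ℝ} (F : FrontSol (T + s) M m Q L q p b U) (hT : 0 < T)
    (hs : 0 < s) : ∀ x > 0, U x 0 - shifted s U x 0 ≤ 0 := fun x hx => by
  rw [F.init_right x hx, shifted_zero, zero_sub, neg_nonpos]
  exact (F.sol.mem _ s ⟨hs.le, by linarith⟩).1

theorem FrontSol.shifted_le_of_lt {s : ℝ} (F : FrontSol (T + s) M m Q L q p b U) (hT : 0 < T)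
    (hs : 0 < s) (hb : b (T + s) < b T + 1) (x : ℝ) : U (x + 1) (T + s) ≤ U x T := by
  by_contra hlt
  push Not at hlt
  have hTs : T + s ∈ Ioc 0 (T + s) := ⟨by linarith, le_rfl⟩
  have hT' : T ∈ Ioc 0 (T + s) := ⟨hT, by linarith⟩
  have h0 : 0 ≤ U x T := (F.sol.mem x T (Ioc_subset_Icc_self hT')).1
  have hx : x + 1 < b (T + s) := by
    by_contra hcon
    rw [F.zero _ hTs _ (not_lt.1 hcon)] at hlt
    linarith
  obtain ⟨x₂, h1, h2⟩ := exists_between (by linarith : b (T + s) - 1 < b T)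
  have := (F.linSol_shifted hT hs).no_reversal (F.shifted_init_left hT hs)
    (F.shifted_init_right hT hs) (x₁ := x) (x₂ := x₂) (by linarith) (sub_neg.2 hlt)
  rw [shifted, F.zero _ hTs _ (by linarith : b (T + s) ≤ x₂ + 1), sub_zero] at this
  exact absurd (F.pos _ hT' x₂ h2) (not_lt.2 this)

theorem FrontSol.shifted_le {s : ℝ} (F : FrontSol (T + s) M m Q L q p b U) (hT : 0 < T)
    (hs : 0 < s) (hb : b (T + s) = b T + 1) (x : ℝ) : U (x + 1) (T + s) ≤ U x T := by
  have hc : ContinuousOn (fun t => U (x + 1) t) (Ioc 0 (T + s)) := continuousOn_time F.sol.cont _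
  have h1 : Tendsto (fun t => U (x + 1) t) (nhdsWithin (T + s) (Ioo T (T + s)))
      (nhds (U (x + 1) (T + s))) :=
    (hc (T + s) ⟨by linarith, le_rfl⟩).mono_left
      (nhdsWithin_mono _ fun t ht => ⟨hT.trans ht.1, ht.2.le⟩)
  have : (nhdsWithin (T + s) (Ioo T (T + s))).NeBot := right_nhdsWithin_Ioo_neBot (by linarith)
  refine le_of_tendsto h1 (eventually_nhdsWithin_of_forall fun t ht => ?_)
  obtain ⟨s', rfl⟩ : ∃ s', t = T + s' := ⟨t - T, by ring⟩
  have hs' : 0 < s' := by linarith [ht.1]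
  refine (F.restrict ht.2.le).shifted_le_of_lt hT hs' ?_ x
  rw [← hb]
  exact F.mono (mem_Ioi.2 (by linarith)) (mem_Ioi.2 (by linarith)) ht.2

end

section
variable {T M m Q L s : ℝ} {q : ℝ → ℝ → ℝ} {p b : ℝ → ℝ} {U : ℝ → ℝ → ℝ}

theorem barrierCentre_of_ge {x₀ z τb τe τ : ℝ} (h : τb < τe) (hτ : τe ≤ τ) :
    barrierCentre x₀ z τb τe τ = z := by
  have : 1 ≤ (τ - τb) / (τe - τb) := by
    rw [le_div_iff₀ (by linarith)]; linarith
  rw [barrierCentre, Real.smoothTransition.one_of_one_le this]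
  ring

theorem barrierCentre_le_max (x₀ z τb τe τ : ℝ) : barrierCentre x₀ z τb τe τ ≤ max x₀ z := by
  unfold barrierCentre
  set θ := Real.smoothTransition ((τ - τb) / (τe - τb))
  have θ0 : 0 ≤ θ := Real.smoothTransition.nonneg _
  have θ1 : θ ≤ 1 := Real.smoothTransition.le_one _
  have h1 := mul_le_mul_of_nonneg_right (le_max_left x₀ z) (sub_nonneg.2 θ1)
  have h2 := mul_le_mul_of_nonneg_right (le_max_right x₀ z) θ0
  linarith

theorem FrontSol.exists_lower_rect (F : FrontSol T M m Q L q p b U) {R R' t₁ t₂ : ℝ} (h0 : 0 < t₁)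
    (h2 : t₂ ≤ T) (hR : ∀ t ∈ Icc t₁ t₂, R' < b t) :
    ∃ δ > 0, ∀ x ∈ Icc R R', ∀ t ∈ Icc t₁ t₂, δ ≤ U x t := by
  obtain ⟨δ, hδ, h⟩ := (isCompact_Icc.prod isCompact_Icc).exists_forall_le'
    (s := Icc R R' ×ˢ Icc t₁ t₂) (f := fun q : ℝ × ℝ => U q.1 q.2) (a := 0)
    (F.sol.cont.mono fun q hq => ⟨mem_univ _, h0.trans_le hq.2.1, hq.2.2.trans h2⟩)
    fun q hq => F.pos _ ⟨h0.trans_le hq.2.1, hq.2.2.trans h2⟩ _ (hq.1.2.trans_lt (hR _ hq.2))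
  exact ⟨δ, hδ, fun x hx t ht => h (x, t) ⟨hx, ht⟩⟩

/-- The diffusion coefficient is bounded below on a tube which leaves `x₀` at the final time and
ends at a point `z` where the translated solution is initially positive. -/
theorem FrontSol.exists_tube (F : FrontSol (T + s) M m Q L q p b U) (hT : 0 < T) (hs : 0 < s)
    {x₀ z : ℝ} (hx₀ : x₀ + 1 < b (T + s)) (hz : z + 1 < b s) :
    ∃ d₀ > 0, ∃ e₀ > 0, ∃ αlo > 0, ∀ τb τe d, τb < τe → τe ≤ e₀ → d ≤ d₀ → ∀ τ ∈ Ico 0 T, ∀ x,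
      |x - barrierCentre x₀ z τb τe τ| < d → αlo ≤ linDiff m T U (shifted s U) x (T - τ) := by
  have hTs : 0 < T + s := by linarith
  have hmono : ∀ t ∈ Icc s (T + s), b s ≤ b t := fun t ht =>
    F.mono.monotoneOn (mem_Ioi.2 hs) (mem_Ioi.2 (hs.trans_le ht.1)) ht.1
  set X := max x₀ z with hX
  have hXb : X + 1 < b (T + s) := by
    exact lt_sub_iff_add_lt.1 (max_lt (lt_sub_iff_add_lt.2 hx₀)
      (lt_sub_iff_add_lt.2 (hz.trans_le (hmono _ ⟨by linarith, le_rfl⟩))))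
  obtain ⟨d₁, hd₁, hd₁'⟩ : ∃ d₁ > 0, X + 1 + d₁ < b (T + s) :=
    ⟨(b (T + s) - (X + 1)) / 2, by linarith, by linarith⟩
  obtain ⟨d₂, hd₂, hd₂'⟩ : ∃ d₂ > 0, z + 1 + d₂ < b s :=
    ⟨(b s - (z + 1)) / 2, by linarith, by linarith⟩
  have hcb : ContinuousAt b (T + s) := F.cont.continuousAt (Ioi_mem_nhds hTs)
  obtain ⟨e₁, he₁, hbe⟩ := Metric.eventually_nhds_iff.1 (hcb.eventually_const_lt hd₁')
  set e₀ := min (e₁ / 2) T with he₀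
  have he0 : 0 < e₀ := by positivity
  have e1 : e₀ ≤ e₁ / 2 := min_le_left _ _
  have e2 : e₀ ≤ T := min_le_right _ _
  set R := -(|x₀| + |z| + min d₁ d₂) with hR
  obtain ⟨δ₁, hδ₁, h1⟩ := F.exists_lower_rect (R := R) (R' := X + 1 + d₁) (t₁ := T + s - e₀)
    (t₂ := T + s) (by linarith) le_rfl fun t ht => hbe (by
      rw [Real.dist_eq, abs_lt]; constructor <;> linarith [ht.1, ht.2])
  obtain ⟨δ₂, hδ₂, h2⟩ := F.exists_lower_rect (R := R) (R' := z + 1 + d₂) (t₁ := s)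
    (t₂ := T + s) hs le_rfl fun t ht => hd₂'.trans_le (hmono t ht)
  refine ⟨min d₁ d₂, by positivity, e₀, he0, min δ₁ δ₂ ^ (m - 1),
    Real.rpow_pos_of_pos (by positivity) _, fun τb τe d hb he hd τ hτ x hx => ?_⟩
  have hτ' : T - τ ∈ Ioc 0 T := ⟨by linarith [hτ.2], by linarith [hτ.1]⟩
  have hτ'' := Ioc_subset_Icc_self hτ'
  rw [linDiff, if_pos hτ']
  refine le_trans ?_ (powSlope_ge_max F.one_lt
    (F.sol.mem x _ ⟨hτ''.1, by linarith [hτ''.2]⟩).1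
    ((F.sol_shifted hT hs).mem x _ hτ'').1)
  refine Real.rpow_le_rpow (by positivity) (le_trans ?_ (le_max_right _ _)) (by linarith [F.one_lt])
  have hx := abs_lt.1 hx
  have hc := (abs_le.1 (abs_barrierCentre_le x₀ z τb τe τ)).1
  have hR1 : R ≤ x + 1 := by linarith
  rw [shifted]
  rcases lt_or_ge τ τe with h | h
  · have := barrierCentre_le_max x₀ z τb τe τ
    exact (min_le_left _ _).trans (h1 _ ⟨hR1, by linarith [min_le_left d₁ d₂]⟩ _
      ⟨by linarith, by linarith [hτ.1]⟩)
  · rw [barrierCentre_of_ge hb h] at hx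
    exact (min_le_right _ _).trans (h2 _ ⟨hR1, by linarith [min_le_right d₁ d₂]⟩ _
      ⟨by linarith [hτ.2], by linarith [hτ.1]⟩)

/-- Near a positive touching point the diffusion coefficient is nearly constant. -/
theorem HatSol.exists_near {V : ℝ → ℝ → ℝ} (hU : HatSol T M m q U) (hV : HatSol T M m q V)
    (hm : 1 < m) (hT : 0 < T) {x₀ : ℝ} (hpos : 0 < U x₀ T) (heq : V x₀ T = U x₀ T) :
    ∃ A > 0, ∃ ε > 0, ∀ τ ∈ Ico 0 ε, τ < T → ∀ x, |x - x₀| < ε →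
      3 / 5 * A ≤ linDiff m T U V x (T - τ) ∧ linDiff m T U V x (T - τ) ≤ 9 / 5 * A := by
  have hA : 0 < m * U x₀ T ^ (m - 1) := mul_pos (by linarith) (Real.rpow_pos_of_pos hpos _)
  set A := m * U x₀ T ^ (m - 1) with hAdef
  set D : Set (ℝ × ℝ) := univ ×ˢ Ioc 0 T with hD
  have hmem : (x₀, T) ∈ D := ⟨mem_univ _, hT, le_rfl⟩
  have c1 : ContinuousOn (fun q : ℝ × ℝ => m * min (U q.1 q.2) (V q.1 q.2) ^ (m - 1)) D :=
    continuousOn_const.mul ((ContinuousOn.inf hU.cont hV.cont).rpow_const fun _ _ => Or.inr (by linarith))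
  have c2 : ContinuousOn (fun q : ℝ × ℝ => m * max (U q.1 q.2) (V q.1 q.2) ^ (m - 1)) D :=
    continuousOn_const.mul ((ContinuousOn.sup hU.cont hV.cont).rpow_const fun _ _ => Or.inr (by linarith))
  have l1 := (c1 _ hmem).eventually_const_lt (u := 3 / 5 * A) (by
    simp only [heq, min_self]; linarith)
  have l2 := (c2 _ hmem).eventually_lt_const (u := 9 / 5 * A) (by
    simp only [heq, max_self]; linarith)
  obtain ⟨ε, hε, h⟩ := Metric.eventually_nhds_iff.1 (eventually_nhdsWithin_iff.1 (l1.and l2))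
  refine ⟨A, hA, ε, hε, fun τ hτ hτT x hx => ?_⟩
  have hτ' : T - τ ∈ Ioc 0 T := ⟨by linarith, by linarith [hτ.1]⟩
  have hτ'' := Ioc_subset_Icc_self hτ'
  have hd : dist (x, T - τ) (x₀, T) < ε := by
    rw [Prod.dist_eq]
    refine max_lt hx ?_
    rw [Real.dist_eq, abs_lt]
    constructor <;> linarith [hτ.1, hτ.2]
  obtain ⟨g1, g2⟩ := h hd ⟨mem_univ _, hτ'⟩
  have n1 := (hU.mem x _ hτ'').1
  have n2 := (hV.mem x _ hτ'').1
  rw [linDiff, if_pos hτ']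
  exact ⟨g1.le.trans (powSlope_ge_min hm n1 n2), (powSlope_le_max hm n1 n2).trans g2.le⟩

theorem FrontSol.continuous_slice (F : FrontSol T M m Q L q p b U) {t : ℝ} (ht : t ∈ Ioc 0 T) :
    Continuous fun x => U x t :=
  _root_.continuous_slice F.sol.cont ht

/-- When the interface has advanced by exactly one period, the translated profile cannot touch
the earlier profile to second order. -/
theorem FrontSol.no_touch (F : FrontSol (T + s) M m Q L q p b U) (hT : 0 < T) (hs : 0 < s)
    (hb : b (T + s) = b T + 1) {x₀ C r : ℝ} (hx₀ : x₀ < b T) (heq : U (x₀ + 1) (T + s) = U x₀ T)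
    (hC0 : 0 ≤ C) (hr : 0 < r)
    (hC : ∀ x, |x - x₀| < r → U x T - U (x + 1) (T + s) ≤ C * (x - x₀) ^ 2) : False := by
  have S := F.linSol_shifted hT hs
  have hT' : T ∈ Ioc 0 (T + s) := ⟨hT, by linarith⟩
  have hs' : s ∈ Ioc 0 (T + s) := ⟨hs, by linarith⟩
  have hg : Continuous fun x => U (x + 1) s := (F.continuous_slice hs').comp (continuous_add_const 1)
  obtain ⟨A, hA, ε, hε, hnear⟩ := (F.sol.mono (by linarith : T ≤ T + s)).exists_near
    (F.sol_shifted hT hs) F.one_lt hT (F.pos T hT' x₀ hx₀) heq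
  obtain ⟨z₁', ⟨hz₁a, hz₁b⟩, hz₁c⟩ := F.exists_lt_profile hs'
    (sub_one_lt (min 1 (b s)))
  obtain ⟨z₁, rfl⟩ : ∃ z₁, z₁' = z₁ + 1 := ⟨z₁' - 1, by ring⟩
  have hz₁0 : z₁ < 0 := by linarith [min_le_left 1 (b s)]
  have hz₁s : z₁ + 1 < b s := by linarith [min_le_right 1 (b s)]
  rw [F.profile_periodic] at hz₁c
  obtain ⟨ρ₁, hρ₁, hρ₁', γ₁, hγ₁, h₁⟩ := exists_pos_radius (F.cont_profile.sub hg) (x₀ := z₁)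
    (sub_pos.2 hz₁c) (r := -z₁ / 2) (by linarith)
  have hw₁ : ∀ x, |x - z₁| ≤ ρ₁ → γ₁ ≤ U x 0 - shifted s U x 0 := fun x hx => by
    have := abs_le.1 hx
    rw [F.init_left x (by linarith), shifted_zero]
    exact h₁ x (by linarith)
  obtain ⟨d₁, hd₁, e₁, he₁, α₁, hα₁, t₁⟩ := F.exists_tube hT hs (x₀ := x₀) (by linarith) hz₁s
  rcases le_or_gt (b s) 1 with h1 | h1
  · set d := min (min d₁ ε) r with hd
    set τe := min (min e₁ ε) T with hτe
    have d1 : d ≤ d₁ := (min_le_left _ _).trans (min_le_left _ _)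
    have d2 : d ≤ ε := (min_le_left _ _).trans (min_le_right _ _)
    have d3 : d ≤ r := min_le_right _ _
    have f1 : τe ≤ e₁ := (min_le_left _ _).trans (min_le_left _ _)
    have f2 : τe ≤ ε := (min_le_left _ _).trans (min_le_right _ _)
    have f3 : τe ≤ T := min_le_right _ _
    exact S.no_touch_of_nonneg (fun x => by
        rcases le_or_gt x 0 with hx | hx
        · exact F.shifted_init_left hT hs x hx
        · rw [F.init_right x hx, shifted_zero, F.zero s hs' _ (by linarith), sub_zero])
      (x₀ := x₀) (z := z₁) (τe := τe) (d := d) (by positivity) f3 (by positivity) hα₁ hA hC0 hγ₁ hρ₁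
      (fun τb _ hb' => t₁ τb τe d hb' f1 d1)
      (fun τ hτ x hx => hnear τ ⟨hτ.1, hτ.2.trans_le f2⟩ (hτ.2.trans_le f3) x (hx.trans_le d2))
      hw₁ (fun x hx => hC x (hx.trans_le d3))
  · obtain ⟨z₂, hz₂0, hz₂s⟩ := exists_between (by linarith : 0 < b s - 1)
    obtain ⟨x₂, hx₂0, hx₂T⟩ := exists_between hx₀
    obtain ⟨ρ₂, hρ₂, hρ₂', γ₂, hγ₂, h₂⟩ := exists_pos_radius hg (x₀ := z₂)
      (F.pos s hs' _ (by linarith)) (r := z₂ / 2) (by linarith)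
    have hw₂ : ∀ x, |x - z₂| ≤ ρ₂ → U x 0 - shifted s U x 0 ≤ -γ₂ := fun x hx => by
      have := abs_le.1 hx
      rw [F.init_right x (by linarith), shifted_zero]
      linarith [h₂ x (by linarith)]
    obtain ⟨d₂, hd₂, e₂, he₂, α₂, hα₂, t₂⟩ := F.exists_tube hT hs (x₀ := x₂) (z := z₂) (by linarith)
      (by linarith)
    have hx2 : 0 < (x₂ - x₀) / 3 := by linarith
    have hz2 : 0 < (z₂ - z₁) / 3 := by linarith
    obtain ⟨d, hd, d1, d2, d3, d4, d5, d6⟩ : ∃ d > 0, d ≤ d₁ ∧ d ≤ d₂ ∧ d ≤ ε ∧ d ≤ r ∧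
        d ≤ (x₂ - x₀) / 3 ∧ d ≤ (z₂ - z₁) / 3 :=
      ⟨min d₁ (min d₂ (min ε (min r (min ((x₂ - x₀) / 3) ((z₂ - z₁) / 3))))), by positivity,
        by simp, by simp, by simp, by simp, by simp, by simp⟩
    obtain ⟨τe, hτe, f1, f2, f3, f4⟩ : ∃ τe > 0, τe ≤ e₁ ∧ τe ≤ e₂ ∧ τe ≤ ε ∧ τe ≤ T :=
      ⟨min e₁ (min e₂ (min ε T)), by positivity, by simp, by simp, by simp, by simp⟩
    exact S.no_touch_of_pattern (F.shifted_init_left hT hs) (F.shifted_init_right hT hs)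
      (fun x => sub_nonneg.2 (F.shifted_le hT hs hb x))
      (x₀ := x₀) (x₂ := x₂) (z₁ := z₁) (z₂ := z₂) (τe := τe) (d := d) (αlo := min α₁ α₂)
      (γ₀ := min γ₁ γ₂) (ρ₀ := min ρ₁ ρ₂)
      hτe f4 hd (by positivity) hA hC0 (by positivity) (by positivity)
      (fun τb _ hb' τ hτ x hx => (min_le_left _ _).trans (t₁ τb τe d hb' f1 d1 τ hτ x hx))
      (fun τb _ hb' τ hτ x hx => (min_le_right _ _).trans (t₂ τb τe d hb' f2 d2 τ hτ x hx))
      (by linarith) (by linarith)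
      (fun τ hτ x hx => hnear τ ⟨hτ.1, hτ.2.trans_le f3⟩ (hτ.2.trans_le f4) x (hx.trans_le d3))
      (fun x hx => (min_le_left _ _).trans (hw₁ x (hx.trans (min_le_left _ _))))
      (by linarith [min_le_left ρ₁ ρ₂])
      (fun x hx => (hw₂ x (hx.trans (min_le_right _ _))).trans (neg_le_neg (min_le_right _ _)))
      (by linarith [min_le_right ρ₁ ρ₂])
      (fun x hx => hC x (hx.trans_le d4))

end

theorem RenormSetting.frontSol {m θ c₀ l₀ : ℝ} {f : ℝ → ℝ → ℝ} {κ φ₀ p : ℝ → ℝ} {u : ℝ → ℝ → ℝ}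
    {b ty : ℝ → ℝ} (hm : 1 < m) (h : RenormSetting m f κ θ c₀ l₀ φ₀ p u b ty) {T : ℝ} (hT : 0 < T) :
    ∃ M Q L, FrontSol T M m Q L (fun x v => f x v * (κ x - v)) p b
      (withInitial (fun x => if x ≤ 0 then p x else 0) u) := by
  obtain ⟨⟨hf, hκ, pf, pκ, -⟩, -, hp, ppos, pper, heq, -, -, hu, hbd, -, hfb, hmono, -⟩ := h
  obtain ⟨-, ⟨M₁, hM₁⟩, -⟩ := hu T hT
  obtain ⟨M₂, hM₂⟩ := isCompact_Icc.exists_bound_of_continuousOn (s := Icc (0:ℝ) 1)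
    hp.continuous.continuousOn
  have hpM : ∀ x, p x ≤ M₂ := fun x => by
    have h1 : Function.Periodic p 1 := pper
    have h2 := h1.sub_int_mul_eq (x := x) ⌊x⌋
    rw [mul_one] at h2
    rw [← h2]
    exact (le_abs_self _).trans (hM₂ _ ⟨Int.fract_nonneg x, (Int.fract_lt_one x).le⟩)
  set M := max M₁ M₂ with hM
  have hM0 : 0 ≤ M := (ppos 0).le.trans ((hpM 0).trans (le_max_right _ _))
  obtain ⟨Q, L, hL, hq⟩ := exists_reaction hf hκ pf pκ M
  have ht : ∀ t ∈ Ioc 0 T, ∀ x, withInitial (fun x => if x ≤ 0 then p x else 0) u x t = u x t :=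
    fun t ht x => if_neg (not_le.2 ht.1)
  have h0 : ∀ x, withInitial (fun x => if x ≤ 0 then p x else 0) u x 0 =
      if x ≤ 0 then p x else 0 := fun x => if_pos le_rfl
  refine ⟨M, Q, L, hm, hL, hq, fun x v => by simp only [pf, pκ],
    hatSol_stationary hp ppos (fun x => (hpM x).trans (le_max_right _ _)) hq.cont heq,
    hatSol_withInitial hT (by linarith) hq hu ?_ (fun x => ?_) (fun x t hx => ⟨?_, ?_⟩),
    hp.continuous, ppos, pper, fun x hx => ?_, fun x hx => ?_, fun t htT x hx => ?_,
    fun t htT x hx => ?_, hmono, fun t ht => (hbd t ht).continuousAt.continuousWithinAt⟩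
  · exact Measurable.ite measurableSet_Iic hp.continuous.measurable measurable_const
  · split_ifs
    · exact ⟨(ppos x).le, (hpM x).trans (le_max_right _ _)⟩
    · exact ⟨le_rfl, hM0⟩
  · rcases lt_or_ge x (b t) with hb | hb
    · exact ((hfb t hx.1 x).1 hb).le
    · exact ((hfb t hx.1 x).2 hb).ge
  · exact (le_abs_self _).trans ((hM₁ x t hx).trans (le_max_left _ _))
  · rw [h0, if_pos hx]
  · rw [h0, if_neg (not_le.2 hx)]
  · rw [ht t htT]; exact (hfb t htT.1 x).1 hx
  · rw [ht t htT]; exact (hfb t htT.1 x).2 hx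

/-- In the renormalization setting, the profile shifted by one space unit at
the later crossing time lies strictly below the profile at the earlier crossing time:
`u(x, t_y) > u(x+1, t_{y+1})` for `x < y`, and both vanish for `x ≥ y`. -/
theorem shifted_profile_strictly_below
    (m : ℝ) (hm : 1 < m) (f : ℝ → ℝ → ℝ) (κ : ℝ → ℝ) (θ c₀ l₀ : ℝ) (φ₀ p : ℝ → ℝ)
    (u : ℝ → ℝ → ℝ) (b : ℝ → ℝ) (ty : ℝ → ℝ)
    (hset : RenormSetting m f κ θ c₀ l₀ φ₀ p u b ty) :
    ∀ y > (0:ℝ),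
      (∀ x < y, u (x + 1) (ty (y + 1)) < u x (ty y)) ∧
      (∀ x : ℝ, y ≤ x → u x (ty y) = 0 ∧ u (x + 1) (ty (y + 1)) = 0) := by
  intro y hy
  obtain ⟨-, -, -, -, -, -, -, -, -, -, -, hfb, hmono, -, hdiff, -, hty⟩ := id hset
  obtain ⟨hT, hbT⟩ := hty y hy
  obtain ⟨hT1, hbT1⟩ := hty (y + 1) (by linarith)
  refine ⟨fun x₀ hx₀ => ?_, fun x hx => ⟨(hfb _ hT x).2 (by rwa [hbT]),
    (hfb _ hT1 (x + 1)).2 (by linarith)⟩⟩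
  have hlt : ty y < ty (y + 1) := (hmono.lt_iff_lt hT hT1).1 (by linarith)
  obtain ⟨s, hs⟩ : ∃ s, ty (y + 1) = ty y + s := ⟨ty (y + 1) - ty y, by ring⟩
  have hs0 : 0 < s := by linarith
  rw [hs] at hT1 hbT1 ⊢
  set T := ty y
  obtain ⟨M, Q, L, F⟩ := hset.frontSol hm hT1
  have hb : b (T + s) = b T + 1 := by linarith
  have e : ∀ t > 0, ∀ x, withInitial (fun x => if x ≤ 0 then p x else 0) u x t = u x t :=
    fun t ht x => if_neg (not_le.2 ht)
  have hle : ∀ x, u (x + 1) (T + s) ≤ u x T := fun x => by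
    simpa only [e T hT, e (T + s) hT1] using F.shifted_le hT hs0 hb x
  refine (hle x₀).lt_of_ne fun heq => ?_
  set g : ℝ → ℝ := fun x => u x T - u (x + 1) (T + s) with hg
  have d1 : ∀ x < y, DifferentiableAt ℝ (fun x => u x T) x ∧
      DifferentiableAt ℝ (deriv fun x => u x T) x := fun x hx =>
    (hdiff x T hT ((hfb T hT x).1 (by linarith))).2
  have d2 : ∀ x < y, DifferentiableAt ℝ (fun x => u x (T + s)) (x + 1) ∧
      DifferentiableAt ℝ (deriv fun x => u x (T + s)) (x + 1) := fun x hx =>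
    (hdiff (x + 1) (T + s) hT1 ((hfb _ hT1 (x + 1)).1 (by linarith))).2
  have hgd : ∀ x < y, HasDerivAt g
      (deriv (fun x => u x T) x - deriv (fun x => u x (T + s)) (x + 1)) x := fun x hx =>
    (d1 x hx).1.hasDerivAt.sub ((d2 x hx).1.hasDerivAt.comp_add_const x 1)
  have hnear : ∀ᶠ x in nhds x₀, x < y := Iio_mem_nhds hx₀
  obtain ⟨C, hC0, r, hr, hC⟩ := exists_le_sq_of_touch (g := g) (x₀ := x₀)
    (fun x => sub_nonneg.2 (hle x)) (sub_eq_zero.2 heq.symm)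
    (hnear.mono fun x hx => (hgd x hx).differentiableAt) (by
      have h2 : DifferentiableAt ℝ (fun x => deriv (fun x => u x T) x -
          deriv (fun x => u x (T + s)) (x + 1)) x₀ :=
        (d1 x₀ hx₀).2.sub
          ((d2 x₀ hx₀).2.hasDerivAt.comp_add_const x₀ 1).differentiableAt
      exact h2.congr_of_eventuallyEq (hnear.mono fun x hx => (hgd x hx).deriv))
  refine F.no_touch hT hs0 hb (x₀ := x₀) (C := C) (r := r) (by linarith) ?_ hC0 hr fun x hx => ?_
  · rw [e T hT, e (T + s) hT1]; exact heq
  · rw [e T hT, e (T + s) hT1]; exact hC x hx
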